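/- Let A = kQ/I be a toupie algebra over a field k with t ≥ 2 branches and m = dim_k e_0 A e_∞. Then A is weakly shod and not quasitilted if and only if m = 0 and at least one branch of Q carries more than one relation. -/

import Mathlib

/-!
Formalization preamble for "Toupie algebras".

We realize the bound quiver algebra `A = kQ/I` of a toupie quiver `Q` concretely:
the path algebra `kQ` is realized, via its (faithful) left regular representation,
as the subalgebra of `Module.End k (paths → k)` generated by the operators of left
multiplication by the trivial paths `e_v` and by the arrows of `Q`.  Paths are
composed from left to right (`p * q` = "first `p`, then `q`"), as in
Assem–Simson–Skowroński, so that paths from the source `0` to the sink `∞` span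
`e₀ (kQ) e∞`, and (right) `A`-modules are identified with representations of `(Q, I)`.
Right `A`-modules are formalized as (left) modules over `Aᵐᵒᵖ`.
-/

set_option synthInstance.maxHeartbeats 400000
set_option maxHeartbeats 800000

noncomputable section
open scoped Classical
open MulOpposite

universe u

namespace Toupie

/-- Vertices of a toupie quiver with `t` branches, branch `i` having length `ℓ i ≥ 1`:
the unique source `src`, the unique sink `snk`, and for each branch `i` its interior
vertices `mid i a` (the `(a+1)`-st vertex on branch `i`, for `a : Fin (ℓ i - 1)`). -/
inductive Vtx (t : ℕ) (ℓ : Fin t → ℕ) : Type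
  | src : Vtx t ℓ
  | snk : Vtx t ℓ
  | mid (i : Fin t) (a : Fin (ℓ i - 1)) : Vtx t ℓ

/-- The `a`-th vertex on branch `i`, for `0 ≤ a ≤ ℓ i`
(`a = 0` is the source, `a = ℓ i` is the sink). -/
def vtx (t : ℕ) (ℓ : Fin t → ℕ) (i : Fin t) (a : ℕ) : Vtx t ℓ :=
  if a = 0 then .src else if h : a - 1 < ℓ i - 1 then .mid i ⟨a - 1, h⟩ else .snk

/-- The paths of a toupie quiver: trivial paths at the vertices, and for each branch
`i` and `a < b ≤ ℓ i` the path `sub i a b` along branch `i` from its `a`-th vertex to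
its `b`-th vertex.  (`sub i 0 (ℓ i)` is the `i`-th branch `w i`.) -/
inductive PIdx (t : ℕ) (ℓ : Fin t → ℕ) : Type
  | vert (v : Vtx t ℓ) : PIdx t ℓ
  | sub (i : Fin t) (a b : ℕ) (hab : a < b) (hb : b ≤ ℓ i) : PIdx t ℓ

variable (k : Type u) [Field k] (t : ℕ) (ℓ : Fin t → ℕ)

/-- The vector space with basis the set of paths of the toupie quiver. -/
abbrev PSp : Type u := PIdx t ℓ → k

variable {t ℓ}

/-- The starting vertex of a path. -/
def startIdx : PIdx t ℓ → Vtx t ℓ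
  | .vert v => v
  | .sub i a _ _ _ => vtx t ℓ i a

/-- Left multiplication by the trivial path (primitive idempotent) `e_v`. -/
def Ev (v : Vtx t ℓ) : Module.End k (PSp k t ℓ) where
  toFun f := fun p => if startIdx p = v then f p else 0
  map_add' f g := by funext p; by_cases h : startIdx p = v <;> simp [h]
  map_smul' c f := by funext p; by_cases h : startIdx p = v <;> simp [h]

/-- Strip the `j`-th arrow of branch `i` (the arrow `vtx i j ⟶ vtx i (j+1)`) from the
front of a path, if possible. -/
def strip (i : Fin t) (j : ℕ) : PIdx t ℓ → Option (PIdx t ℓ)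
  | .vert _ => none
  | .sub i' a b _ hb =>
      if h : i' = i ∧ a = j then
        if hb2 : j + 1 < b then some (.sub i (j + 1) b hb2 (h.1 ▸ hb))
        else some (.vert (vtx t ℓ i b))
      else none

/-- Left multiplication by the `j`-th arrow of branch `i`
(the arrow from `vtx i j` to `vtx i (j+1)`, for `j < ℓ i`; the zero operator for junk `j`). -/
def Ar (i : Fin t) (j : ℕ) : Module.End k (PSp k t ℓ) where
  toFun f := fun p => (strip i j p).elim 0 f
  map_add' f g := by funext p; rcases h : strip i j p with _ | q <;> simp [h]
  map_smul' c f := by funext p; rcases h : strip i j p with _ | q <;> simp [h]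

variable (t ℓ)

/-- The generators of the path algebra: the trivial paths and the arrows. -/
def gens : Set (Module.End k (PSp k t ℓ)) :=
  Set.range (Ev k) ∪ {x | ∃ i j, x = Ar k i j}

/-- The path algebra `kQ` of the toupie quiver, realized as the subalgebra of
`Module.End k (PSp k t ℓ)` generated by left multiplication by trivial paths and arrows. -/
def PathAlg : Subalgebra k (Module.End k (PSp k t ℓ)) :=
  Algebra.adjoin k (gens k t ℓ)

variable {k t ℓ}

/-- The trivial path `e_v` as an element of the path algebra. -/
def eV (v : Vtx t ℓ) : PathAlg k t ℓ :=
  ⟨Ev k v, Algebra.subset_adjoin (Or.inl ⟨v, rfl⟩)⟩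

/-- The `j`-th arrow of branch `i` as an element of the path algebra. -/
def arE (i : Fin t) (j : ℕ) : PathAlg k t ℓ :=
  ⟨Ar k i j, Algebra.subset_adjoin (Or.inr ⟨i, j, rfl⟩)⟩

/-- The path along branch `i` from its `a`-th vertex to its `b`-th vertex, as an element
of the path algebra: the product (composed from left to right) of the arrows
`a → a+1 → ⋯ → b`.  (For `b ≤ a` this is the empty product `1`.) -/
def subE (i : Fin t) (a b : ℕ) : PathAlg k t ℓ :=
  (((List.range (b - a)).map fun s => arE i (a + s)).prod)

/-- The `i`-th branch `w i` (the path from the source to the sink along branch `i`)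
as an element of the path algebra. -/
def wE (i : Fin t) : PathAlg k t ℓ := subE i 0 (ℓ i)

variable {k : Type u} [Field k]

/-- A toupie algebra `A = kQ/I`: a toupie quiver `Q` (a non-linear quiver with a unique
source, a unique sink, and all other vertices having exactly one incoming and one
outgoing arrow, i.e. `t ≥ 2` branches of lengths `ℓ i ≥ 1`), together with an admissible
ideal `I` of the path algebra `kQ`.  Since `Q` is finite and acyclic, the arrow ideal is
nilpotent, so admissibility amounts to `I ⊆ R_Q²`, i.e. every element of `I` is a linear
combination of paths of length `≥ 2`. -/
structure ToupieAlg (k : Type u) [Field k] : Type u where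
  t : ℕ
  ht : 2 ≤ t
  ℓ : Fin t → ℕ
  hℓ : ∀ i, 1 ≤ ℓ i
  I : TwoSidedIdeal (PathAlg k t ℓ)
  adm : ∀ x ∈ I, x ∈ Submodule.span k
    {y : PathAlg k t ℓ | ∃ i a b, a + 2 ≤ b ∧ b ≤ ℓ i ∧ y = subE i a b}

variable (T : ToupieAlg k)

/-- The underlying algebra `A = kQ/I` of a toupie algebra. -/
def Alg : Type u := T.I.ringCon.Quotient

instance : Ring (Alg T) := inferInstanceAs (Ring T.I.ringCon.Quotient)

/-- The quotient map `kQ → A = kQ/I`. -/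
def mkA : PathAlg k T.t T.ℓ →+* Alg T := T.I.ringCon.mk'

lemma mkA_surjective : Function.Surjective (mkA T) := Quotient.mk''_surjective

instance : Algebra k (Alg T) :=
  RingHom.toAlgebra' ((mkA T).comp (algebraMap k (PathAlg k T.t T.ℓ)))
    (by
      intro c x
      obtain ⟨y, rfl⟩ := mkA_surjective T x
      simp only [RingHom.coe_comp, Function.comp_apply, ← map_mul]
      rw [Algebra.commutes])

/-- The idempotent `e₀` (at the source) in `A`. -/
def e0 : Alg T := mkA T (eV Vtx.src)

/-- The idempotent `e∞` (at the sink) in `A`. -/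
def einf : Alg T := mkA T (eV Vtx.snk)

/-- The `k`-linear map `A → A`, `x ↦ e₀ * x * e∞`, whose range is `e₀ A e∞`. -/
def lrMap : Alg T →ₗ[k] Alg T where
  toFun x := e0 T * x * einf T
  map_add' x y := by simp [mul_add, add_mul]
  map_smul' c x := by
    simp only [RingHom.id_apply]
    rw [mul_smul_comm, smul_mul_assoc]

/-- `m = dim_k e₀ A e∞`, the dimension of the span of the (residues of the) paths from
the source to the sink. -/
def mDim : ℕ := Module.finrank k ↥(LinearMap.range (lrMap T))

/-- The branch `w i` lies in the ideal `I`. -/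
def branchInI (i : Fin T.t) : Prop := wE i ∈ T.I

/-- A minimal relation: `∑_{i ∈ J} λ i • w i ∈ I` with `|J| ≥ 2`, all `λ i ≠ 0`, and no
nonempty proper subsum in `I`. -/
def MinRel (J : Finset (Fin T.t)) (lam : Fin T.t → k) : Prop :=
  2 ≤ J.card ∧ (∀ i ∈ J, lam i ≠ 0) ∧ (∑ i ∈ J, lam i • wE i) ∈ T.I ∧
    ∀ J' ⊂ J, J'.Nonempty → (∑ i ∈ J', lam i • wE i) ∉ T.I

/-- A toupie algebra is simply connected if any two distinct branches are involved in a
common minimal relation. -/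
def SimplyConnected : Prop :=
  ∀ i j : Fin T.t, i ≠ j → ∃ J lam, MinRel T J lam ∧ i ∈ J ∧ j ∈ J

/-- A (minimal) zero-relation on branch `i`: the subpath of branch `i` from its `a`-th
to its `b`-th vertex lies in `I`, but no proper subpath of it does. -/
def ZeroRel (i : Fin T.t) (a b : ℕ) : Prop :=
  a < b ∧ b ≤ T.ℓ i ∧ subE i a b ∈ T.I ∧
    ∀ a' b', a ≤ a' → b' ≤ b → a' < b' → (a', b') ≠ (a, b) → subE i a' b' ∉ T.I

/-- There is exactly one relation on branch `i`. -/
def ExactlyOneRel (i : Fin T.t) : Prop := ∃! p : ℕ × ℕ, ZeroRel T i p.1 p.2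

/-- Branch `i` carries more than one relation. -/
def MoreThanOneRel (i : Fin T.t) : Prop :=
  ∃ p q : ℕ × ℕ, p ≠ q ∧ ZeroRel T i p.1 p.2 ∧ ZeroRel T i q.1 q.2

/-- At most one branch of `Q` has length at least three. -/
def AtMostOneLongBranch : Prop := ∀ i j : Fin T.t, 3 ≤ T.ℓ i → 3 ≤ T.ℓ j → i = j

/-- The two-sided ideal `I` is generated by the set `S`. -/
def IsGenBy {R : Type u} [Ring R] (I : TwoSidedIdeal R) (S : Set R) : Prop :=
  S ⊆ (I : Set R) ∧ ∀ J : TwoSidedIdeal R, S ⊆ (J : Set R) → (I : Set R) ⊆ (J : Set R)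

/-- A toupie algebra is canonical if (after choosing two distinguished branches `i₁, i₂`)
its ideal is generated by `{w i₁ + λ j • w i₂ - w j}` over the remaining branches `j`,
with the `λ j` pairwise distinct and nonzero. -/
def IsCanonical : Prop :=
  ∃ (i₁ i₂ : Fin T.t) (lam : Fin T.t → k), i₁ ≠ i₂ ∧
    (∀ j, j ≠ i₁ → j ≠ i₂ → lam j ≠ 0) ∧
    (∀ j j', j ≠ i₁ → j ≠ i₂ → j' ≠ i₁ → j' ≠ i₂ → j ≠ j' → lam j ≠ lam j') ∧
    IsGenBy T.I {x | ∃ j, j ≠ i₁ ∧ j ≠ i₂ ∧ x = wE i₁ + lam j • wE i₂ - wE j}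

end Toupie
namespace Toupie

/-! ### Module-theoretic notions over an arbitrary ring

Following the paper, all modules are finite-dimensional *right* modules; a right
`A`-module is formalized as a (left) module over `Aᵐᵒᵖ`.  The definitions below are
stated for modules over an arbitrary ring `R` and are applied with `R := Aᵐᵒᵖ`. -/

variable (R : Type u) [Ring R]

/-- A module is indecomposable if it is nonzero and its only idempotent endomorphisms
are `0` and the identity. -/
def Indec (M : ModuleCat.{u} R) : Prop :=
  Nontrivial M ∧ ∀ f : M →ₗ[R] M, f.comp f = f → f = 0 ∨ f = LinearMap.id

/-- Finiteness ("finite dimensionality") of a module. -/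
def FdMod (M : ModuleCat.{u} R) : Prop := Module.Finite R M

/-- `M` has projective dimension at most one: it is the quotient of a projective module
by a projective submodule. -/
def PdLeOne (M : ModuleCat.{u} R) : Prop :=
  ∃ (P : ModuleCat.{u} R) (f : P →ₗ[R] M), Function.Surjective f ∧
    Module.Projective R P ∧ Module.Projective R ↥(LinearMap.ker f)

/-- `M` has injective dimension at most one: it embeds in an injective module with
injective cokernel. -/
def IdLeOne (M : ModuleCat.{u} R) : Prop :=
  ∃ (E : ModuleCat.{u} R) (f : M →ₗ[R] E), Function.Injective f ∧
    Module.Injective R E ∧ Module.Injective R (E ⧸ LinearMap.range f)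

/-- One step of a path in `ind R`: a nonzero non-isomorphism between (finite-dimensional)
indecomposable modules. -/
def Step (M N : ModuleCat.{u} R) : Prop :=
  Indec R M ∧ FdMod R M ∧ Indec R N ∧ FdMod R N ∧
    ∃ f : M →ₗ[R] N, f ≠ 0 ∧ ¬ Function.Bijective f

/-- A path in `ind R` from `M` to `N` (possibly trivial): a chain
`M = M₀ → M₁ → ⋯ → Mₙ = N` of nonzero non-isomorphisms between indecomposables. -/
def IndPath (M N : ModuleCat.{u} R) : Prop := Relation.ReflTransGen (Step R) M N

/-- The left part `L_R`: the indecomposable (finite-dimensional) modules `M` such that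
every indecomposable `X` with a path `X ⇝ M` in `ind R` has projective dimension `≤ 1`. -/
def InLeftPart (M : ModuleCat.{u} R) : Prop :=
  Indec R M ∧ FdMod R M ∧
    ∀ X : ModuleCat.{u} R, Indec R X → FdMod R X → IndPath R X M → PdLeOne R X

/-- The right part `R_R`: the indecomposable (finite-dimensional) modules `M` such that
every indecomposable `X` with a path `M ⇝ X` in `ind R` has injective dimension `≤ 1`. -/
def InRightPart (M : ModuleCat.{u} R) : Prop :=
  Indec R M ∧ FdMod R M ∧
    ∀ X : ModuleCat.{u} R, Indec R X → FdMod R X → IndPath R M X → IdLeOne R X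

/-- Hereditary: global dimension at most one, i.e. every module has projective dimension
at most one. -/
def Hereditary : Prop := ∀ M : ModuleCat.{u} R, PdLeOne R M

/-- Quasitilted: every indecomposable projective module lies in the left part. -/
def Quasitilted : Prop :=
  ∀ P : ModuleCat.{u} R, Indec R P → FdMod R P → Module.Projective R P → InLeftPart R P

/-- A module is directed if it lies on no cycle of nonzero non-isomorphisms between
indecomposables in `ind R`. -/
def Directed (M : ModuleCat.{u} R) : Prop := ¬ Relation.TransGen (Step R) M M

/-- Weakly shod: every indecomposable (finite-dimensional) module not lying in
`L_R ∪ R_R` is directed. -/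
def WeaklyShod : Prop :=
  ∀ M : ModuleCat.{u} R, Indec R M → FdMod R M →
    ¬ InLeftPart R M → ¬ InRightPart R M → Directed R M

/-- Laura: all but finitely many isomorphism classes of indecomposable
(finite-dimensional) modules lie in `L_R ∪ R_R`. -/
def Laura : Prop :=
  ∃ S : Set (ModuleCat.{u} R), S.Finite ∧
    ∀ M : ModuleCat.{u} R, Indec R M → FdMod R M →
      ¬ InLeftPart R M → ¬ InRightPart R M → ∃ N ∈ S, Nonempty (M ≃ₗ[R] N)

/-- There are exactly `n` isomorphism classes of modules satisfying `P`. -/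
def NumClasses (P : ModuleCat.{u} R → Prop) (n : ℕ) : Prop :=
  ∃ f : Fin n → ModuleCat.{u} R, (∀ i, P (f i)) ∧
    (∀ i j, Nonempty ((f i : Type u) ≃ₗ[R] (f j : Type u)) → i = j) ∧
    ∀ M : ModuleCat.{u} R, P M → ∃ i, Nonempty ((M : Type u) ≃ₗ[R] (f i : Type u))

/-- `M` is (isomorphic to) a direct summand of `T`. -/
def IsSummandOf (T : Type u) [AddCommGroup T] [Module R T] (M : ModuleCat.{u} R) : Prop :=
  ∃ N N' : Submodule R T, IsCompl N N' ∧ Nonempty ((M : Type u) ≃ₗ[R] N)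

/-- `Ext¹_R(T, T) = 0`: every self-extension `0 → T → E → T → 0` splits. -/
def SelfExtVanish (T : Type u) [AddCommGroup T] [Module R T] : Prop :=
  ∀ (E : Type u) [AddCommGroup E] [Module R E] (ι : T →ₗ[R] E) (π : E →ₗ[R] T),
    Function.Injective ι → Function.Surjective π → LinearMap.range ι = LinearMap.ker π →
      ∃ s : T →ₗ[R] E, π.comp s = LinearMap.id

/-- A tilting module over a hereditary algebra: a finite module with `Ext¹(T,T) = 0`
having as many pairwise non-isomorphic indecomposable direct summands as there are
simple modules. -/
def IsTiltingMod (T : Type u) [AddCommGroup T] [Module R T] : Prop :=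
  Module.Finite R T ∧ SelfExtVanish R T ∧
    ∃ n : ℕ, NumClasses R (fun M => Indec R M ∧ IsSummandOf R T M) n ∧
      NumClasses R (fun M => IsSimpleModule R M) n

variable (k : Type u) [Field k]

/-- A `k`-algebra `A` is tilted if it is the endomorphism algebra of a tilting (right)
module over a hereditary finite-dimensional `k`-algebra `H`.  (Right `H`-modules are
modules over `Hᵐᵒᵖ`; the isomorphism `A ≅ End_H T` is a `k`-linear ring isomorphism.) -/
def IsTilted (A : Type u) [Ring A] [Algebra k A] : Prop :=
  ∃ (H : Type u) (_ : Ring H) (_ : Algebra k H),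
    FiniteDimensional k H ∧ Hereditary Hᵐᵒᵖ ∧
      ∃ (T : Type u) (_ : AddCommGroup T) (_ : Module Hᵐᵒᵖ T),
        IsTiltingMod Hᵐᵒᵖ T ∧
          ∃ (_ : Module k T) (_ : SMulCommClass Hᵐᵒᵖ k T) (_ : IsScalarTower k Hᵐᵒᵖ T)
            (φ : A ≃+* Module.End Hᵐᵒᵖ T), ∀ (c : k) (x : A), φ (c • x) = c • φ x

end Toupie
namespace Toupie

variable {k : Type u} [Field k] (T : ToupieAlg k)

/-! ### Right `A`-modules as representations of `(Q, I)`

For a right `A`-module `M` (a module over `Aᵐᵒᵖ`) and a vertex `v`, the space of the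
corresponding representation at `v` is `M_v = M • e_v`. -/

/-- The action of the idempotent `e_v ∈ A` on a right `A`-module (= `Aᵐᵒᵖ`-module). -/
def actV (v : Vtx T.t T.ℓ) : (Alg T)ᵐᵒᵖ := op (mkA T (eV v))

/-- The space `M_v = M • e_v` of the representation `M` at the vertex `v` is zero. -/
def VanishAt (M : ModuleCat.{u} (Alg T)ᵐᵒᵖ) (v : Vtx T.t T.ℓ) : Prop :=
  ∀ m : M, actV T v • m = 0

/-- Every simple summand of `top M = M / rad M` is one of the simple modules `S_v`,
`v ∈ vs`: for every maximal submodule `N` the simple quotient `M/N` is supported at some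
vertex of `vs` (for an admissible quotient of a path algebra, the simple module `S_v` is
the unique simple on which `e_v` acts nontrivially). -/
def TopIn (M : ModuleCat.{u} (Alg T)ᵐᵒᵖ) (vs : Set (Vtx T.t T.ℓ)) : Prop :=
  ∀ N : Submodule (Alg T)ᵐᵒᵖ M, IsCoatom N → ∃ v ∈ vs, ∃ m : M, actV T v • m ∉ N

/-- Every simple summand of the socle of `M` is one of the simple modules `S_v`,
`v ∈ vs`: every simple submodule `N ≤ M` is supported at some vertex of `vs`. -/
def SocIn (M : ModuleCat.{u} (Alg T)ᵐᵒᵖ) (vs : Set (Vtx T.t T.ℓ)) : Prop :=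
  ∀ N : Submodule (Alg T)ᵐᵒᵖ M, IsAtom N → ∃ v ∈ vs, ∃ m ∈ N, actV T v • m ≠ 0

/-- The module `D x y` (for two positions `0 ≤ x, y ≤ ℓ i₀` on the unique branch `i₀`
lying in `I`, and an auxiliary branch `i₂ ≠ i₀`): the right `A`-module with generators
`g = e₀` (at the source) and `h = e_y` (at the `y`-th vertex of branch `i₀`), subject to
the relations `g ⬝ (subpath of w i₀ from 0 to x+1) = 0` and
`g ⬝ w i₂ = h ⬝ (subpath of w i₀ from y to ℓ i₀)`.  It is presented as the quotient of
the right regular module `A ⊕ A` by the right submodule generated by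
`(1 - e₀, 0)`, `(0, 1 - e_y)`, `(subE i₀ 0 (min (x+1) (ℓ i₀)), 0)` and
`(w i₂, - subE i₀ y (ℓ i₀))`. -/
abbrev Dmod (i₀ i₂ : Fin T.t) (x y : ℕ) : Type u :=
  (Alg T × Alg T) ⧸ Submodule.span (Alg T)ᵐᵒᵖ
    ({((mkA T (1 - eV Vtx.src) : Alg T), (0 : Alg T)),
      ((0 : Alg T), (mkA T (1 - eV (vtx T.t T.ℓ i₀ y)) : Alg T)),
      ((mkA T (subE i₀ 0 (min (x + 1) (T.ℓ i₀))) : Alg T), (0 : Alg T)),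
      ((mkA T (wE i₂) : Alg T), (- mkA T (subE i₀ y (T.ℓ i₀)) : Alg T))} :
        Set (Alg T × Alg T))

end Toupie

namespace Toupie

open scoped RightActions

section PathAlgebra

variable {t : ℕ} {ℓ : Fin t → ℕ}

instance : Fintype (Vtx t ℓ) :=
  Fintype.ofInjective
    (fun v : Vtx t ℓ => (match v with
      | .src => none
      | .snk => some none
      | .mid i a => some (some ⟨i, a⟩) : Option (Option (Σ i : Fin t, Fin (ℓ i - 1)))))
    (by
      intro v w h
      cases v <;> cases w <;> simp at h ⊢
      exact h)

lemma vtx_zero (i : Fin t) : vtx t ℓ i 0 = .src := by simp [vtx]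

lemma vtx_of_le {i : Fin t} {a : ℕ} (h0 : 0 < a) (h : ℓ i ≤ a) : vtx t ℓ i a = .snk := by
  have h1 : ¬ a - 1 < ℓ i - 1 := by omega
  have h2 : a ≠ 0 := by omega
  simp [vtx, h1, h2]

lemma vtx_of_lt {i : Fin t} {a : ℕ} (h0 : 0 < a) (h : a < ℓ i) :
    vtx t ℓ i a = .mid i ⟨a - 1, by omega⟩ := by
  have h1 : a - 1 < ℓ i - 1 := by omega
  have h2 : a ≠ 0 := by omega
  simp [vtx, h1, h2]

lemma vtx_cases {i : Fin t} (a : ℕ) :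
    (a = 0 ∧ vtx t ℓ i a = .src) ∨ ((0 < a ∧ a < ℓ i) ∧ ∃ h, vtx t ℓ i a = .mid i ⟨a - 1, h⟩) ∨
      ((0 < a ∧ ℓ i ≤ a) ∧ vtx t ℓ i a = .snk) := by
  rcases Nat.eq_zero_or_pos a with rfl | h0
  · exact Or.inl ⟨rfl, vtx_zero i⟩
  · rcases lt_or_ge a (ℓ i) with h | h
    · exact Or.inr (Or.inl ⟨⟨h0, h⟩, by omega, vtx_of_lt h0 h⟩)
    · exact Or.inr (Or.inr ⟨⟨h0, h⟩, vtx_of_le h0 h⟩)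

lemma vtx_interior_inj {i j : Fin t} {a b : ℕ} (hb0 : 0 < b) (hb : b < ℓ j)
    (h : vtx t ℓ i a = vtx t ℓ j b) : i = j ∧ a = b := by
  rw [vtx_of_lt hb0 hb] at h
  rcases vtx_cases (ℓ := ℓ) (i := i) a with ⟨_, h'⟩ | ⟨⟨h0, _⟩, _, h'⟩ | ⟨_, h'⟩ <;> rw [h'] at h
  · cases h
  · injection h with h1 h2
    subst h1
    simp only [heq_eq_eq, Fin.mk.injEq] at h2
    exact ⟨rfl, by omega⟩
  · cases h

lemma vtx_inj {i : Fin t} {a b : ℕ} (ha : a ≤ ℓ i) (hb : b ≤ ℓ i)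
    (h : vtx t ℓ i a = vtx t ℓ i b) : a = b := by
  rcases vtx_cases (ℓ := ℓ) (i := i) a with ⟨_, h1⟩ | ⟨⟨_, _⟩, _, h1⟩ | ⟨_, h1⟩ <;>
  rcases vtx_cases (ℓ := ℓ) (i := i) b with ⟨_, h2⟩ | ⟨⟨_, _⟩, _, h2⟩ | ⟨_, h2⟩ <;>
  rw [h1, h2] at h <;> first | cases h | skip
  · omega
  · simp only [Vtx.mid.injEq, heq_eq_eq, Fin.mk.injEq, true_and] at h
    omega
  · omega

lemma vtx_exhaust (v : Vtx t ℓ) :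
    v = .src ∨ v = .snk ∨ ∃ i a, 0 < a ∧ a < ℓ i ∧ v = vtx t ℓ i a := by
  rcases v with _ | _ | ⟨i, a⟩
  · simp
  · simp
  · refine Or.inr (Or.inr ⟨i, a + 1, by omega, by omega, ?_⟩)
    rw [vtx_of_lt (by omega) (by omega)]
    simp

/-- A rank function on the vertices which increases along arrows. -/
def rk : Vtx t ℓ → ℕ
  | .src => 0
  | .snk => (∑ i, ℓ i) + 1
  | .mid _ a => a + 1

lemma rk_vtx {i : Fin t} {a : ℕ} (ha : a < ℓ i) : rk (vtx t ℓ i a) = a := by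
  rcases vtx_cases (ℓ := ℓ) (i := i) a with ⟨h, h1⟩ | ⟨⟨_, _⟩, _, h1⟩ | ⟨_, h1⟩ <;> rw [h1]
  · simp [rk, h]
  · simp only [rk]; omega
  · omega

lemma rk_vtx_lt {i : Fin t} {a b : ℕ} (hab : a < b) (hb : b ≤ ℓ i) :
    rk (vtx t ℓ i a) < rk (vtx t ℓ i b) := by
  rw [rk_vtx (by omega)]
  rcases hb.lt_or_eq with h | h
  · rwa [rk_vtx h]
  · rw [vtx_of_le (by omega) h.ge]
    have := Finset.single_le_sum (f := ℓ) (fun _ _ => Nat.zero_le _) (Finset.mem_univ i)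
    simp only [rk]; omega

variable (k : Type u) [Field k]

lemma Ev_mul_Ev (v w : Vtx t ℓ) : Ev k v * Ev k w = if v = w then Ev k v else 0 := by
  refine LinearMap.ext fun f => funext fun p => ?_
  by_cases h : v = w
  · subst h
    by_cases h1 : startIdx p = v <;> simp [Ev, h1]
  · by_cases h1 : startIdx p = v
    · simp [Ev, h1, h]
    · simp [Ev, h1, h]

lemma sum_Ev : ∑ v : Vtx t ℓ, Ev k v = 1 := by
  refine LinearMap.ext fun f => funext fun p => ?_
  simp [Ev, LinearMap.sum_apply, Finset.sum_apply]

lemma Ar_eq_zero {i : Fin t} {j : ℕ} (h : ℓ i ≤ j) : Ar k (ℓ := ℓ) i j = 0 := by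
  refine LinearMap.ext fun f => funext fun p => ?_
  rcases p with v | ⟨i', a, b, hab, hb⟩
  · simp [Ar, strip]
  · have : ¬ (i' = i ∧ a = j) := by rintro ⟨rfl, rfl⟩; omega
    simp [Ar, strip, this]

lemma Ev_mul_Ar (i : Fin t) (j : ℕ) : Ev k (vtx t ℓ i j) * Ar k i j = Ar k i j := by
  refine LinearMap.ext fun f => funext fun p => ?_
  rcases p with v | ⟨i', a, b, hab, hb⟩
  · simp [Ar, Ev, strip]
  · by_cases h : i' = i ∧ a = j
    · obtain ⟨rfl, rfl⟩ := h
      simp [Ar, Ev, startIdx]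
    · simp [Ar, Ev, strip, h]

lemma Ar_mul_Ev (i : Fin t) (j : ℕ) : Ar k i j * Ev k (vtx t ℓ i (j + 1)) = Ar k i j := by
  refine LinearMap.ext fun f => funext fun p => ?_
  rcases p with v | ⟨i', a, b, hab, hb⟩
  · simp [Ar, strip]
  · by_cases h : i' = i ∧ a = j
    · obtain ⟨rfl, rfl⟩ := h
      by_cases h2 : a + 1 < b
      · simp [Ar, Ev, strip, startIdx, h2]
      · have : b = a + 1 := by omega
        subst this
        simp [Ar, Ev, strip, startIdx]
    · simp [Ar, Ev, strip, h]

lemma eV_mul_eV (v w : Vtx t ℓ) :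
    (eV v * eV w : PathAlg k t ℓ) = if v = w then eV v else 0 := by
  apply Subtype.ext
  have := Ev_mul_Ev k v w
  split_ifs at this ⊢ <;> exact this

lemma sum_eV : ∑ v : Vtx t ℓ, (eV v : PathAlg k t ℓ) = 1 := by
  apply Subtype.ext
  rw [AddSubmonoidClass.coe_finsetSum]
  exact sum_Ev k

lemma arE_eq_zero {i : Fin t} {j : ℕ} (h : ℓ i ≤ j) : (arE i j : PathAlg k t ℓ) = 0 :=
  Subtype.ext (Ar_eq_zero k h)

lemma eV_mul_arE (i : Fin t) (j : ℕ) : (eV (vtx t ℓ i j) * arE i j : PathAlg k t ℓ) = arE i j :=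
  Subtype.ext (Ev_mul_Ar k i j)

lemma arE_mul_eV (i : Fin t) (j : ℕ) :
    (arE i j * eV (vtx t ℓ i (j + 1)) : PathAlg k t ℓ) = arE i j :=
  Subtype.ext (Ar_mul_Ev k i j)

lemma subE_of_le {i : Fin t} {a b : ℕ} (h : b ≤ a) : (subE i a b : PathAlg k t ℓ) = 1 := by
  simp [subE, Nat.sub_eq_zero_of_le h]

lemma subE_succ {i : Fin t} {a b : ℕ} (h : a ≤ b) :
    (subE i a (b + 1) : PathAlg k t ℓ) = subE i a b * arE i b := by
  simp [subE, Nat.succ_sub h, List.range_succ, Nat.add_sub_cancel' h]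

lemma subE_cons {i : Fin t} {a b : ℕ} (h : a < b) :
    (subE i a b : PathAlg k t ℓ) = arE i a * subE i (a + 1) b := by
  have h1 : b - a = (b - (a + 1)) + 1 := by omega
  rw [subE, h1, List.range_succ_eq_map]
  simp [subE, Function.comp_def, Nat.add_assoc, Nat.add_comm 1]

end PathAlgebra

section BoundQuiverAlgebra

variable {k : Type u} [Field k] (T : ToupieAlg k)

/-- The `a`-th vertex on branch `i` of the quiver of a toupie algebra. -/
abbrev vt (i : Fin T.t) (a : ℕ) : Vtx T.t T.ℓ := vtx T.t T.ℓ i a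

/-- The idempotent of the toupie algebra at the vertex `v`. -/
def e (v : Vtx T.t T.ℓ) : Alg T := mkA T (eV v)

/-- The class in the toupie algebra of the `j`-th arrow of branch `i`. -/
def ar (i : Fin T.t) (j : ℕ) : Alg T := mkA T (arE i j)

/-- The class in the toupie algebra of the path from the `a`-th to the `b`-th vertex of
branch `i`. -/
def pp (i : Fin T.t) (a b : ℕ) : Alg T := e T (vt T i a) * mkA T (subE i a b)

lemma vt_zero (i : Fin T.t) : vt T i 0 = .src := vtx_zero i

lemma vt_len (i : Fin T.t) : vt T i (T.ℓ i) = .snk := vtx_of_le (T.hℓ i) le_rfl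

lemma vt_exhaust (v : Vtx T.t T.ℓ) :
    v = .src ∨ v = .snk ∨ ∃ i a, 0 < a ∧ a < T.ℓ i ∧ v = vt T i a := vtx_exhaust v

lemma vt_ne_snk {i : Fin T.t} {a : ℕ} (h : a < T.ℓ i) : vt T i a ≠ .snk := by
  intro h1
  have := vtx_inj h.le le_rfl (h1.trans (vt_len T i).symm)
  omega

lemma vt_ne_src {i : Fin T.t} {a : ℕ} (h : 0 < a) : vt T i a ≠ .src := by
  intro h1
  rcases vtx_cases (ℓ := T.ℓ) (i := i) a with ⟨h, h2⟩ | ⟨⟨_, _⟩, _, h2⟩ | ⟨_, h2⟩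
  · omega
  · simp [h2] at h1
  · simp [h2] at h1

lemma e_mul_e (v w : Vtx T.t T.ℓ) : e T v * e T w = if v = w then e T v else 0 := by
  rw [e, e, ← map_mul, eV_mul_eV]
  split_ifs <;> simp

@[simp] lemma e_mul_self (v : Vtx T.t T.ℓ) : e T v * e T v = e T v := by simp [e_mul_e]

lemma e_mul_of_ne {v w : Vtx T.t T.ℓ} (h : v ≠ w) : e T v * e T w = 0 := by simp [e_mul_e, h]

lemma sum_e : ∑ v, e T v = 1 := by
  simp only [e, ← map_sum, sum_eV, map_one]

lemma ar_eq_zero {i : Fin T.t} {j : ℕ} (h : T.ℓ i ≤ j) : ar T i j = 0 := by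
  rw [ar, arE_eq_zero k h, map_zero]

@[simp] lemma e_mul_ar (i : Fin T.t) (j : ℕ) : e T (vt T i j) * ar T i j = ar T i j := by
  rw [e, ar, ← map_mul, eV_mul_arE]

@[simp] lemma ar_mul_e (i : Fin T.t) (j : ℕ) : ar T i j * e T (vt T i (j + 1)) = ar T i j := by
  rw [e, ar, ← map_mul, arE_mul_eV]

lemma e_mul_ar_of_ne {v : Vtx T.t T.ℓ} {i : Fin T.t} {j : ℕ} (h : v ≠ vt T i j) :
    e T v * ar T i j = 0 := by
  rw [← e_mul_ar, ← mul_assoc, e_mul_of_ne T h, zero_mul]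

lemma ar_mul_e_of_ne {v : Vtx T.t T.ℓ} {i : Fin T.t} {j : ℕ} (h : v ≠ vt T i (j + 1)) :
    ar T i j * e T v = 0 := by
  rw [← ar_mul_e, mul_assoc, e_mul_of_ne T h.symm, mul_zero]

lemma pp_of_le {i : Fin T.t} {a b : ℕ} (h : b ≤ a) : pp T i a b = e T (vt T i a) := by
  rw [pp, subE_of_le k h, map_one, mul_one]

@[simp] lemma pp_self (i : Fin T.t) (a : ℕ) : pp T i a a = e T (vt T i a) := pp_of_le T le_rfl

lemma pp_succ {i : Fin T.t} {a b : ℕ} (h : a ≤ b) :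
    pp T i a (b + 1) = pp T i a b * ar T i b := by
  rw [pp, pp, subE_succ k h, map_mul, ar, mul_assoc]

@[simp] lemma pp_self_succ (i : Fin T.t) (a : ℕ) : pp T i a (a + 1) = ar T i a := by
  rw [pp_succ T le_rfl, pp_self, e_mul_ar]

lemma pp_cons {i : Fin T.t} {a b : ℕ} (h : a < b) :
    pp T i a b = ar T i a * pp T i (a + 1) b := by
  rw [pp, subE_cons k h, map_mul, pp, ← mul_assoc, ← ar, e_mul_ar, ← mul_assoc, ar_mul_e]

@[simp] lemma e_mul_pp (i : Fin T.t) (a b : ℕ) : e T (vt T i a) * pp T i a b = pp T i a b := by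
  rw [pp, ← mul_assoc, e_mul_self]

lemma pp_mul_e {i : Fin T.t} {a b : ℕ} (h : a ≤ b) :
    pp T i a b * e T (vt T i b) = pp T i a b := by
  rcases h.eq_or_lt with rfl | h
  · simp
  · obtain ⟨b, rfl⟩ : ∃ c, b = c + 1 := ⟨b - 1, by omega⟩
    rw [pp_succ T (by omega), mul_assoc, ar_mul_e]

lemma e_mul_pp_of_ne {v : Vtx T.t T.ℓ} {i : Fin T.t} {a b : ℕ} (h : v ≠ vt T i a) :
    e T v * pp T i a b = 0 := by
  rw [← e_mul_pp, ← mul_assoc, e_mul_of_ne T h, zero_mul]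

lemma pp_mul_e_of_ne {v : Vtx T.t T.ℓ} {i : Fin T.t} {a b : ℕ} (hab : a ≤ b)
    (h : v ≠ vt T i b) : pp T i a b * e T v = 0 := by
  rw [← pp_mul_e T hab, mul_assoc, e_mul_of_ne T h.symm, mul_zero]

lemma pp_mul_pp {i : Fin T.t} {a b c : ℕ} (hab : a ≤ b) (hbc : b ≤ c) :
    pp T i a b * pp T i b c = pp T i a c := by
  induction c, hbc using Nat.le_induction with
  | base => rw [pp_self, pp_mul_e T hab]
  | succ c hbc ih => rw [pp_succ T hbc, ← mul_assoc, ih, pp_succ T (hab.trans hbc)]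

lemma mkA_eq_zero_iff (x : PathAlg k T.t T.ℓ) : mkA T x = 0 ↔ x ∈ T.I := by
  rw [TwoSidedIdeal.mem_iff, ← map_zero (mkA T)]
  exact ⟨fun h => Quotient.exact' h, fun h => Quotient.sound' h⟩

lemma subE_mem_iff {i : Fin T.t} {a b : ℕ} (h : a < b) : subE i a b ∈ T.I ↔ pp T i a b = 0 := by
  have h1 : pp T i a b = mkA T (subE i a b) := by
    rw [pp, subE_cons k h, map_mul, ← mul_assoc, ← ar, e_mul_ar]
  rw [h1, mkA_eq_zero_iff]

/-- The function on paths which is `1` on trivial paths and `0` on the others. -/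
def trivInd : PSp k T.t T.ℓ
  | .vert _ => 1
  | .sub .. => 0

lemma trivInd_eq_zero_of_mem {x : PathAlg k T.t T.ℓ} (hx : x ∈ T.I) :
    (∀ v, x.1 (trivInd T) (.vert v) = 0) ∧
      ∀ i j (h : j + 1 ≤ T.ℓ i), x.1 (trivInd T) (.sub i j (j + 1) (Nat.lt_succ_self j) h) = 0 := by
  refine Submodule.span_induction ?_ ?_ ?_ ?_ (T.adm x hx)
  · rintro _ ⟨i, a, b, hab, hb, rfl⟩
    rw [subE_cons k (by omega), subE_cons k (by omega)]
    have key : ∀ (g : PSp k T.t T.ℓ) v, Ar k i (a + 1) g (.vert v) = 0 := by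
      intro g v; simp [Ar, strip]
    have hmul : ∀ (i : Fin T.t) j (y : PathAlg k T.t T.ℓ) g,
        (arE i j * y).1 g = Ar k i j (y.1 g) := fun _ _ _ _ => rfl
    refine ⟨fun v => ?_, fun i' j h => ?_⟩
    · rw [hmul]; simp [Ar, strip]
    · rw [hmul, hmul]
      by_cases h2 : i' = i ∧ j = a
      · obtain ⟨rfl, rfl⟩ := h2
        rw [Ar]
        simp only [LinearMap.coe_mk, AddHom.coe_mk, strip, and_self, dif_pos, lt_irrefl, dif_neg,
          not_false_eq_true, Option.elim_some]
        simpa using key _ _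
      · simp [Ar, strip, h2]
  · simp
  · rintro x y _ _ ⟨h1, h2⟩ ⟨h3, h4⟩
    exact ⟨fun v => by simp [h1 v, h3 v], fun i j h => by simp [h2 i j h, h4 i j h]⟩
  · rintro c x _ ⟨h1, h2⟩
    exact ⟨fun v => by simp [h1 v], fun i j h => by simp [h2 i j h]⟩

lemma e_ne_zero (v : Vtx T.t T.ℓ) : e T v ≠ 0 := by
  intro h
  have := (trivInd_eq_zero_of_mem T ((mkA_eq_zero_iff T _).1 h)).1 v
  simp [eV, Ev, startIdx, trivInd] at this

lemma ar_ne_zero {i : Fin T.t} {j : ℕ} (hj : j < T.ℓ i) : ar T i j ≠ 0 := by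
  intro h
  have := (trivInd_eq_zero_of_mem T ((mkA_eq_zero_iff T _).1 h)).2 i j hj
  simp [arE, Ar, strip, trivInd] at this

/-- The residues of the paths span the toupie algebra. -/
lemma mem_span_paths (x : Alg T) : x ∈ Submodule.span k
    (Set.range (e T) ∪ {y | ∃ i a b, a < b ∧ b ≤ T.ℓ i ∧ y = pp T i a b}) := by
  set S := Submodule.span k
    (Set.range (e T) ∪ {y | ∃ i a b, a < b ∧ b ≤ T.ℓ i ∧ y = pp T i a b}) with hS
  have he : ∀ v, e T v ∈ S := fun v => Submodule.subset_span (Or.inl ⟨v, rfl⟩)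
  have hp : ∀ i a b, a < b → b ≤ T.ℓ i → pp T i a b ∈ S := fun i a b h1 h2 =>
    Submodule.subset_span (Or.inr ⟨i, a, b, h1, h2, rfl⟩)
  have har : ∀ i j, ar T i j ∈ S := by
    intro i j
    rcases lt_or_ge j (T.ℓ i) with h | h
    · rw [← pp_self_succ]; exact hp _ _ _ (by omega) h
    · rw [ar_eq_zero T h]; exact S.zero_mem
  have aux : ∀ y : Alg T,
      (∀ s ∈ Set.range (e T) ∪ {y | ∃ i a b, a < b ∧ b ≤ T.ℓ i ∧ y = pp T i a b}, s * y ∈ S) →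
      ∀ s ∈ S, s * y ∈ S := by
    intro y h s hs
    induction hs using Submodule.span_induction with
    | mem s hs => exact h s hs
    | zero => simp
    | add a b _ _ ha hb => rw [add_mul]; exact S.add_mem ha hb
    | smul c a _ ha => rw [smul_mul_assoc]; exact S.smul_mem c ha
  have key : ∀ (y : Module.End k (PSp k T.t T.ℓ)) (hy : y ∈ PathAlg k T.t T.ℓ),
      ∀ s ∈ S, s * mkA T ⟨y, hy⟩ ∈ S := by
    intro y hy
    induction hy using Algebra.adjoin_induction with
    | mem y hy =>
      apply aux
      rcases hy with ⟨v, rfl⟩ | ⟨i, j, rfl⟩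
      · change ∀ s ∈ _, s * e T v ∈ S
        rintro _ (⟨w, rfl⟩ | ⟨i, a, b, hab, hb, rfl⟩)
        · rw [e_mul_e]; split_ifs
          exacts [he _, S.zero_mem]
        · by_cases h : v = vt T i b
          · rw [h, pp_mul_e T hab.le]; exact hp _ _ _ hab hb
          · rw [pp_mul_e_of_ne T hab.le h]; exact S.zero_mem
      · change ∀ s ∈ _, s * ar T i j ∈ S
        rintro _ (⟨w, rfl⟩ | ⟨i', a, b, hab, hb, rfl⟩)
        · by_cases h : w = vt T i j
          · rw [h, e_mul_ar]; exact har _ _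
          · rw [e_mul_ar_of_ne T h]; exact S.zero_mem
        · rcases lt_or_ge j (T.ℓ i) with hj | hj
          · by_cases h : vt T i j = vt T i' b
            · have hb' : b < T.ℓ i' := by
                rcases hb.lt_or_eq with h1 | h1
                · exact h1
                · rw [h1, vt_len] at h
                  exact absurd h (vt_ne_snk T hj)
              obtain ⟨rfl, rfl⟩ := vtx_interior_inj (by omega) hb' h
              rw [← pp_succ T hab.le]
              exact hp _ _ _ (by omega) hb'
            · rw [← e_mul_ar, ← mul_assoc, pp_mul_e_of_ne T hab.le h, zero_mul]; exact S.zero_mem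
          · rw [ar_eq_zero T hj, mul_zero]; exact S.zero_mem
    | algebraMap c =>
      intro s hs
      change s * algebraMap k (Alg T) c ∈ S
      rw [← Algebra.commutes, ← Algebra.smul_def]
      exact S.smul_mem c hs
    | add x y hx hy h1 h2 =>
      intro s hs
      have : mkA T ⟨x + y, add_mem hx hy⟩ = mkA T ⟨x, hx⟩ + mkA T ⟨y, hy⟩ := by
        rw [← map_add]; rfl
      rw [this, mul_add]
      exact S.add_mem (h1 s hs) (h2 s hs)
    | mul x y hx hy h1 h2 =>
      intro s hs
      have : mkA T ⟨x * y, mul_mem hx hy⟩ = mkA T ⟨x, hx⟩ * mkA T ⟨y, hy⟩ := by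
        rw [← map_mul]; rfl
      rw [this, ← mul_assoc]
      exact h2 _ (h1 s hs)
  obtain ⟨y, rfl⟩ := mkA_surjective T x
  have h1 : (1 : Alg T) ∈ S := by
    rw [← sum_e]; exact S.sum_mem fun v _ => he v
  simpa using key y.1 y.2 1 h1

/-- Induction principle for elements of a toupie algebra. -/
lemma alg_induction {p : Alg T → Prop} (he : ∀ v, p (e T v))
    (hp : ∀ i a b, a < b → b ≤ T.ℓ i → p (pp T i a b)) (h0 : p 0)
    (hadd : ∀ x y, p x → p y → p (x + y)) (hsmul : ∀ (c : k) x, p x → p (c • x)) (x : Alg T) :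
    p x := by
  refine Submodule.span_induction (p := fun x _ => p x) ?_ h0 (fun x y _ _ => hadd x y)
    (fun c x _ => hsmul c x) (mem_span_paths T x)
  rintro _ (⟨v, rfl⟩ | ⟨i, a, b, h1, h2, rfl⟩)
  exacts [he v, hp i a b h1 h2]

instance : Module.Finite k (Alg T) := by
  refine ⟨⟨(Finset.univ.image (e T)) ∪ (Finset.univ ×ˢ Finset.range (∑ i, T.ℓ i + 1) ×ˢ
    Finset.range (∑ i, T.ℓ i + 1)).image (fun x => pp T x.1 x.2.1 x.2.2), ?_⟩⟩
  rw [eq_top_iff]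
  rintro x -
  refine Submodule.span_mono ?_ (mem_span_paths T x)
  rintro _ (⟨v, rfl⟩ | ⟨i, a, b, h1, h2, rfl⟩)
  · simp
  · have := Finset.single_le_sum (f := T.ℓ) (fun _ _ => Nat.zero_le _) (Finset.mem_univ i)
    simp only [Finset.coe_union, Finset.coe_image, Set.mem_union, Set.mem_image, Finset.mem_coe]
    refine Or.inr ⟨(i, a, b), ?_, rfl⟩
    simp only [Finset.mem_product, Finset.mem_univ, Finset.mem_range, true_and]
    omega

/-- Elements of `e_v A` for `v` the `c`-th vertex of branch `i`, `0 < c`. -/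
lemma e_mul_mem_span {i : Fin T.t} {c : ℕ} (hc : 0 < c) (hcl : c ≤ T.ℓ i) (x : Alg T) :
    e T (vt T i c) * x ∈ Submodule.span k {y | ∃ b, c ≤ b ∧ b ≤ T.ℓ i ∧ y = pp T i c b} := by
  induction x using alg_induction with
  | he v =>
    rw [e_mul_e]
    split_ifs
    · exact Submodule.subset_span ⟨c, le_rfl, hcl, (pp_self T i c).symm⟩
    · exact Submodule.zero_mem _
  | hp j a b hab hb =>
    by_cases h : vt T i c = vt T j a
    · have hc' : c < T.ℓ i := by
        rcases hcl.lt_or_eq with h1 | h1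
        · exact h1
        · rw [h1, vt_len] at h
          exact absurd h.symm (vt_ne_snk T (by omega))
      obtain ⟨rfl, rfl⟩ := vtx_interior_inj hc hc' h.symm
      rw [e_mul_pp]
      exact Submodule.subset_span ⟨b, by omega, hb, rfl⟩
    · rw [e_mul_pp_of_ne T h]; exact Submodule.zero_mem _
  | h0 => simp
  | hadd x y hx hy => rw [mul_add]; exact Submodule.add_mem _ hx hy
  | hsmul r x hx => rw [mul_smul_comm]; exact Submodule.smul_mem _ r hx

/-- Elements of `A e_v` for `v` the `c`-th vertex of branch `i`, `c < ℓ i`. -/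
lemma mul_e_mem_span {i : Fin T.t} {c : ℕ} (hcl : c < T.ℓ i) (x : Alg T) :
    x * e T (vt T i c) ∈ Submodule.span k {y | ∃ a, a ≤ c ∧ y = pp T i a c} := by
  induction x using alg_induction with
  | he v =>
    rw [e_mul_e]
    split_ifs with h
    · exact Submodule.subset_span ⟨c, le_rfl, by rw [h, pp_self]⟩
    · exact Submodule.zero_mem _
  | hp j a b hab hb =>
    by_cases h : vt T i c = vt T j b
    · have hc' : b < T.ℓ j := by
        rcases hb.lt_or_eq with h1 | h1
        · exact h1
        · rw [h1, vt_len] at h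
          exact absurd h (vt_ne_snk T hcl)
      obtain ⟨rfl, rfl⟩ := vtx_interior_inj (by omega) hc' h
      rw [pp_mul_e T hab.le]
      exact Submodule.subset_span ⟨a, hab.le, rfl⟩
    · rw [pp_mul_e_of_ne T hab.le h]; exact Submodule.zero_mem _
  | h0 => simp
  | hadd x y hx hy => rw [add_mul]; exact Submodule.add_mem _ hx hy
  | hsmul r x hx => rw [smul_mul_assoc]; exact Submodule.smul_mem _ r hx

/-- Paths between two vertices of the same branch. -/
lemma e_mul_e_branch {i : Fin T.t} {c d : ℕ} (hc : 0 < c) (hcl : c ≤ T.ℓ i) (hd : d ≤ T.ℓ i)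
    (x : Alg T) : (c ≤ d ∧ ∃ r : k, e T (vt T i c) * x * e T (vt T i d) = r • pp T i c d) ∨
      (d < c ∧ e T (vt T i c) * x * e T (vt T i d) = 0) := by
  have key : ∀ y ∈ Submodule.span k {y | ∃ b, c ≤ b ∧ b ≤ T.ℓ i ∧ y = pp T i c b},
      if c ≤ d then ∃ r : k, y * e T (vt T i d) = r • pp T i c d
        else y * e T (vt T i d) = 0 := by
    intro y hy
    induction hy using Submodule.span_induction with
    | mem y hy =>
      obtain ⟨b, hb, hb', rfl⟩ := hy
      by_cases h : d = b
      · subst h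
        rw [if_pos hb, pp_mul_e T hb]
        exact ⟨1, (one_smul _ _).symm⟩
      · rw [pp_mul_e_of_ne T hb (fun h' => h (vtx_inj hd hb' h'))]
        split_ifs
        · exact ⟨0, (zero_smul _ _).symm⟩
        · rfl
    | zero =>
      split_ifs
      · exact ⟨0, by simp⟩
      · simp
    | add x y _ _ hx hy =>
      split_ifs at hx hy ⊢
      · obtain ⟨r, hr⟩ := hx
        obtain ⟨s, hs⟩ := hy
        exact ⟨r + s, by rw [add_mul, hr, hs, add_smul]⟩
      · rw [add_mul, hx, hy, add_zero]
    | smul c x _ hx =>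
      split_ifs at hx ⊢
      · obtain ⟨r, hr⟩ := hx
        exact ⟨c * r, by rw [smul_mul_assoc, hr, smul_smul]⟩
      · rw [smul_mul_assoc, hx, smul_zero]
  have := key _ (e_mul_mem_span T hc hcl x)
  split_ifs at this with h
  · exact Or.inl ⟨h, this⟩
  · exact Or.inr ⟨by omega, this⟩

/-- There are no paths between interior vertices of different branches. -/
lemma e_mul_e_eq_zero_of_ne {i j : Fin T.t} {c d : ℕ} (hij : i ≠ j) (hc : 0 < c)
    (hcl : c < T.ℓ i) (hd : 0 < d) (hdl : d < T.ℓ j) (x : Alg T) :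
    e T (vt T i c) * x * e T (vt T j d) = 0 := by
  have h := e_mul_mem_span T hc hcl.le x
  generalize e T (vt T i c) * x = y at h ⊢
  induction h using Submodule.span_induction with
  | mem y hy =>
    obtain ⟨b, hb, hb', rfl⟩ := hy
    exact pp_mul_e_of_ne T hb fun h => hij (vtx_interior_inj hd hdl h.symm).1
  | zero => simp
  | add x y _ _ hx hy => rw [add_mul, hx, hy, add_zero]
  | smul c x _ hx => rw [smul_mul_assoc, hx, smul_zero]

/-- The algebra has no paths into the source, except for the trivial one. -/
lemma mul_e_src (x : Alg T) : ∃ r : k, x * e T .src = r • e T .src := by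
  induction x using alg_induction with
  | he v =>
    rw [e_mul_e]
    split_ifs with h
    · exact ⟨1, by rw [h, one_smul]⟩
    · exact ⟨0, by simp⟩
  | hp j a b hab hb =>
    exact ⟨0, by rw [pp_mul_e_of_ne T hab.le (vt_ne_src T (by omega)).symm, zero_smul]⟩
  | h0 => exact ⟨0, by simp⟩
  | hadd x y hx hy =>
    obtain ⟨r, hr⟩ := hx
    obtain ⟨s, hs⟩ := hy
    exact ⟨r + s, by rw [add_mul, hr, hs, add_smul]⟩
  | hsmul c x hx =>
    obtain ⟨r, hr⟩ := hx
    exact ⟨c * r, by rw [smul_mul_assoc, hr, smul_smul]⟩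

/-- The algebra has no paths out of the sink, except for the trivial one. -/
lemma e_snk_mul (x : Alg T) : ∃ r : k, e T .snk * x = r • e T .snk := by
  induction x using alg_induction with
  | he v =>
    rw [e_mul_e]
    split_ifs with h
    · exact ⟨1, by rw [one_smul]⟩
    · exact ⟨0, by simp⟩
  | hp j a b hab hb =>
    exact ⟨0, by rw [e_mul_pp_of_ne T (vt_ne_snk T (by omega)).symm, zero_smul]⟩
  | h0 => exact ⟨0, by simp⟩
  | hadd x y hx hy =>
    obtain ⟨r, hr⟩ := hx
    obtain ⟨s, hs⟩ := hy
    exact ⟨r + s, by rw [mul_add, hr, hs, add_smul]⟩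
  | hsmul c x hx =>
    obtain ⟨r, hr⟩ := hx
    exact ⟨c * r, by rw [mul_smul_comm, hr, smul_smul]⟩

lemma e_mul_e_self (v : Vtx T.t T.ℓ) (x : Alg T) : ∃ r : k, e T v * x * e T v = r • e T v := by
  rcases vt_exhaust T v with rfl | rfl | ⟨i, a, h0, h1, rfl⟩
  · exact mul_e_src T _
  · obtain ⟨r, hr⟩ := e_snk_mul T x
    exact ⟨r, by rw [hr, smul_mul_assoc, e_mul_self]⟩
  · rcases e_mul_e_branch T h0 h1.le h1.le x with ⟨_, h⟩ | ⟨h, _⟩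
    · simpa using h
    · omega

lemma mDim_eq_zero_iff : mDim T = 0 ↔ ∀ x, e T .src * x * e T .snk = 0 := by
  rw [mDim, Submodule.finrank_eq_zero, LinearMap.range_eq_bot]
  exact ⟨fun h x => LinearMap.congr_fun h x, fun h => LinearMap.ext h⟩

end BoundQuiverAlgebra

section GeneralModules

variable {R : Type u} [Ring R]

/-- Unbundled form of indecomposability. -/
abbrev IsIndec (R : Type u) [Ring R] (M : Type u) [AddCommGroup M] [Module R M] : Prop :=
  Indec R (ModuleCat.of R M)

section

variable {M N : Type u} [AddCommGroup M] [Module R M] [AddCommGroup N] [Module R N]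

lemma IsIndec.eq_bot_or_top (h : IsIndec R M) {K K' : Submodule R M} (hK : IsCompl K K') :
    K = ⊥ ∨ K = ⊤ := by
  have h1 : (K.projection K' hK).comp (K.projection K' hK) = K.projection K' hK :=
    Submodule.isIdempotentElem_projection hK
  rcases h.2 _ h1 with h2 | h2
  · left
    rw [← Submodule.range_projection hK, h2]
    exact LinearMap.range_zero
  · right
    rw [← Submodule.range_projection hK, h2]
    exact LinearMap.range_id

lemma IsIndec.bijective_of_leftInverse (h : IsIndec R M) (hN : Nontrivial N) {f : N →ₗ[R] M}
    {r : M →ₗ[R] N} (hr : ∀ x, r (f x) = x) : Function.Bijective f := by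
  have hinj : Function.Injective f := Function.LeftInverse.injective hr
  refine ⟨hinj, ?_⟩
  have h1 : (f.comp r).comp (f.comp r) = f.comp r := by
    ext x; simp [hr]
  rcases h.2 _ h1 with h2 | h2
  · exfalso
    obtain ⟨x, hx⟩ := exists_ne (0 : N)
    have h3 : f (r (f x)) = 0 := LinearMap.congr_fun h2 (f x)
    rw [hr] at h3
    exact hx (hinj (h3.trans (map_zero f).symm))
  · intro y
    exact ⟨r y, LinearMap.congr_fun h2 y⟩

lemma IsIndec.congr (h : IsIndec R M) (φ : M ≃ₗ[R] N) : IsIndec R N := by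
  have := h.1
  have hM : Nontrivial M := h.1
  refine ⟨φ.symm.toEquiv.nontrivial, fun f hf => ?_⟩
  have key := h.2 (φ.symm.toLinearMap.comp (f.comp φ.toLinearMap)) (by
    refine LinearMap.ext fun x => ?_
    have : f (f (φ x)) = f (φ x) := LinearMap.congr_fun hf (φ x)
    change φ.symm (f (φ (φ.symm (f (φ x))))) = φ.symm (f (φ x))
    rw [φ.apply_symm_apply, this])
  rcases key with h1 | h1
  · left
    refine LinearMap.ext fun y => φ.symm.injective ?_
    have := LinearMap.congr_fun h1 (φ.symm y)
    change φ.symm (f (φ (φ.symm y))) = 0 at this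
    rw [φ.apply_symm_apply] at this
    rw [this]
    exact (map_zero φ.symm).symm
  · right
    refine LinearMap.ext fun y => φ.symm.injective ?_
    have := LinearMap.congr_fun h1 (φ.symm y)
    change φ.symm (f (φ (φ.symm y))) = φ.symm y at this
    rw [φ.apply_symm_apply] at this
    exact this

/-- The sum of two disjoint submodules is their direct sum. -/
def supEquiv {N₁ N₂ : Submodule R M} (h : Disjoint N₁ N₂) : (N₁ × N₂) ≃ₗ[R] ↥(N₁ ⊔ N₂) :=
  LinearEquiv.ofBijective
    ((Submodule.inclusion le_sup_left).coprod (Submodule.inclusion le_sup_right)) (by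
    constructor
    · rw [injective_iff_map_eq_zero]
      rintro ⟨a, b⟩ hab
      have h1 : (a : M) + b = 0 := congrArg Subtype.val hab
      have h2 : (a : M) = 0 :=
        Submodule.disjoint_def.1 h _ a.2 (by rw [eq_neg_of_add_eq_zero_left h1]; exact neg_mem b.2)
      rw [h2, zero_add] at h1
      exact Prod.ext (Subtype.ext h2) (Subtype.ext h1)
    · rintro ⟨x, hx⟩
      obtain ⟨a, ha, b, hb, rfl⟩ := Submodule.mem_sup.1 hx
      exact ⟨(⟨a, ha⟩, ⟨b, hb⟩), rfl⟩)

/-- An Artinian module has an indecomposable direct summand with a property `Φ` which is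
inherited by one of the summands of every direct sum decomposition. -/
lemma exists_indec_summand [IsArtinian R M] (Φ : Submodule R M → Prop) (hbot : ¬ Φ ⊥) (htop : Φ ⊤)
    (hsup : ∀ N₁ N₂, Disjoint N₁ N₂ → Φ (N₁ ⊔ N₂) → Φ N₁ ∨ Φ N₂) :
    ∃ K K' : Submodule R M, IsCompl K K' ∧ Φ K ∧ IsIndec R K := by
  obtain ⟨K, ⟨hΦ, K', hK⟩, hmin⟩ := IsArtinian.set_has_minimal
    {K : Submodule R M | Φ K ∧ ∃ K', IsCompl K K'} ⟨⊤, htop, ⊥, isCompl_top_bot⟩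
  refine ⟨K, K', hK, hΦ, ?_, fun f hf => ?_⟩
  · have hK0 : K ≠ ⊥ := fun h => hbot (h ▸ hΦ)
    exact Submodule.nontrivial_iff_ne_bot.2 hK0
  · have hc : IsCompl (LinearMap.range f) (LinearMap.ker f) := LinearMap.IsIdempotentElem.isCompl hf
    set N₁ := (LinearMap.range f).map K.subtype with hN₁
    set N₂ := (LinearMap.ker f).map K.subtype with hN₂
    have hle₁ : N₁ ≤ K := Submodule.map_subtype_le _ _
    have hle₂ : N₂ ≤ K := Submodule.map_subtype_le _ _
    have hs : N₁ ⊔ N₂ = K := by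
      rw [hN₁, hN₂, ← Submodule.map_sup, hc.sup_eq_top, Submodule.map_top, Submodule.range_subtype]
    have hd : Disjoint N₁ N₂ := by
      rw [disjoint_iff, hN₁, hN₂, ← Submodule.map_inf _ K.injective_subtype, hc.inf_eq_bot,
        Submodule.map_bot]
    have aux : ∀ L L' : Submodule R M, L ≤ K → L ⊔ L' = K → Disjoint L L' → Φ L → L = K := by
      intro L L' hL h1 h2 h3
      by_contra hne
      refine hmin L ⟨h3, L' ⊔ K', ?_⟩ (lt_of_le_of_ne hL hne)
      refine ⟨?_, ?_⟩
      · refine Disjoint.disjoint_sup_right_of_disjoint_sup_left h2 ?_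
        rw [h1]; exact hK.disjoint
      · rw [codisjoint_iff, ← sup_assoc, h1, hK.sup_eq_top]
    rcases hsup N₁ N₂ hd (hs.symm ▸ hΦ) with h | h
    · right
      have h1 := aux N₁ N₂ hle₁ hs hd h
      have h2 : LinearMap.range f = ⊤ := by
        apply Submodule.map_injective_of_injective K.injective_subtype
        rw [← hN₁, h1, Submodule.map_top, Submodule.range_subtype]
      refine LinearMap.ext fun x => ?_
      obtain ⟨y, rfl⟩ := LinearMap.range_eq_top.1 h2 x
      exact LinearMap.congr_fun hf y
    · left
      have h1 := aux N₂ N₁ hle₂ (sup_comm N₂ N₁ ▸ hs) hd.symm h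
      have h2 : LinearMap.ker f = ⊤ := by
        apply Submodule.map_injective_of_injective K.injective_subtype
        rw [← hN₂, h1, Submodule.map_top, Submodule.range_subtype]
      exact LinearMap.ker_eq_top.1 h2

lemma exists_indec_summand_ne_bot [IsArtinian R M] [Nontrivial M] :
    ∃ K K' : Submodule R M, IsCompl K K' ∧ IsIndec R K := by
  obtain ⟨K, K', h1, -, h2⟩ := exists_indec_summand (M := M) (fun K => K ≠ ⊥) (by simp) top_ne_bot
    (fun (N₁ N₂ : Submodule R M) _ h => by
      by_contra hc
      simp only [not_or, not_not] at hc
      exact h (by rw [hc.1, hc.2, bot_sup_eq]))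
  exact ⟨K, K', h1, h2⟩

end

section Ext

/-- The vanishing of `Ext¹(X, Y)`: maps to `Y` extend along extensions by `X`. -/
def Ext1Zero (R : Type u) [Ring R] (X Y : Type u) [AddCommGroup X] [Module R X] [AddCommGroup Y]
    [Module R Y] : Prop :=
  ∀ (K P : Type u) [AddCommGroup K] [Module R K] [AddCommGroup P] [Module R P]
    (ι : K →ₗ[R] P) (p : P →ₗ[R] X), Function.Injective ι → Function.Surjective p →
    (∀ x, p x = 0 ↔ ∃ y, ι y = x) → ∀ φ : K →ₗ[R] Y, ∃ ψ : P →ₗ[R] Y, ∀ x, ψ (ι x) = φ x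

variable {X X' X'' Y Y' : Type u} [AddCommGroup X] [Module R X] [AddCommGroup X'] [Module R X']
  [AddCommGroup X''] [Module R X''] [AddCommGroup Y] [Module R Y] [AddCommGroup Y'] [Module R Y']

/-- A map into the target of an injective map factors through it if its image is in the range. -/
lemma exists_factor {f : X →ₗ[R] Y} (hf : Function.Injective f) {g : X' →ₗ[R] Y}
    (h : ∀ x, ∃ y, f y = g x) : ∃ g' : X' →ₗ[R] X, ∀ x, f (g' x) = g x := by
  refine ⟨(LinearEquiv.ofInjective f hf).symm.toLinearMap.comp
    (g.codRestrict (LinearMap.range f) h), fun x => ?_⟩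
  have := LinearEquiv.apply_symm_apply (LinearEquiv.ofInjective f hf)
    (g.codRestrict (LinearMap.range f) h x)
  exact congrArg Subtype.val this

/-- A map out of the source of a surjective map factors through it if it kills the kernel. -/
lemma exists_descend {f : X →ₗ[R] Y} (hf : Function.Surjective f) {g : X →ₗ[R] X'}
    (h : ∀ x, f x = 0 → g x = 0) : ∃ g' : Y →ₗ[R] X', ∀ x, g' (f x) = g x := by
  refine ⟨((LinearMap.ker f).liftQ g (fun x hx => h x hx)).comp
    (f.quotKerEquivOfSurjective hf).symm.toLinearMap, fun x => ?_⟩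
  have : (f.quotKerEquivOfSurjective hf).symm (f x) = (LinearMap.ker f).mkQ x := by
    rw [LinearEquiv.symm_apply_eq]; rfl
  rw [LinearMap.comp_apply, LinearEquiv.coe_coe, this]
  rfl

lemma exists_extend_of_injective (hY : Module.Injective R Y) {f : X →ₗ[R] X'}
    (hf : Function.Injective f) (g : X →ₗ[R] Y) : ∃ h : X' →ₗ[R] Y, ∀ x, h (f x) = g x :=
  hY.out f hf g

lemma ext1Zero_of_projective (h : Module.Projective R X) : Ext1Zero R X Y := by
  intro K P _ _ _ _ ι p hι hp hex φ
  obtain ⟨s, hs⟩ := Module.projective_lifting_property p LinearMap.id hp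
  have hs' : ∀ x, p (s x) = x := fun x => LinearMap.congr_fun hs x
  obtain ⟨q, hq⟩ := exists_factor (g := LinearMap.id - s.comp p) hι (fun x => by
    rw [← hex]; simp [hs'])
  refine ⟨φ.comp q, fun x => ?_⟩
  have : p (ι x) = 0 := (hex _).2 ⟨x, rfl⟩
  have h2 : q (ι x) = x := hι (by rw [hq]; simp [this])
  simp [h2]

lemma ext1Zero_of_subsingleton [Subsingleton X] : Ext1Zero R X Y :=
  ext1Zero_of_projective inferInstance

lemma ext1Zero_of_subsingleton_right [Subsingleton Y] : Ext1Zero R X Y :=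
  fun _ _ _ _ _ _ _ _ _ _ _ _ => ⟨0, fun _ => Subsingleton.elim _ _⟩

lemma Ext1Zero.congr_left (h : Ext1Zero R X Y) (f : X ≃ₗ[R] X') : Ext1Zero R X' Y := by
  intro K P _ _ _ _ ι p hι hp hex φ
  refine h K P ι (f.symm.toLinearMap.comp p) hι (f.symm.surjective.comp hp) (fun x => ?_) φ
  rw [← hex]; simp

lemma Ext1Zero.congr_right (h : Ext1Zero R X Y) (f : Y ≃ₗ[R] Y') : Ext1Zero R X Y' := by
  intro K P _ _ _ _ ι p hι hp hex φ
  obtain ⟨ψ, hψ⟩ := h K P ι p hι hp hex (f.symm.toLinearMap.comp φ)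
  exact ⟨f.toLinearMap.comp ψ, fun x => by simp [hψ]⟩

lemma Ext1Zero.prod_right (h : Ext1Zero R X Y) (h' : Ext1Zero R X Y') : Ext1Zero R X (Y × Y') := by
  intro K P _ _ _ _ ι p hι hp hex φ
  obtain ⟨ψ, hψ⟩ := h K P ι p hι hp hex ((LinearMap.fst R Y Y').comp φ)
  obtain ⟨ψ', hψ'⟩ := h' K P ι p hι hp hex ((LinearMap.snd R Y Y').comp φ)
  exact ⟨ψ.prod ψ', fun x => by ext <;> simp [hψ, hψ']⟩

/-- `Ext¹(-, Y)` is half exact. -/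
lemma Ext1Zero.of_ses (f : X →ₗ[R] X'') (hf : Function.Surjective f)
    (h₁ : Ext1Zero R (LinearMap.ker f) Y) (h₂ : Ext1Zero R X'' Y) : Ext1Zero R X Y := by
  intro K P _ _ _ _ ι p hι hp hex φ
  have hpK : ∀ x, p (ι x) = 0 := fun x => (hex _).2 ⟨x, rfl⟩
  let ι₁ : K →ₗ[R] LinearMap.ker (f.comp p) := ι.codRestrict _ (fun x => by simp [hpK])
  let p₁ : LinearMap.ker (f.comp p) →ₗ[R] LinearMap.ker f := p.restrict (fun x hx => hx)
  obtain ⟨ψ₁, hψ₁⟩ := h₁ K (LinearMap.ker (f.comp p)) ι₁ p₁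
    (fun x y hxy => hι (congrArg Subtype.val hxy))
    (by
      rintro ⟨x, hx⟩
      obtain ⟨y, rfl⟩ := hp x
      exact ⟨⟨y, hx⟩, rfl⟩)
    (by
      rintro ⟨x, hx⟩
      have : p₁ ⟨x, hx⟩ = 0 ↔ p x = 0 := ⟨fun h => congrArg Subtype.val h, fun h => Subtype.ext h⟩
      rw [this, hex]
      exact ⟨fun ⟨y, hy⟩ => ⟨y, Subtype.ext hy⟩, fun ⟨y, hy⟩ => ⟨y, congrArg Subtype.val hy⟩⟩) φ
  obtain ⟨ψ, hψ⟩ := h₂ _ P (LinearMap.ker (f.comp p)).subtype (f.comp p) Subtype.val_injective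
    (hf.comp hp) (fun x => ⟨fun h => ⟨⟨x, h⟩, rfl⟩, fun ⟨y, hy⟩ => hy ▸ y.2⟩) ψ₁
  exact ⟨ψ, fun x => (hψ (ι₁ x)).trans (hψ₁ x)⟩

lemma Ext1Zero.prod_left (h : Ext1Zero R X Y) (h' : Ext1Zero R X' Y) : Ext1Zero R (X × X') Y := by
  refine Ext1Zero.of_ses (LinearMap.snd R X X') LinearMap.snd_surjective ?_ h'
  refine h.congr_left (LinearEquiv.ofBijective
    ((LinearMap.inl R X X').codRestrict (LinearMap.ker (LinearMap.snd R X X')) (by simp)) ⟨?_, ?_⟩)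
  · intro x y hxy
    exact congrArg (fun z => z.1.1) hxy
  · rintro ⟨⟨x, x'⟩, hx⟩
    have : x' = 0 := hx
    subst this
    exact ⟨x, rfl⟩

lemma Ext1Zero.sup_right {N₁ N₂ : Submodule R Y} (hd : Disjoint N₁ N₂) (h : Ext1Zero R X N₁)
    (h' : Ext1Zero R X N₂) : Ext1Zero R X ↥(N₁ ⊔ N₂) :=
  (h.prod_right h').congr_right (supEquiv hd)

lemma Ext1Zero.sup_left {N₁ N₂ : Submodule R X} (hd : Disjoint N₁ N₂) (h : Ext1Zero R N₁ Y)
    (h' : Ext1Zero R N₂ Y) : Ext1Zero R ↥(N₁ ⊔ N₂) Y :=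
  (h.prod_left h').congr_left (supEquiv hd)

/-- `Ext¹(X, Y)` vanishes if all extensions of `X` by `Y` split. -/
lemma ext1Zero_of_split
    (h : ∀ (E : Type u) [AddCommGroup E] [Module R E] (ι : Y →ₗ[R] E) (p : E →ₗ[R] X),
      Function.Injective ι → Function.Surjective p → (∀ x, p x = 0 ↔ ∃ y, ι y = x) →
      ∃ r : E →ₗ[R] Y, ∀ y, r (ι y) = y) : Ext1Zero R X Y := by
  intro K P _ _ _ _ ι p hι hp hex φ
  have hpK : ∀ x, p (ι x) = 0 := fun x => (hex _).2 ⟨x, rfl⟩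
  let S := LinearMap.range (φ.prod (-ι))
  let q : (Y × P) →ₗ[R] X := p.comp (LinearMap.snd R Y P)
  have hS : ∀ z ∈ S, q z = 0 := by
    rintro _ ⟨x, rfl⟩
    simp [q, hpK]
  have key : ∀ x, (S.mkQ (φ x, 0)) = S.mkQ (0, ι x) := by
    intro x
    rw [← sub_eq_zero, ← map_sub]
    simp only [Submodule.mkQ_apply, Submodule.Quotient.mk_eq_zero]
    exact ⟨x, by simp⟩
  obtain ⟨r, hr⟩ := h (_ ⧸ S) (S.mkQ.comp (LinearMap.inl R Y P)) (S.liftQ q hS)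
    (by
      rw [injective_iff_map_eq_zero]
      intro y hy
      simp only [LinearMap.comp_apply, Submodule.mkQ_apply, Submodule.Quotient.mk_eq_zero] at hy
      obtain ⟨x, hx⟩ := hy
      have h1 := congrArg Prod.fst hx
      have h2 := congrArg Prod.snd hx
      simp at h1 h2
      have h3 : x = 0 := hι (by rw [h2, map_zero])
      rw [← h1, h3, map_zero])
    (by
      intro x
      obtain ⟨y, rfl⟩ := hp x
      exact ⟨S.mkQ (0, y), rfl⟩)
    (by
      intro z
      obtain ⟨⟨y, x⟩, rfl⟩ := S.mkQ_surjective z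
      constructor
      · intro hz
        have hx : p x = 0 := hz
        obtain ⟨w, rfl⟩ := (hex x).1 hx
        refine ⟨y + φ w, ?_⟩
        have : (y, ι w) = (y, 0) + ((0 : Y), ι w) := by simp
        rw [this, map_add S.mkQ, ← key, map_add]
        rfl
      · rintro ⟨w, hw⟩
        rw [← hw]
        change p ((LinearMap.snd R Y P) (w, 0)) = 0
        simp)
  refine ⟨r.comp (S.mkQ.comp (LinearMap.inr R Y P)), fun x => ?_⟩
  have := hr (φ x)
  simp only [LinearMap.comp_apply, LinearMap.inl_apply, LinearMap.inr_apply] at this ⊢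
  rw [← key, this]

/-- If `Y` has injective dimension at most one, then `Ext¹(-, Y)` is right exact. -/
lemma Ext1Zero.of_injective_map (hY : IdLeOne R (ModuleCat.of R Y)) {j : X →ₗ[R] X'}
    (hj : Function.Injective j) (h : Ext1Zero R X' Y) : Ext1Zero R X Y := by
  obtain ⟨E, u, hu, hE, hQ⟩ := hY
  change Y →ₗ[R] E at u
  intro K P _ _ _ _ ι p hι hp hex φ
  have hpK : ∀ x, p (ι x) = 0 := fun x => (hex _).2 ⟨x, rfl⟩
  obtain ⟨g, hg⟩ := exists_extend_of_injective hE hι (u.comp φ)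
  let π : E →ₗ[R] E ⧸ LinearMap.range u := (LinearMap.range u).mkQ
  have hπ : ∀ x, π x = 0 ↔ ∃ y, u y = x := fun x => by simp [π]
  obtain ⟨gb, hgb⟩ := exists_descend hp (g := π.comp g) (fun x hx => by
    obtain ⟨y, rfl⟩ := (hex x).1 hx
    rw [LinearMap.comp_apply, hπ, hg]
    exact ⟨_, rfl⟩)
  obtain ⟨h', hh'⟩ := exists_extend_of_injective hQ hj gb
  let Z := LinearMap.ker (h'.comp (LinearMap.fst R X' E) - π.comp (LinearMap.snd R X' E))
  have hZ : ∀ z, z ∈ Z ↔ h' z.1 = π z.2 := fun z => by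
    simp only [Z, LinearMap.mem_ker, LinearMap.sub_apply, sub_eq_zero]; rfl
  let ι' : Y →ₗ[R] Z := ((LinearMap.inr R X' E).comp u).codRestrict Z (fun y => by
    rw [hZ]
    have : π (u y) = 0 := (hπ _).2 ⟨y, rfl⟩
    simp [this])
  obtain ⟨r, hr⟩ := h Y Z ι' ((LinearMap.fst R X' E).comp Z.subtype)
    (fun x y hxy => hu (congrArg (fun z => z.1.2) hxy))
    (fun x => by
      obtain ⟨y, hy⟩ := (LinearMap.range u).mkQ_surjective (h' x)
      exact ⟨⟨(x, y), (hZ _).2 hy.symm⟩, rfl⟩)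
    (by
      rintro ⟨⟨x, y⟩, hz⟩
      constructor
      · intro hx
        have hx' : x = 0 := hx
        subst hx'
        have h1 := (hZ _).1 hz
        simp only [map_zero] at h1
        obtain ⟨w, rfl⟩ := (hπ y).1 h1.symm
        exact ⟨w, rfl⟩
      · rintro ⟨w, hw⟩
        exact (congrArg (fun z => z.1.1) hw).symm) LinearMap.id
  refine ⟨r.comp (((j.comp p).prod g).codRestrict Z (fun x => ?_)), fun x => ?_⟩
  · rw [hZ]
    change h' (j (p x)) = π (g x)
    rw [hh', hgb]; rfl
  · rw [LinearMap.comp_apply, ← LinearMap.id_apply (R := R) (φ x), ← hr]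
    congr 1
    apply Subtype.ext
    change (j (p (ι x)), g (ι x)) = ((0 : X'), u (φ x))
    rw [hpK, map_zero, hg]; rfl

end Ext

end GeneralModules

section Paths

variable {R : Type u} [Ring R]

/-- Two indecomposable modules are connected by a path in `ind R` which may involve
isomorphisms. -/
def Reach (M N : ModuleCat.{u} R) : Prop :=
  Indec R M ∧ FdMod R M ∧ Indec R N ∧ FdMod R N ∧
    (Nonempty (M ≃ₗ[R] N) ∨ Relation.TransGen (Step R) M N)

lemma Step.congr_left {M M' N : ModuleCat.{u} R} (h : Step R M N) (f : M ≃ₗ[R] M') :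
    Step R M' N := by
  obtain ⟨h1, h2, h3, h4, g, hg, hg'⟩ := h
  refine ⟨IsIndec.congr h1 f, ?_, h3, h4, g.comp f.symm.toLinearMap, ?_, ?_⟩
  · have : Module.Finite R M := h2
    exact Module.Finite.equiv f
  · intro h0
    apply hg
    ext x
    simpa using LinearMap.congr_fun h0 (f x)
  · intro hb
    apply hg'
    have := hb.comp f.bijective
    convert this using 1
    ext x; simp

lemma Step.congr_right {M N N' : ModuleCat.{u} R} (h : Step R M N) (f : N ≃ₗ[R] N') :
    Step R M N' := by
  obtain ⟨h1, h2, h3, h4, g, hg, hg'⟩ := h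
  refine ⟨h1, h2, IsIndec.congr h3 f, ?_, f.toLinearMap.comp g, ?_, ?_⟩
  · have : Module.Finite R N := h4
    exact Module.Finite.equiv f
  · intro h0
    apply hg
    ext x
    apply f.injective
    simpa using LinearMap.congr_fun h0 x
  · intro hb
    apply hg'
    have := f.symm.bijective.comp hb
    convert this using 1
    ext x; simp

lemma transGen_congr_left {M M' N : ModuleCat.{u} R} (h : Relation.TransGen (Step R) M N)
    (f : M ≃ₗ[R] M') : Relation.TransGen (Step R) M' N := by
  obtain ⟨X, h1, h2⟩ := Relation.TransGen.head'_iff.1 h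
  exact Relation.TransGen.head' (h1.congr_left f) h2

lemma transGen_congr_right {M N N' : ModuleCat.{u} R} (h : Relation.TransGen (Step R) M N)
    (f : N ≃ₗ[R] N') : Relation.TransGen (Step R) M N' := by
  obtain ⟨X, h1, h2⟩ := Relation.TransGen.tail'_iff.1 h
  exact Relation.TransGen.tail' h1 (h2.congr_right f)

lemma Reach.of_map {M N : ModuleCat.{u} R} (hM : Indec R M) (hM' : FdMod R M) (hN : Indec R N)
    (hN' : FdMod R N) {f : M →ₗ[R] N} (hf : f ≠ 0) : Reach M N := by
  refine ⟨hM, hM', hN, hN', ?_⟩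
  by_cases h : Function.Bijective f
  · exact Or.inl ⟨LinearEquiv.ofBijective f h⟩
  · exact Or.inr (.single ⟨hM, hM', hN, hN', f, hf, h⟩)

lemma Reach.refl {M : ModuleCat.{u} R} (hM : Indec R M) (hM' : FdMod R M) : Reach M M :=
  ⟨hM, hM', hM, hM', Or.inl ⟨LinearEquiv.refl R M⟩⟩

lemma Reach.transGen {M N P : ModuleCat.{u} R} (h : Reach M N)
    (h' : Relation.TransGen (Step R) N P) : Relation.TransGen (Step R) M P := by
  obtain ⟨-, -, -, -, ⟨⟨f⟩⟩ | h⟩ := h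
  · exact transGen_congr_left h' f.symm
  · exact h.trans h'

lemma transGen_reach {M N P : ModuleCat.{u} R} (h : Relation.TransGen (Step R) M N)
    (h' : Reach N P) : Relation.TransGen (Step R) M P := by
  obtain ⟨-, -, -, -, ⟨⟨f⟩⟩ | h'⟩ := h'
  · exact transGen_congr_right h f
  · exact h.trans h'

lemma Reach.trans {M N P : ModuleCat.{u} R} (h : Reach M N) (h' : Reach N P) : Reach M P := by
  refine ⟨h.1, h.2.1, h'.2.2.1, h'.2.2.2.1, ?_⟩
  obtain ⟨h1, h2, h3, h4, ⟨⟨f⟩⟩ | h⟩ := h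
  · obtain ⟨-, -, -, -, ⟨⟨g⟩⟩ | h'⟩ := h'
    · exact Or.inl ⟨f.trans g⟩
    · exact Or.inr (transGen_congr_left h' f.symm)
  · exact Or.inr (transGen_reach h h')

lemma Reach.of_indPath {M N : ModuleCat.{u} R} (hM : Indec R M) (hM' : FdMod R M)
    (h : IndPath R M N) : Reach M N := by
  induction h with
  | refl => exact Reach.refl hM hM'
  | tail _ h ih =>
    obtain ⟨h1, h2, h3, h4, f, hf, -⟩ := h
    exact ih.trans (Reach.of_map h1 h2 h3 h4 hf)

lemma exists_injective_ne_zero {ι : Type*} {M N : Type*} [AddCommGroup M] [AddCommGroup N]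
    [Module R M] [Module R N] [Finite ι] {f : (ι → M) →ₗ[R] N} (hf : f ≠ 0) :
    ∃ g : M →ₗ[R] N, g ≠ 0 := by
  by_contra! h
  apply hf
  have := Fintype.ofFinite ι
  ext i x
  exact LinearMap.congr_fun (h (f.comp (LinearMap.single R (fun _ => M) i))) x

variable [IsNoetherianRing R] [IsArtinianRing R]

/-- If `Ext¹(X, Y) ≠ 0` for indecomposable modules, then there is a path from `Y` to `X`. -/
lemma transGen_of_not_ext1Zero {X Y : ModuleCat.{u} R} (hX : Indec R X) (hX' : FdMod R X)
    (hY : Indec R Y) (hY' : FdMod R Y) (h : ¬ Ext1Zero R X Y) :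
    Relation.TransGen (Step R) Y X := by
  have : Module.Finite R X := hX'
  have : Module.Finite R Y := hY'
  have hXn : Nontrivial X := hX.1
  have hYn : Nontrivial Y := hY.1
  have h1 := mt ext1Zero_of_split h
  push Not at h1
  obtain ⟨E, _, _, ι, p, hι, hp, hex, hr⟩ := h1
  have hpι : ∀ y, p (ι y) = 0 := fun y => (hex _).2 ⟨y, rfl⟩
  have hsplit : ¬ ∃ s : X →ₗ[R] E, ∀ x, p (s x) = x := by
    rintro ⟨s, hs⟩
    obtain ⟨q, hq⟩ := exists_factor (g := LinearMap.id - s.comp p) hι (fun x => by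
      rw [← hex]; simp [hs])
    obtain ⟨y, hy⟩ := hr q
    exact hy (hι (by rw [hq]; simp [hpι]))
  have hE : Module.Finite R E := by
    have e1 : LinearMap.ker p = LinearMap.range ι := by
      ext x; rw [LinearMap.mem_ker, hex]; rfl
    have : Module.Finite R (LinearMap.ker p) := by rw [e1]; infer_instance
    have : Module.Finite R (E ⧸ LinearMap.ker p) :=
      Module.Finite.equiv (p.quotKerEquivOfSurjective hp).symm
    exact Module.Finite.of_submodule_quotient (LinearMap.ker p)
  have : IsArtinian R E := inferInstance
  have : Nontrivial E := hp.nontrivial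
  obtain ⟨K, K', hK, hKi⟩ := exists_indec_summand_ne_bot (R := R) (M := E)
  have hKf : Module.Finite R K := inferInstance
  have hKn : Nontrivial K := hKi.1
  let q := K.projectionOnto K' hK
  have hq : ∀ x : K, q x = x := fun x => Submodule.projectionOnto_apply_left hK x
  have hq' : ∀ x, q x = 0 ↔ x ∈ K' := fun x => Submodule.projectionOnto_apply_eq_zero_iff hK
  let a : Y →ₗ[R] K := q.comp ι
  let b : K →ₗ[R] X := p.comp K.subtype
  have ha : a ≠ 0 := by
    intro h0
    have hYK : ∀ y, ι y ∈ K' := fun y => (hq' _).1 (LinearMap.congr_fun h0 y)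
    obtain ⟨r, hr'⟩ := exists_descend hp (g := q) (fun x hx => by
      obtain ⟨y, rfl⟩ := (hex x).1 hx
      exact (hq' _).2 (hYK y))
    have hbij := IsIndec.bijective_of_leftInverse (M := X) hX hKn (f := b) (r := r)
      (fun x => (hr' _).trans (hq x))
    refine hsplit ⟨K.subtype.comp (LinearEquiv.ofBijective b hbij).symm.toLinearMap, fun x => ?_⟩
    exact LinearEquiv.apply_symm_apply (LinearEquiv.ofBijective b hbij) x
  have hb : b ≠ 0 := by
    intro h0
    obtain ⟨c, hc⟩ := exists_factor (g := K.subtype) hι (fun x => by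
      rw [← hex]; exact LinearMap.congr_fun h0 x)
    have hbij := IsIndec.bijective_of_leftInverse (M := Y) hY hKn (f := c) (r := a)
      (fun x => by
        change q (ι (c x)) = x
        rw [hc]; exact hq x)
    obtain ⟨y, hy⟩ := hr (c.comp q)
    obtain ⟨x, rfl⟩ := hbij.2 y
    apply hy
    have : q (ι (c x)) = x := by rw [hc]; exact hq x
    rw [LinearMap.comp_apply, this]
  refine Relation.TransGen.trans (b := ModuleCat.of R K) (.single ⟨hY, hY', hKi, hKf, a, ha, ?_⟩)
    (.single ⟨hKi, hKf, hX, hX', b, hb, ?_⟩)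
  · intro hbij
    obtain ⟨y, hy⟩ := hr ((LinearEquiv.ofBijective a hbij).symm.toLinearMap.comp q)
    exact hy (LinearEquiv.symm_apply_apply (LinearEquiv.ofBijective a hbij) y)
  · intro hbij
    refine hsplit ⟨K.subtype.comp (LinearEquiv.ofBijective b hbij).symm.toLinearMap, fun x => ?_⟩
    exact LinearEquiv.apply_symm_apply (LinearEquiv.ofBijective b hbij) x

/-- If `X` has projective dimension greater than one, then `Ext¹(X, C) ≠ 0` for some
indecomposable `C` generated by an injective cogenerator `D`. -/
lemma exists_not_ext1Zero_of_not_pdLeOne {D : Type u} [AddCommGroup D] [Module R D]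
    (hD : Module.Injective R D) (hDf : Module.Finite R D)
    (hcog : ∀ (Y : Type u) [AddCommGroup Y] [Module R Y], Module.Finite R Y →
      ∃ (n : ℕ) (j : Y →ₗ[R] (Fin n → D)), Function.Injective j)
    {X : ModuleCat.{u} R} (hX : FdMod R X) (h : ¬ PdLeOne R X) :
    ∃ C : ModuleCat.{u} R, Indec R C ∧ FdMod R C ∧ (∃ f : D →ₗ[R] C, f ≠ 0) ∧
      ¬ Ext1Zero R X C := by
  have : Module.Finite R X := hX
  obtain ⟨n, p, hp⟩ := Module.Finite.exists_fin' R X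
  let K := LinearMap.ker p
  have hK : ¬ Module.Projective R K := fun hK => h ⟨ModuleCat.of R (Fin n → R), p, hp,
    inferInstanceAs (Module.Projective R (Fin n → R)), hK⟩
  obtain ⟨m, q, hq⟩ := Module.Finite.exists_fin' R K
  obtain ⟨r, j, hj⟩ := hcog (LinearMap.ker q) inferInstance
  have hE : Module.Injective R (Fin r → D) := inferInstance
  let π := (LinearMap.range j).mkQ
  have hπ : ∀ x, π x = 0 ↔ ∃ y, j y = x := fun x => by simp [π]
  have hQ : ¬ Ext1Zero R X ((Fin r → D) ⧸ LinearMap.range j) := by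
    intro hQ
    apply hK
    obtain ⟨g, hg⟩ := exists_extend_of_injective hE (LinearMap.ker q).injective_subtype j
    obtain ⟨gb, hgb⟩ := exists_descend hq (g := π.comp g) (fun x hx => by
      rw [LinearMap.comp_apply, hπ]
      exact ⟨⟨x, hx⟩, (hg ⟨x, hx⟩).symm⟩)
    obtain ⟨gh, hgh⟩ := hQ K (Fin n → R) K.subtype p K.injective_subtype hp
      (fun x => ⟨fun hx => ⟨⟨x, hx⟩, rfl⟩, fun ⟨y, hy⟩ => hy ▸ y.2⟩) gb
    obtain ⟨G, hG⟩ := Module.projective_lifting_property π gh (LinearMap.range j).mkQ_surjective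
    obtain ⟨s, hs⟩ := exists_factor (g := g - G.comp (K.subtype.comp q)) hj (fun x => by
      rw [← hπ, LinearMap.sub_apply, map_sub]
      have h1 : π (G (q x)) = gh (q x) := LinearMap.congr_fun hG _
      have h2 : gh (q x) = gb (q x) := hgh (q x)
      have h3 : gb (q x) = π (g x) := hgb x
      change π (g x) - π (G (q x)) = 0
      rw [h1, h2, h3, sub_self])
    have hs' : ∀ x : LinearMap.ker q, s x = x := fun x => hj (by
      have hx : q x = 0 := x.2
      rw [hs]; simp [hx]; exact hg x)
    obtain ⟨t, ht⟩ := exists_descend hq (g := LinearMap.id - (LinearMap.ker q).subtype.comp s)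
      (fun x hx => by
        have := hs' ⟨x, hx⟩
        simp [this])
    refine Module.Projective.of_split t q (LinearMap.ext fun x => ?_)
    obtain ⟨y, rfl⟩ := hq x
    have h1 : q (s y) = 0 := (s y).2
    simp [ht, h1]
  obtain ⟨C, C', hC, hΦ, hCi⟩ := exists_indec_summand
    (fun N : Submodule R ((Fin r → D) ⧸ LinearMap.range j) => ¬ Ext1Zero R X N)
    (by simpa using ext1Zero_of_subsingleton_right)
    (fun h0 => hQ (h0.congr_right Submodule.topEquiv))
    (fun N₁ N₂ hd hN => by
      by_contra! hc
      exact hN (Ext1Zero.sup_right hd hc.1 hc.2))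
  refine ⟨ModuleCat.of R C, hCi, inferInstanceAs (Module.Finite R C), ?_, hΦ⟩
  refine exists_injective_ne_zero (f := (C.projectionOnto C' hC).comp π) fun h0 => ?_
  have hCn : Nontrivial C := hCi.1
  obtain ⟨x, hx⟩ := exists_ne (0 : C)
  obtain ⟨y, hy⟩ := ((Submodule.projectionOnto_surjective hC).comp
    (LinearMap.range j).mkQ_surjective) x
  exact hx (hy.symm.trans (LinearMap.congr_fun h0 y))

/-- Nonvanishing of `Ext¹` propagates along nonzero maps between indecomposable modules. -/
lemma exists_not_ext1Zero_of_map {J Y N N' : ModuleCat.{u} R}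
    (hJ : ∀ Z, Relation.TransGen (Step R) J Z → IdLeOne R Z) (hN : Indec R N) (hNf : FdMod R N)
    {f : N →ₗ[R] N'} (hf : f ≠ 0) (hY : Relation.TransGen (Step R) J Y) (hYi : Indec R Y)
    (hYf : FdMod R Y) (h : ¬ Ext1Zero R N Y) :
    ∃ Y', Relation.TransGen (Step R) J Y' ∧ Indec R Y' ∧ FdMod R Y' ∧ ¬ Ext1Zero R N' Y' := by
  have : Module.Finite R N := hNf
  let p := f.rangeRestrict
  have hp : Function.Surjective p := f.surjective_rangeRestrict
  have hker : LinearMap.ker p = LinearMap.ker f := LinearMap.ker_rangeRestrict f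
  by_cases hK : Ext1Zero R (LinearMap.ker f) Y
  · refine ⟨Y, hY, hYi, hYf, fun h' => h ?_⟩
    refine Ext1Zero.of_ses p hp (by rw [hker]; exact hK) ?_
    exact h'.of_injective_map (hJ Y hY) (LinearMap.range f).injective_subtype
  · obtain ⟨K, K', hc, hΦ, hKi⟩ := exists_indec_summand
      (fun L : Submodule R (LinearMap.ker f) => ¬ Ext1Zero R L Y)
      (by simpa using ext1Zero_of_subsingleton)
      (fun h0 => hK (h0.congr_left Submodule.topEquiv))
      (fun N₁ N₂ hd hN => by
        by_contra! hc
        exact hN (Ext1Zero.sup_left hd hc.1 hc.2))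
    have hKf : Module.Finite R K := inferInstance
    have hJK : Relation.TransGen (Step R) J (ModuleCat.of R K) :=
      hY.trans (transGen_of_not_ext1Zero (X := ModuleCat.of R K) hKi hKf hYi hYf hΦ)
    refine ⟨ModuleCat.of R K, hJK, hKi, hKf, fun h' => hf ?_⟩
    have h1 : Ext1Zero R (LinearMap.range f) K :=
      Ext1Zero.of_injective_map (hJ _ hJK) (LinearMap.range f).injective_subtype h'
    obtain ⟨r, hr⟩ := h1 (LinearMap.ker f) N (LinearMap.ker f).subtype p
      (LinearMap.ker f).injective_subtype hp (fun x => by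
        rw [← LinearMap.mem_ker, hker]
        exact ⟨fun hx => ⟨⟨x, hx⟩, rfl⟩, fun ⟨y, hy⟩ => hy ▸ y.2⟩) (K.projectionOnto K' hc)
    have hbij := IsIndec.bijective_of_leftInverse (M := N) hN hKi.1
      (f := (LinearMap.ker f).subtype.comp K.subtype) (r := r)
      (fun x => (hr x).trans (Submodule.projectionOnto_apply_left hc x))
    refine LinearMap.ext fun x => ?_
    obtain ⟨y, rfl⟩ := hbij.2 x
    exact y.1.2

end Paths

section Dimensions

variable {R : Type u} [Ring R]
variable {M M'' : Type u} [AddCommGroup M] [Module R M] [AddCommGroup M''] [Module R M'']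

lemma projective_of_ses {g : M →ₗ[R] M''} (hg : Function.Surjective g)
    (h' : Module.Projective R (LinearMap.ker g)) (h'' : Module.Projective R M'') :
    Module.Projective R M := by
  obtain ⟨s, hs⟩ := Module.projective_lifting_property g LinearMap.id hg
  have hs' : ∀ x, g (s x) = x := fun x => LinearMap.congr_fun hs x
  refine Module.Projective.of_equiv (M := LinearMap.ker g × M'') (LinearEquiv.ofBijective
    ((LinearMap.ker g).subtype.coprod s) ⟨?_, fun x => ?_⟩)
  · rw [injective_iff_map_eq_zero]
    rintro ⟨a, b⟩ hab
    have h1 : (a : M) + s b = 0 := hab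
    have h2 : b = 0 := by
      have := congrArg g h1
      rwa [map_add, hs', show g a = 0 from a.2, zero_add, map_zero] at this
    subst h2
    rw [map_zero, add_zero] at h1
    exact Prod.ext (Subtype.ext h1) rfl
  · refine ⟨(⟨x - s (g x), by simp [hs']⟩, g x), ?_⟩
    simp

lemma pdLeOne_of_projective (h : Module.Projective R M) : PdLeOne R (ModuleCat.of R M) := by
  refine ⟨ModuleCat.of R M, LinearMap.id, Function.surjective_id, h, ?_⟩
  have : Subsingleton (LinearMap.ker (LinearMap.id : M →ₗ[R] M)) := by
    rw [LinearMap.ker_id]; infer_instance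
  change Module.Projective R (LinearMap.ker (LinearMap.id : M →ₗ[R] M))
  infer_instance

lemma pdLeOne_of_ses {g : M →ₗ[R] M''} (hg : Function.Surjective g)
    (h' : PdLeOne R (ModuleCat.of R (LinearMap.ker g))) (h'' : PdLeOne R (ModuleCat.of R M'')) :
    PdLeOne R (ModuleCat.of R M) := by
  obtain ⟨P', p', hp', hP', hK'⟩ := h'
  obtain ⟨P'', p'', hp'', hP'', hK''⟩ := h''
  change P' →ₗ[R] LinearMap.ker g at p'
  change P'' →ₗ[R] M'' at p''
  obtain ⟨t, ht⟩ := Module.projective_lifting_property g p'' hg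
  have ht' : ∀ x, g (t x) = p'' x := fun x => LinearMap.congr_fun ht x
  have hgp : ∀ x, g (p' x) = 0 := fun x => (p' x).2
  let q : (P' × P'') →ₗ[R] M := ((LinearMap.ker g).subtype.comp p').coprod t
  have hqa : ∀ a b, q (a, b) = p' a + t b := fun a b => rfl
  have hq : Function.Surjective q := by
    intro x
    obtain ⟨b, hb⟩ := hp'' (g x)
    obtain ⟨a, ha⟩ := hp' ⟨x - t b, by simp [ht', hb]⟩
    exact ⟨(a, b), by rw [hqa, ha]; simp⟩
  refine ⟨ModuleCat.of R (P' × P''), q, hq, inferInstanceAs (Module.Projective R (P' × P'')), ?_⟩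
  have hmem : ∀ a b, q (a, b) = 0 → p'' b = 0 := fun a b h => by
    have := congrArg g ((hqa a b).symm.trans h)
    rwa [map_add, hgp, zero_add, map_zero, ht'] at this
  let c : LinearMap.ker q →ₗ[R] LinearMap.ker p'' :=
    ((LinearMap.snd R P' P'').comp (LinearMap.ker q).subtype).codRestrict _
      (fun x => hmem x.1.1 x.1.2 x.2)
  have hc : Function.Surjective c := by
    rintro ⟨b, hb⟩
    obtain ⟨a, ha⟩ := hp' ⟨-t b, by
      have : p'' b = 0 := hb
      simp [ht', this]⟩
    exact ⟨⟨(a, b), by rw [LinearMap.mem_ker, hqa, ha]; simp⟩, rfl⟩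
  change Module.Projective R (LinearMap.ker q)
  refine projective_of_ses hc ?_ hK''
  refine Module.Projective.of_equiv (M := LinearMap.ker p') (LinearEquiv.ofBijective
    ((((LinearMap.inl R P' P'').comp (LinearMap.ker p').subtype).codRestrict (LinearMap.ker q)
      (fun x => by
        have : p' x = 0 := x.2
        rw [LinearMap.mem_ker]
        change q (x, 0) = 0
        rw [hqa, this]; simp)).codRestrict (LinearMap.ker c) (fun x => rfl)) ⟨?_, ?_⟩)
  · intro x y hxy
    exact Subtype.ext (congrArg (fun z => z.1.1.1) hxy)
  · rintro ⟨⟨⟨a, b⟩, h1⟩, h2⟩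
    have h3 : b = 0 := congrArg Subtype.val h2
    subst h3
    have h4 : (p' a : M) = 0 := by
      have := (hqa a 0).symm.trans h1
      simpa using this
    exact ⟨⟨a, Subtype.ext h4⟩, rfl⟩

lemma injective_of_equiv {M N : Type u} [AddCommGroup M] [Module R M] [AddCommGroup N]
    [Module R N] (f : M ≃ₗ[R] N) (h : Module.Injective R M) : Module.Injective R N :=
  (Module.Baer.of_equiv f (Module.Baer.of_injective h)).injective

lemma injective_prod {M N : Type u} [AddCommGroup M] [Module R M] [AddCommGroup N]
    [Module R N] (h : Module.Injective R M) (h' : Module.Injective R N) :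
    Module.Injective R (M × N) := by
  refine ⟨fun X Y _ _ _ _ f hf g => ?_⟩
  obtain ⟨a, ha⟩ := h.out f hf ((LinearMap.fst R M N).comp g)
  obtain ⟨b, hb⟩ := h'.out f hf ((LinearMap.snd R M N).comp g)
  exact ⟨a.prod b, fun x => by ext <;> simp [ha, hb]⟩

/-- A direct factor of an injective module is injective. -/
lemma injective_of_retract {M N : Type u} [AddCommGroup M] [Module R M] [AddCommGroup N]
    [Module R N] (h : Module.Injective R M) (f : N →ₗ[R] M) (r : M →ₗ[R] N)
    (hr : ∀ x, r (f x) = x) : Module.Injective R N := by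
  refine ⟨fun X Y _ _ _ _ i hi g => ?_⟩
  obtain ⟨a, ha⟩ := h.out i hi (f.comp g)
  exact ⟨r.comp a, fun x => by simp [ha, hr]⟩

lemma injective_of_ses {g : M →ₗ[R] M''} (hg : Function.Surjective g)
    (h' : Module.Injective R (LinearMap.ker g)) (h'' : Module.Injective R M'') :
    Module.Injective R M := by
  obtain ⟨r, hr⟩ := exists_extend_of_injective h' (LinearMap.ker g).injective_subtype LinearMap.id
  refine injective_of_equiv (LinearEquiv.ofBijective (r.prod g) ⟨?_, fun x => ?_⟩).symm
    (injective_prod h' h'')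
  · rw [injective_iff_map_eq_zero]
    intro x hx
    have h2 : g x = 0 := congrArg Prod.snd hx
    have h1 : r x = 0 := congrArg Prod.fst hx
    have h3 := hr ⟨x, h2⟩
    exact congrArg Subtype.val (h3.symm.trans h1)
  · obtain ⟨y, hy⟩ := hg x.2
    have h3 := hr (x.1 - r y)
    refine ⟨y + (x.1 - r y : LinearMap.ker g), ?_⟩
    have h4 : g (x.1 - r y : LinearMap.ker g) = 0 := (x.1 - r y).2
    have h5 : r (x.1 - r y : LinearMap.ker g) = x.1 - r y := h3
    refine Prod.ext ?_ ?_
    · change r (y + _) = x.1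
      rw [map_add, h5, add_sub_cancel]
    · change g (y + _) = x.2
      rw [map_add, h4, hy, add_zero]

lemma idLeOne_of_injective (h : Module.Injective R M) : IdLeOne R (ModuleCat.of R M) := by
  refine ⟨ModuleCat.of R M, LinearMap.id, Function.injective_id, h, ?_⟩
  change Module.Injective R (M ⧸ LinearMap.range (LinearMap.id : M →ₗ[R] M))
  have : Subsingleton (M ⧸ LinearMap.range (LinearMap.id : M →ₗ[R] M)) := by
    rw [LinearMap.range_id]; infer_instance
  exact ⟨fun X Y _ _ _ _ i hi g => ⟨0, fun _ => Subsingleton.elim _ _⟩⟩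

lemma idLeOne_of_ses {g : M →ₗ[R] M''} (hg : Function.Surjective g)
    (h' : IdLeOne R (ModuleCat.of R (LinearMap.ker g))) (h'' : IdLeOne R (ModuleCat.of R M'')) :
    IdLeOne R (ModuleCat.of R M) := by
  obtain ⟨E', u', hu', hE', hQ'⟩ := h'
  obtain ⟨E'', u'', hu'', hE'', hQ''⟩ := h''
  change LinearMap.ker g →ₗ[R] E' at u'
  change M'' →ₗ[R] E'' at u''
  obtain ⟨t, ht⟩ := exists_extend_of_injective hE' (LinearMap.ker g).injective_subtype u'
  have ht' : ∀ x (hx : g x = 0), t x = u' ⟨x, hx⟩ := fun x hx => ht ⟨x, hx⟩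
  let w : M →ₗ[R] E' × E'' := t.prod (u''.comp g)
  have hwa : ∀ x, w x = (t x, u'' (g x)) := fun x => rfl
  have hw : Function.Injective w := by
    rw [injective_iff_map_eq_zero]
    intro x hx
    have h2 : g x = 0 := hu'' ((congrArg Prod.snd hx).trans (map_zero u'').symm)
    have h1 : t x = 0 := congrArg Prod.fst hx
    rw [ht' x h2] at h1
    exact congrArg Subtype.val (hu' (h1.trans (map_zero u').symm))
  refine ⟨ModuleCat.of R (E' × E''), w, hw, injective_prod hE' hE'', ?_⟩
  let c : ((E' × E'') ⧸ LinearMap.range w) →ₗ[R] E'' ⧸ LinearMap.range u'' :=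
    (LinearMap.range w).liftQ ((LinearMap.range u'').mkQ.comp (LinearMap.snd R E' E'')) (by
      rintro _ ⟨x, rfl⟩
      simp [hwa])
  have hca : ∀ a b, c ((LinearMap.range w).mkQ (a, b)) = (LinearMap.range u'').mkQ b :=
    fun a b => rfl
  have hc : Function.Surjective c := by
    intro x
    obtain ⟨b, rfl⟩ := (LinearMap.range u'').mkQ_surjective x
    exact ⟨(LinearMap.range w).mkQ (0, b), hca _ _⟩
  change Module.Injective R ((E' × E'') ⧸ LinearMap.range w)
  refine injective_of_ses hc ?_ hQ''
  let d : (E' ⧸ LinearMap.range u') →ₗ[R] ((E' × E'') ⧸ LinearMap.range w) :=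
    (LinearMap.range u').liftQ ((LinearMap.range w).mkQ.comp (LinearMap.inl R E' E'')) (by
      rintro _ ⟨⟨x, hx⟩, rfl⟩
      have hx' : g x = 0 := hx
      simp only [LinearMap.mem_ker, LinearMap.comp_apply, Submodule.mkQ_apply,
        Submodule.Quotient.mk_eq_zero]
      exact ⟨x, by rw [hwa, ht' x hx', hx', map_zero]; rfl⟩)
  have hda : ∀ a, d ((LinearMap.range u').mkQ a) = (LinearMap.range w).mkQ (a, 0) := fun a => rfl
  refine injective_of_equiv (LinearEquiv.ofBijective (d.codRestrict (LinearMap.ker c) ?_)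
    ⟨?_, ?_⟩) hQ'
  · intro x
    obtain ⟨a, rfl⟩ := (LinearMap.range u').mkQ_surjective x
    rw [LinearMap.mem_ker, hda, hca, map_zero]
  · rw [injective_iff_map_eq_zero]
    intro x hx
    obtain ⟨a, rfl⟩ := (LinearMap.range u').mkQ_surjective x
    have h1 : (LinearMap.range w).mkQ (a, 0) = 0 := congrArg Subtype.val hx
    simp only [Submodule.mkQ_apply, Submodule.Quotient.mk_eq_zero] at h1 ⊢
    obtain ⟨y, hy⟩ := h1
    rw [hwa, Prod.mk.injEq] at hy
    have h2 : g y = 0 := hu'' (hy.2.trans (map_zero u'').symm)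
    exact ⟨⟨y, h2⟩, by rw [← ht' y h2, hy.1]⟩
  · rintro ⟨x, hx⟩
    obtain ⟨⟨a, b⟩, rfl⟩ := (LinearMap.range w).mkQ_surjective x
    rw [LinearMap.mem_ker, hca] at hx
    simp only [Submodule.mkQ_apply, Submodule.Quotient.mk_eq_zero] at hx
    obtain ⟨y, rfl⟩ := hx
    obtain ⟨z, rfl⟩ := hg y
    refine ⟨(LinearMap.range u').mkQ (a - t z), Subtype.ext ?_⟩
    change (LinearMap.range w).mkQ (a - t z, 0) = (LinearMap.range w).mkQ (a, u'' (g z))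
    rw [← sub_eq_zero, ← map_sub]
    simp only [Submodule.mkQ_apply, Submodule.Quotient.mk_eq_zero]
    exact ⟨-z, by rw [hwa]; simp⟩

end Dimensions

section RightModules

variable {k : Type u} [Field k] (T : ToupieAlg k)

instance : Module.Finite k (Alg T)ᵐᵒᵖ := Module.Finite.equiv (MulOpposite.opLinearEquiv k)

instance : IsArtinianRing (Alg T)ᵐᵒᵖ := IsArtinianRing.of_finite k _

instance : IsNoetherianRing (Alg T)ᵐᵒᵖ := IsNoetherianRing.of_finite k _

variable {T}
variable {M N : Type u} [AddCommGroup M] [Module (Alg T)ᵐᵒᵖ M] [AddCommGroup N]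
  [Module (Alg T)ᵐᵒᵖ N]

lemma act_act (x : M) (a b : Alg T) : x <• a <• b = x <• (a * b) := by
  rw [smul_smul, ← op_mul]

@[simp] lemma act_one (x : M) : x <• (1 : Alg T) = x := by simp

@[simp] lemma act_zero (x : M) : x <• (0 : Alg T) = 0 := by simp

lemma act_add (x : M) (a b : Alg T) : x <• (a + b) = x <• a + x <• b := by
  rw [op_add, add_smul]

lemma act_sub (x : M) (a b : Alg T) : x <• (a - b) = x <• a - x <• b := by
  rw [op_sub, sub_smul]

lemma act_smul (x : M) (c : k) (a : Alg T) :
    x <• (c • a) = x <• a <• algebraMap k (Alg T) c := by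
  rw [act_act, ← Algebra.commutes, Algebra.smul_def]

lemma act_comm (x : M) (c : k) (a : Alg T) :
    x <• a <• algebraMap k (Alg T) c = x <• algebraMap k (Alg T) c <• a := by
  rw [act_act, act_act, Algebra.commutes]

lemma sum_act_e (x : M) : ∑ v, x <• e T v = x := by
  rw [← Finset.sum_smul, ← Finset.op_sum, sum_e, act_one]

lemma act_e_of_ne {x : M} {v w : Vtx T.t T.ℓ} (hx : x <• e T v = x) (h : v ≠ w) :
    x <• e T w = 0 := by
  rw [← hx, act_act, e_mul_of_ne T h, act_zero]

lemma act_ar_of_ne {x : M} {v : Vtx T.t T.ℓ} (hx : x <• e T v = x) {i : Fin T.t} {j : ℕ}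
    (h : v ≠ vt T i j) : x <• ar T i j = 0 := by
  rw [← hx, act_act, e_mul_ar_of_ne T h, act_zero]

lemma act_e_e (x : M) (v : Vtx T.t T.ℓ) : x <• e T v <• e T v = x <• e T v := by
  rw [act_act, e_mul_self]

lemma act_ar_e (x : M) (i : Fin T.t) (j : ℕ) :
    x <• ar T i j <• e T (vt T i (j + 1)) = x <• ar T i j := by
  rw [act_act, ar_mul_e]

lemma act_alg_cancel {x : M} {c : k} (hc : c ≠ 0) (h : x <• algebraMap k (Alg T) c = 0) :
    x = 0 := by
  have := congrArg (fun y => y <• algebraMap k (Alg T) c⁻¹) h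
  simpa only [act_act, ← map_mul, mul_inv_cancel₀ hc, map_one, act_one, smul_zero] using this

lemma mem_of_act_e_mem {K : Submodule (Alg T)ᵐᵒᵖ M} {x : M} (h : ∀ v, x <• e T v ∈ K) : x ∈ K := by
  rw [← sum_act_e (T := T) x]
  exact Submodule.sum_mem _ fun v _ => h v

/-- An additive subgroup stable under scalars, idempotents, and arrows is a submodule. -/
def subOf (K : AddSubgroup M) (hs : ∀ (c : k), ∀ x ∈ K, x <• algebraMap k (Alg T) c ∈ K)
    (he : ∀ v : Vtx T.t T.ℓ, ∀ x ∈ K, x <• e T v ∈ K) (ha : ∀ i j, ∀ x ∈ K, x <• ar T i j ∈ K) :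
    Submodule (Alg T)ᵐᵒᵖ M :=
  { K with
    smul_mem' := by
      intro a x hx
      have key : ∀ b : Alg T, ∀ x ∈ K, x <• b ∈ K := by
        intro b
        induction b using alg_induction with
        | he v => exact he v
        | hp i a b hab hb =>
          clear hx x hb
          induction b, hab.le using Nat.le_induction with
          | base => exact absurd hab (lt_irrefl _)
          | succ b hab' ih =>
            intro x hx
            rw [pp_succ T hab', ← act_act]
            refine ha _ _ _ ?_
            rcases hab'.eq_or_lt with rfl | h
            · rw [pp_of_le T le_rfl]; exact he _ _ hx
            · exact ih h x hx
        | h0 => intro x _; rw [act_zero]; exact K.zero_mem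
        | hadd b c hb hc => intro x hx; rw [act_add]; exact K.add_mem (hb x hx) (hc x hx)
        | hsmul c b hb => intro x hx; rw [act_smul]; exact hs _ _ (hb x hx)
      exact key a.unop x hx }

/-- A homogeneous element of a submodule outside of another one, at a vertex of maximal rank. -/
lemma exists_homogeneous_max {K P : Submodule (Alg T)ᵐᵒᵖ M} (h : ¬ P ≤ K) :
    ∃ v, ∃ x ∈ P, x <• e T v = x ∧ x ∉ K ∧ (∀ i j, x <• ar T i j ∈ K) := by
  have hex : ∃ v : Vtx T.t T.ℓ, ∃ x ∈ P, x <• e T v = x ∧ x ∉ K := by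
    obtain ⟨x, hx, hxK⟩ := Set.not_subset.1 h
    by_contra! hc
    exact hxK (mem_of_act_e_mem fun v => hc v _ (P.smul_mem _ hx) (act_e_e x v))
  obtain ⟨v, hv, hmax⟩ := Finset.exists_max_image
    (Finset.univ.filter fun v : Vtx T.t T.ℓ => ∃ x ∈ P, x <• e T v = x ∧ x ∉ K) rk
    (by obtain ⟨v, hv⟩ := hex; exact ⟨v, by simpa using hv⟩)
  obtain ⟨x, hxP, hxv, hxK⟩ := (Finset.mem_filter.1 hv).2
  refine ⟨v, x, hxP, hxv, hxK, fun i j => ?_⟩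
  by_contra hn
  by_cases hvj : v = vt T i j
  · by_cases hj : j < T.ℓ i
    · have := hmax (vt T i (j + 1)) (Finset.mem_filter.2 ⟨Finset.mem_univ _, x <• ar T i j,
        P.smul_mem _ hxP, act_ar_e x i j, hn⟩)
      rw [hvj] at this
      exact absurd (rk_vtx_lt (Nat.lt_succ_self j) hj) (not_lt.2 this)
    · rw [ar_eq_zero T (not_lt.1 hj), act_zero] at hn
      exact hn K.zero_mem
  · rw [act_ar_of_ne hxv hvj] at hn
    exact hn K.zero_mem

lemma map_act (f : M →ₗ[(Alg T)ᵐᵒᵖ] N) (x : M) (a : Alg T) : f (x <• a) = f x <• a :=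
  map_smul f _ x

/-- A module generated by a homogeneous element is indecomposable. -/
lemma isIndec_of_cyclic {x : M} (hx : x ≠ 0) {v : Vtx T.t T.ℓ} (hxv : x <• e T v = x)
    (hgen : ∀ y : M, ∃ a : Alg T, x <• a = y) : IsIndec (Alg T)ᵐᵒᵖ M := by
  refine ⟨⟨x, 0, hx⟩, fun (f : M →ₗ[(Alg T)ᵐᵒᵖ] M) hf => ?_⟩
  obtain ⟨a, ha⟩ := hgen (f x)
  obtain ⟨r, hr⟩ := e_mul_e_self T v a
  have hfx : f x = x <• algebraMap k (Alg T) r := by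
    have h1 : f x = x <• (e T v * a * e T v) := by
      rw [← act_act, ← act_act, hxv, ha, ← map_act, hxv]
    rw [h1, hr, act_smul, hxv]
  have hff : f (f x) = f x := LinearMap.congr_fun hf x
  rw [hfx, map_act, hfx, act_act, ← sub_eq_zero, ← act_sub, ← map_mul, ← map_sub] at hff
  have hr0 : r * r - r = 0 := by
    by_contra hne
    exact hx (act_alg_cancel hne hff)
  have hext : ∀ g : M →ₗ[(Alg T)ᵐᵒᵖ] M, f x = g x → f = g := by
    intro g hg
    ext y
    obtain ⟨b, rfl⟩ := hgen y
    rw [map_act, map_act, hg]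
  have : r * (r - 1) = 0 := by linear_combination hr0
  rcases mul_eq_zero.1 this with h | h
  · left; apply hext; rw [hfx, h, map_zero, act_zero]; rfl
  · right; apply hext; rw [hfx, sub_eq_zero.1 h, map_one, act_one]; rfl

end RightModules

section Duality

variable {k : Type u} [Field k] (T : ToupieAlg k)

/-- The dual `D(A)` of the left regular module. -/
def DA : Type u := Alg T →ₗ[k] k

instance : AddCommGroup (DA T) := inferInstanceAs (AddCommGroup (Alg T →ₗ[k] k))

instance : Module k (DA T) := inferInstanceAs (Module k (Alg T →ₗ[k] k))

instance : Module.Finite k (DA T) := inferInstanceAs (Module.Finite k (Alg T →ₗ[k] k))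

instance : FunLike (DA T) (Alg T) k := inferInstanceAs (FunLike (Alg T →ₗ[k] k) (Alg T) k)

instance : Module (Alg T)ᵐᵒᵖ (DA T) where
  smul b f := (show Alg T →ₗ[k] k from f).comp (LinearMap.mulLeft k b.unop)
  one_smul f := by
    refine LinearMap.ext fun y => ?_
    change f (1 * y) = f y
    rw [one_mul]
  mul_smul a b f := by
    refine LinearMap.ext fun y => ?_
    change f ((a * b).unop * y) = f (b.unop * (a.unop * y))
    rw [unop_mul, mul_assoc]
  smul_zero a := rfl
  smul_add a f g := rfl
  add_smul a b f := by
    refine LinearMap.ext fun y => ?_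
    change f ((a + b).unop * y) = f (a.unop * y) + f (b.unop * y)
    rw [unop_add, add_mul]
    exact map_add (show Alg T →ₗ[k] k from f) _ _
  zero_smul f := by
    refine LinearMap.ext fun y => ?_
    change f (0 * y) = 0
    rw [zero_mul]
    exact map_zero (show Alg T →ₗ[k] k from f)

variable {T}

@[ext] lemma DA.ext {f g : DA T} (h : ∀ x, f x = g x) : f = g := LinearMap.ext h

lemma DA.act_apply (f : DA T) (a b : Alg T) : (f <• a) b = f (a * b) := rfl

lemma DA.apply_smul (f : DA T) (c : k) (a : Alg T) : f (c • a) = c * f a :=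
  LinearMap.map_smul (show Alg T →ₗ[k] k from f) c a

lemma DA.apply_add (f : DA T) (a b : Alg T) : f (a + b) = f a + f b :=
  LinearMap.map_add (show Alg T →ₗ[k] k from f) a b

lemma DA.apply_zero (f : DA T) : f 0 = 0 :=
  LinearMap.map_zero (show Alg T →ₗ[k] k from f)

instance : IsScalarTower k (Alg T)ᵐᵒᵖ (DA T) :=
  ⟨fun c b f => by
    ext y
    change f ((c • b).unop * y) = c * f (b.unop * y)
    rw [unop_smul, smul_mul_assoc, DA.apply_smul]⟩

instance : Module.Finite (Alg T)ᵐᵒᵖ (DA T) := Module.Finite.of_restrictScalars_finite k _ _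

lemma DA.injective : Module.Injective (Alg T)ᵐᵒᵖ (DA T) := by
  refine Module.Baer.injective fun J g => ?_
  let φ : J.restrictScalars k →ₗ[k] k :=
    { toFun := fun j => g ⟨j.1, j.2⟩ 1
      map_add' := fun x y => by
        have : g ⟨(x + y).1, (x + y).2⟩ = g ⟨x.1, x.2⟩ + g ⟨y.1, y.2⟩ := by
          rw [← map_add]; rfl
        rw [this]; rfl
      map_smul' := fun c x => by
        have : (⟨(c • x).1, (c • x).2⟩ : J) = op (algebraMap k (Alg T) c) • ⟨x.1, x.2⟩ := by
          refine Subtype.ext ?_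
          change c • x.1 = op (algebraMap k (Alg T) c) * x.1
          rw [Algebra.smul_def]; rfl
        rw [this, map_act, DA.act_apply, mul_one, Algebra.algebraMap_eq_smul_one, DA.apply_smul]
        rfl }
  obtain ⟨Φ, hΦ⟩ := φ.exists_extend
  let f : DA T := Φ.comp (MulOpposite.opLinearEquiv k).toLinearMap
  refine ⟨LinearMap.toSpanSingleton _ _ f, fun x hx => ?_⟩
  ext b
  have h1 : Φ (op b * x) = φ ⟨op b * x, J.mul_mem_left _ hx⟩ :=
    LinearMap.congr_fun hΦ ⟨op b * x, J.mul_mem_left _ hx⟩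
  have h2 : g ⟨op b * x, J.mul_mem_left _ hx⟩ = op b • g ⟨x, hx⟩ := by
    rw [← map_smul]; rfl
  change Φ (op (x.unop * b)) = _
  rw [op_mul, op_unop, h1]
  change g ⟨op b * x, _⟩ 1 = _
  rw [h2, DA.act_apply, mul_one]

section

variable {Y : Type u} [AddCommGroup Y] [Module (Alg T)ᵐᵒᵖ Y]

/-- The map to `D(A)` induced by a linear functional. -/
def DA.homOf (φ : Y →+ k) (hφ : ∀ (c : k) y, φ (y <• algebraMap k (Alg T) c) = c * φ y) :
    Y →ₗ[(Alg T)ᵐᵒᵖ] DA T where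
  toFun y :=
    { toFun := fun a => φ (y <• a)
      map_add' := fun a b => by rw [act_add, map_add]
      map_smul' := fun c a => by rw [act_smul, hφ]; rfl }
  map_add' y z := by
    refine LinearMap.ext fun a => ?_
    change φ ((y + z) <• a) = φ (y <• a) + φ (z <• a)
    rw [smul_add, map_add]
  map_smul' b y := by
    refine LinearMap.ext fun a => ?_
    change φ ((b • y) <• a) = φ (y <• (b.unop * a))
    rw [← act_act, op_unop]

lemma DA.exists_hom {y : Y} (hy : y ≠ 0) : ∃ j : Y →ₗ[(Alg T)ᵐᵒᵖ] DA T, j y 1 ≠ 0 := by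
  let _ : Module k Y := Module.compHom Y (algebraMap k (Alg T)ᵐᵒᵖ)
  obtain ⟨φ, hφ⟩ : ∃ φ : Y →ₗ[k] k, φ y ≠ 0 := by
    by_contra! h
    exact hy ((Module.forall_dual_apply_eq_zero_iff k _).1 h)
  refine ⟨DA.homOf φ.toAddMonoidHom fun c y => φ.map_smul c y, ?_⟩
  change φ (y <• (1 : Alg T)) ≠ 0
  rwa [act_one]

lemma DA.cogenerator (Y : Type u) [AddCommGroup Y] [Module (Alg T)ᵐᵒᵖ Y]
    (hY : Module.Finite (Alg T)ᵐᵒᵖ Y) :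
    ∃ (n : ℕ) (j : Y →ₗ[(Alg T)ᵐᵒᵖ] (Fin n → DA T)), Function.Injective j := by
  let _ : Module k Y := Module.compHom Y (algebraMap k (Alg T)ᵐᵒᵖ)
  have hs : ∀ (c : k) (y : Y), c • y = algebraMap k (Alg T)ᵐᵒᵖ c • y := fun c y => rfl
  have : IsScalarTower k (Alg T)ᵐᵒᵖ Y := ⟨fun c b y => by
    rw [hs, smul_smul, Algebra.smul_def]⟩
  have : Module.Finite k Y := Module.Finite.trans (Alg T)ᵐᵒᵖ Y
  let bs := Module.finBasis k Y
  refine ⟨_, LinearMap.pi fun i =>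
    DA.homOf (bs.coord i).toAddMonoidHom fun c y => (bs.coord i).map_smul c y, ?_⟩
  rw [injective_iff_map_eq_zero]
  intro y hy
  refine bs.repr.map_eq_zero_iff.1 (Finsupp.ext fun i => ?_)
  have : bs.repr (y <• (1 : Alg T)) i = 0 := DFunLike.congr_fun (congrFun hy i) (1 : Alg T)
  rwa [act_one] at this

end

/-- The indecomposable projective module `e_v A`. -/
def Pm (v : Vtx T.t T.ℓ) : Submodule (Alg T)ᵐᵒᵖ (Alg T) where
  carrier := {x | e T v * x = x}
  add_mem' {x y} hx hy := by
    change e T v * (x + y) = x + y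
    rw [mul_add, hx, hy]
  zero_mem' := mul_zero _
  smul_mem' a x hx := by
    change e T v * (x * a.unop) = x * a.unop
    rw [← mul_assoc, hx]

lemma mem_Pm {v : Vtx T.t T.ℓ} {x : Alg T} : x ∈ Pm v ↔ e T v * x = x := Iff.rfl

/-- The generator of `e_v A`. -/
def Pm.gen (v : Vtx T.t T.ℓ) : Pm (T := T) v := ⟨e T v, e_mul_self T v⟩

lemma Pm.gen_act (v : Vtx T.t T.ℓ) (a : Alg T) :
    ((Pm.gen v <• a : Pm (T := T) v) : Alg T) = e T v * a := rfl

lemma Pm.gen_act_e (v : Vtx T.t T.ℓ) : Pm.gen v <• e T v = Pm.gen (T := T) v :=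
  Subtype.ext (e_mul_self T v)

lemma Pm.act_coe {v : Vtx T.t T.ℓ} (x : Pm (T := T) v) (a : Alg T) :
    ((x <• a : Pm (T := T) v) : Alg T) = x * a := rfl

lemma Pm.exists_act (v : Vtx T.t T.ℓ) (x : Pm (T := T) v) : ∃ a : Alg T, Pm.gen v <• a = x :=
  ⟨x.1, Subtype.ext x.2⟩

lemma Pm.indec (v : Vtx T.t T.ℓ) : IsIndec (Alg T)ᵐᵒᵖ (Pm (T := T) v) :=
  isIndec_of_cyclic (x := Pm.gen v) (fun h => e_ne_zero T v (congrArg Subtype.val h))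
    (Pm.gen_act_e v) (Pm.exists_act v)

variable {M : Type u} [AddCommGroup M] [Module (Alg T)ᵐᵒᵖ M]

/-- The map `e_v A → M` given by an element of `M e_v`. -/
def Pm.lift (v : Vtx T.t T.ℓ) (x : M) : Pm (T := T) v →ₗ[(Alg T)ᵐᵒᵖ] M where
  toFun a := x <• (a : Alg T)
  map_add' a b := act_add _ _ _
  map_smul' b a := by
    change x <• ((a : Alg T) * b.unop) = _
    rw [← act_act]; rfl

lemma Pm.lift_apply (v : Vtx T.t T.ℓ) (x : M) (a : Pm (T := T) v) :
    Pm.lift v x a = x <• (a : Alg T) := rfl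

lemma Pm.lift_gen {v : Vtx T.t T.ℓ} {x : M} (hx : x <• e T v = x) :
    Pm.lift v x (Pm.gen v) = x := hx

/-- The regular module. -/
def regEquiv : (Alg T)ᵐᵒᵖ ≃ₗ[(Alg T)ᵐᵒᵖ] Alg T where
  toFun := unop
  invFun := op
  map_add' _ _ := rfl
  map_smul' _ _ := rfl
  left_inv _ := rfl
  right_inv _ := rfl

lemma regular_projective : Module.Projective (Alg T)ᵐᵒᵖ (Alg T) := .of_equiv' regEquiv

instance : Module.Finite (Alg T)ᵐᵒᵖ (Alg T) := Module.Finite.equiv regEquiv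

lemma Pm.finite (v : Vtx T.t T.ℓ) : Module.Finite (Alg T)ᵐᵒᵖ (Pm (T := T) v) := inferInstance

lemma Pm.projective (v : Vtx T.t T.ℓ) : Module.Projective (Alg T)ᵐᵒᵖ (Pm (T := T) v) := by
  have := regular_projective (T := T)
  refine Module.Projective.of_split (Pm v).subtype
    { toFun := fun a => ⟨e T v * a, by rw [mem_Pm, ← mul_assoc, e_mul_self]⟩
      map_add' := fun a b => Subtype.ext (mul_add _ _ _)
      map_smul' := fun b a => Subtype.ext (mul_assoc _ _ _).symm } ?_
  ext x
  exact x.2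

/-- The indecomposable injective module `D(A e_v)`. -/
def Im (v : Vtx T.t T.ℓ) : Submodule (Alg T)ᵐᵒᵖ (DA T) where
  carrier := {f | ∀ a, f (a * e T v) = f a}
  add_mem' {f g} hf hg a := by
    change f (a * e T v) + g (a * e T v) = f a + g a
    rw [hf, hg]
  zero_mem' _ := rfl
  smul_mem' b f hf a := by
    change f (b.unop * (a * e T v)) = f (b.unop * a)
    rw [← mul_assoc, hf]

/-- The projection `f ↦ f(- e_v)` of `D(A)` onto `D(A e_v)`. -/
def Im.proj (v : Vtx T.t T.ℓ) : DA T →ₗ[(Alg T)ᵐᵒᵖ] Im (T := T) v where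
  toFun f := ⟨(show Alg T →ₗ[k] k from f).comp (LinearMap.mulRight k (e T v)), fun a => by
    change f (a * e T v * e T v) = f (a * e T v)
    rw [mul_assoc, e_mul_self]⟩
  map_add' f g := rfl
  map_smul' b f := by
    refine Subtype.ext (DA.ext fun a => ?_)
    change f (b.unop * (a * e T v)) = f ((b.unop * a) * e T v)
    rw [mul_assoc]

lemma Im.proj_apply (v : Vtx T.t T.ℓ) (f : DA T) (a : Alg T) :
    ((Im.proj v f : Im (T := T) v) : DA T) a = f (a * e T v) := rfl

lemma Im.proj_coe (v : Vtx T.t T.ℓ) (f : Im (T := T) v) : Im.proj v (f : DA T) = f :=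
  Subtype.ext (DA.ext fun a => f.2 a)

lemma DA.sum_proj (f : DA T) : ∑ v, ((Im.proj v f : Im (T := T) v) : DA T) = f := by
  ext a
  have h1 : ∀ s : Finset (Vtx T.t T.ℓ), (∑ v ∈ s, ((Im.proj v f : Im (T := T) v) : DA T)) a =
      f (a * ∑ v ∈ s, e T v) := by
    intro s
    induction s using Finset.induction_on with
    | empty => rw [Finset.sum_empty, Finset.sum_empty, mul_zero, DA.apply_zero]; rfl
    | insert v s hv ih =>
      rw [Finset.sum_insert hv, Finset.sum_insert hv, mul_add, DA.apply_add, ← ih]; rfl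
  rw [h1, sum_e, mul_one]

lemma Im.injective (v : Vtx T.t T.ℓ) : Module.Injective (Alg T)ᵐᵒᵖ (Im (T := T) v) :=
  injective_of_retract DA.injective (Im v).subtype (Im.proj v) (Im.proj_coe v)

lemma Im.exists_ne_zero (v : Vtx T.t T.ℓ) : ∃ f : Im (T := T) v, f ≠ 0 := by
  obtain ⟨φ, hφ⟩ : ∃ φ : Alg T →ₗ[k] k, φ (e T v) ≠ 0 := by
    by_contra! h
    exact e_ne_zero T v ((Module.forall_dual_apply_eq_zero_iff k _).1 h)
  refine ⟨Im.proj v φ, fun h => hφ ?_⟩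
  have h1 : φ (e T v * e T v) = 0 := congrArg (fun g : Im (T := T) v => (g : DA T) (e T v)) h
  rwa [e_mul_self] at h1

lemma Im.finite (v : Vtx T.t T.ℓ) : Module.Finite (Alg T)ᵐᵒᵖ (Im (T := T) v) := inferInstance

lemma Im.indec (v : Vtx T.t T.ℓ) : IsIndec (Alg T)ᵐᵒᵖ (Im (T := T) v) := by
  have key : ∀ f : Im (T := T) v, f ≠ 0 → ∃ a : Alg T, ((f <• a : Im v) : DA T) (e T v) = 1 := by
    intro f hf
    obtain ⟨b, hb⟩ : ∃ b, (f : DA T) b ≠ 0 := by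
      by_contra! h
      exact hf (Subtype.ext (DA.ext h))
    refine ⟨((f : DA T) b)⁻¹ • b, ?_⟩
    change (f : DA T) ((((f : DA T) b)⁻¹ • b) * e T v) = 1
    rw [f.2, DA.apply_smul, inv_mul_cancel₀ hb]
  have hsoc : ∀ f : Im (T := T) v, (f : DA T) (e T v) = 1 → ∀ g : Im (T := T) v,
      (g : DA T) (e T v) = 1 → f <• e T v = g <• e T v := by
    intro f hf g hg
    refine Subtype.ext (DA.ext fun a => ?_)
    obtain ⟨r, hr⟩ := e_mul_e_self T v a
    change (f : DA T) (e T v * a) = (g : DA T) (e T v * a)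
    rw [← f.2, ← g.2, hr, DA.apply_smul, DA.apply_smul, hf, hg]
  have hne : ∀ f : Im (T := T) v, (f : DA T) (e T v) = 1 → f <• e T v ≠ 0 := by
    intro f hf h0
    have : (f : DA T) (e T v * e T v) = 0 :=
      congrArg (fun g : Im (T := T) v => (g : DA T) (e T v)) h0
    rw [e_mul_self, hf] at this
    exact one_ne_zero this
  obtain ⟨f₀, hf₀⟩ := Im.exists_ne_zero v
  refine ⟨⟨f₀, 0, hf₀⟩, fun (p : Im (T := T) v →ₗ[(Alg T)ᵐᵒᵖ] Im (T := T) v) hp => ?_⟩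
  have hp' : ∀ x, p (p x) = p x := LinearMap.congr_fun hp
  by_contra! hc
  obtain ⟨x, hx⟩ : ∃ x, p x ≠ 0 := by
    by_contra! h
    exact hc.1 (LinearMap.ext h)
  obtain ⟨y, hy⟩ : ∃ y, y - p y ≠ 0 := by
    by_contra! h
    exact hc.2 (LinearMap.ext fun y => (sub_eq_zero.1 (h y)).symm)
  obtain ⟨a, ha⟩ := key _ hx
  obtain ⟨b, hb⟩ := key _ hy
  have h1 := hsoc _ ha _ hb
  have h2 := congrArg p h1
  rw [map_act, map_act, map_act, map_act, hp', map_sub, hp', sub_self, smul_zero, smul_zero] at h2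
  exact hne _ ha h2

end Duality

section Cycles

variable {k : Type u} [Field k] {T : ToupieAlg k}

lemma Pm.reach {M : ModuleCat.{u} (Alg T)ᵐᵒᵖ} (hM : Indec _ M) (hM' : FdMod _ M) {x : M}
    {v : Vtx T.t T.ℓ} (hx : x <• e T v ≠ 0) : Reach (ModuleCat.of (Alg T)ᵐᵒᵖ (Pm (T := T) v)) M := by
  refine Reach.of_map (Pm.indec v) (Pm.finite v) hM hM' (f := Pm.lift v x) fun h => hx ?_
  exact LinearMap.congr_fun h (Pm.gen v)

lemma Im.exists_hom {M : Type u} [AddCommGroup M] [Module (Alg T)ᵐᵒᵖ M] {x : M} {v : Vtx T.t T.ℓ}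
    (hx : x <• e T v ≠ 0) : ∃ f : M →ₗ[(Alg T)ᵐᵒᵖ] Im (T := T) v, f ≠ 0 := by
  obtain ⟨j, hj⟩ := DA.exists_hom (T := T) hx
  refine ⟨(Im.proj v).comp j, fun h => hj ?_⟩
  have h1 : (Im.proj v (j x) : DA T) 1 = 0 :=
    congrArg (fun g : Im (T := T) v => (g : DA T) 1) (LinearMap.congr_fun h x)
  rw [Im.proj_apply, one_mul] at h1
  rw [map_act, DA.act_apply, mul_one, h1]

lemma Im.reach {M : ModuleCat.{u} (Alg T)ᵐᵒᵖ} (hM : Indec _ M) (hM' : FdMod _ M) {x : M}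
    {v : Vtx T.t T.ℓ} (hx : x <• e T v ≠ 0) :
    Reach M (ModuleCat.of (Alg T)ᵐᵒᵖ (Im (T := T) v)) := by
  obtain ⟨f, hf⟩ := Im.exists_hom hx
  exact Reach.of_map hM hM' (Im.indec v) (Im.finite v) hf

lemma Pm.reach_vt (i : Fin T.t) {a : ℕ} (ha : a ≤ T.ℓ i) :
    Reach (ModuleCat.of (Alg T)ᵐᵒᵖ (Pm (T := T) (vt T i a))) (ModuleCat.of _ (Pm (T := T) .src)) := by
  induction a with
  | zero => rw [vt_zero]; exact Reach.refl (Pm.indec _) (Pm.finite _)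
  | succ a ih =>
    refine (Pm.reach (Pm.indec (vt T i a)) (Pm.finite _)
      (x := (Pm.gen (vt T i a) <• ar T i a : Pm (T := T) (vt T i a))) fun h => ?_).trans
      (ih (by omega))
    have h1 : e T (vt T i a) * ar T i a = 0 :=
      congrArg Subtype.val ((act_ar_e (Pm.gen (vt T i a)) i a).symm.trans h)
    rw [e_mul_ar] at h1
    exact ar_ne_zero T ha h1

lemma exists_vt (v : Vtx T.t T.ℓ) : ∃ i, ∃ a ≤ T.ℓ i, v = vt T i a := by
  rcases vt_exhaust T v with rfl | rfl | ⟨i, a, -, h, rfl⟩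
  · exact ⟨⟨0, by have := T.ht; omega⟩, 0, Nat.zero_le _, (vt_zero T _).symm⟩
  · exact ⟨⟨0, by have := T.ht; omega⟩, _, le_rfl, (vt_len T _).symm⟩
  · exact ⟨i, a, h.le, rfl⟩

lemma Pm.reach_src (v : Vtx T.t T.ℓ) :
    Reach (ModuleCat.of (Alg T)ᵐᵒᵖ (Pm (T := T) v)) (ModuleCat.of _ (Pm (T := T) .src)) := by
  obtain ⟨i, a, ha, rfl⟩ := exists_vt v
  exact Pm.reach_vt i ha

lemma Im.reach_vt (i : Fin T.t) {a : ℕ} (n : ℕ) (ha : a + n = T.ℓ i) :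
    Reach (ModuleCat.of (Alg T)ᵐᵒᵖ (Im (T := T) .snk)) (ModuleCat.of _ (Im (T := T) (vt T i a))) := by
  induction n generalizing a with
  | zero =>
    rw [add_zero] at ha
    rw [ha, vt_len]; exact Reach.refl (Im.indec _) (Im.finite _)
  | succ n ih =>
    refine (ih (a := a + 1) (by omega)).trans ?_
    obtain ⟨φ, hφ⟩ : ∃ φ : Alg T →ₗ[k] k, φ (ar T i a) ≠ 0 := by
      by_contra! h
      exact ar_ne_zero T (show a < T.ℓ i by omega) ((Module.forall_dual_apply_eq_zero_iff k _).1 h)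
    refine Im.reach (Im.indec _) (Im.finite _) (x := Im.proj (vt T i (a + 1)) φ) fun h => hφ ?_
    have h1 : φ (e T (vt T i a) * ar T i a * e T (vt T i (a + 1))) = 0 :=
      congrArg (fun g : Im (T := T) (vt T i (a + 1)) => (g : DA T) (ar T i a)) h
    rwa [e_mul_ar, ar_mul_e] at h1

lemma Im.reach_snk (v : Vtx T.t T.ℓ) :
    Reach (ModuleCat.of (Alg T)ᵐᵒᵖ (Im (T := T) .snk)) (ModuleCat.of _ (Im (T := T) v)) := by
  obtain ⟨i, a, ha, rfl⟩ := exists_vt v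
  exact Im.reach_vt i (T.ℓ i - a) (by omega)

lemma Im.exists_ne_zero_of_DA {M : Type u} [AddCommGroup M] [Module (Alg T)ᵐᵒᵖ M]
    {f : DA T →ₗ[(Alg T)ᵐᵒᵖ] M} (hf : f ≠ 0) :
    ∃ v, ∃ g : Im (T := T) v →ₗ[(Alg T)ᵐᵒᵖ] M, g ≠ 0 := by
  by_contra! h
  refine hf (LinearMap.ext fun x => ?_)
  rw [← DA.sum_proj x, map_sum]
  exact Finset.sum_eq_zero fun v _ =>
    LinearMap.congr_fun (h v (f.comp (Im v).subtype)) (Im.proj v x)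

/-- Every indecomposable projective has a path to the projective at the source. -/
lemma reach_src_of_projective {P : ModuleCat.{u} (Alg T)ᵐᵒᵖ} (hP : Indec _ P) (hP' : FdMod _ P)
    (h : Module.Projective (Alg T)ᵐᵒᵖ P) :
    Reach P (ModuleCat.of _ (Pm (T := T) .src)) := by
  obtain ⟨x, hx⟩ := @exists_ne P hP.1 0
  obtain ⟨s, hs⟩ := h.out
  have hsx : s x ≠ 0 := by
    intro h0
    have := hs x
    rw [h0, map_zero] at this
    exact hx this.symm
  obtain ⟨y, hy⟩ : ∃ y, s x y ≠ 0 := by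
    by_contra! h0
    exact hsx (Finsupp.ext h0)
  obtain ⟨v, hv⟩ : ∃ v, e T v * (s x y).unop ≠ 0 := by
    by_contra! h0
    refine hy (unop_injective ?_)
    rw [← one_mul (unop (s x y)), ← sum_e, Finset.sum_mul]
    exact Finset.sum_eq_zero fun v _ => h0 v
  let g : P →ₗ[(Alg T)ᵐᵒᵖ] Pm (T := T) v :=
    { toFun := fun z => ⟨e T v * (s z y).unop, by rw [mem_Pm, ← mul_assoc, e_mul_self]⟩
      map_add' := fun a b => Subtype.ext (by
        change e T v * (s (a + b) y).unop = e T v * (s a y).unop + e T v * (s b y).unop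
        rw [map_add, Finsupp.add_apply, unop_add, mul_add])
      map_smul' := fun b a => Subtype.ext (by
        change e T v * (s (b • a) y).unop = e T v * (s a y).unop * b.unop
        rw [map_smul, Finsupp.smul_apply, smul_eq_mul, unop_mul, mul_assoc]) }
  refine (Reach.of_map hP hP' (Pm.indec v) (Pm.finite v) (f := g) fun h0 => hv ?_).trans
    (Pm.reach_src v)
  exact congrArg Subtype.val (LinearMap.congr_fun h0 x)

theorem quasitilted_of_weaklyShod (hm : mDim T ≠ 0) (h : WeaklyShod (Alg T)ᵐᵒᵖ) :
    Quasitilted (Alg T)ᵐᵒᵖ := by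
  rw [Ne, mDim_eq_zero_iff] at hm
  push Not at hm
  obtain ⟨a, ha⟩ := hm
  have hPI : Reach (ModuleCat.of (Alg T)ᵐᵒᵖ (Pm (T := T) .src))
      (ModuleCat.of _ (Im (T := T) .snk)) :=
    Im.reach (Pm.indec _) (Pm.finite _) (x := (Pm.gen .src <• a : Pm (T := T) .src)) fun h0 =>
      ha (congrArg Subtype.val h0)
  intro P hP hP' hproj
  refine ⟨hP, hP', fun X hX hX' hXP => ?_⟩
  by_contra hpd
  have hXI := ((Reach.of_indPath hX hX' hXP).trans (reach_src_of_projective hP hP' hproj)).trans hPI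
  obtain ⟨C, hC, hC', ⟨f, hf⟩, hext⟩ :=
    exists_not_ext1Zero_of_not_pdLeOne DA.injective inferInstance DA.cogenerator hX' hpd
  obtain ⟨v, g, hg⟩ := Im.exists_ne_zero_of_DA hf
  have hIC := (Im.reach_snk v).trans (Reach.of_map (Im.indec v) (Im.finite v) hC hC' hg)
  have hIX := hIC.transGen (transGen_of_not_ext1Zero hX hX' hC hC' hext)
  have hII := transGen_reach hIX hXI
  have hXI' : Relation.TransGen (Step (Alg T)ᵐᵒᵖ) X (ModuleCat.of _ (Im (T := T) .snk)) :=
    hXI.transGen hII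
  have hR : InRightPart (Alg T)ᵐᵒᵖ (ModuleCat.of _ (Im (T := T) .snk)) := by
    by_contra hR
    refine h _ (Im.indec _) (Im.finite _) (fun hL => ?_) hR hII
    exact hpd (hL.2.2 X hX hX' hXI'.to_reflTransGen)
  have hid : ∀ Z, Relation.TransGen (Step (Alg T)ᵐᵒᵖ) (ModuleCat.of _ (Im (T := T) .snk)) Z →
      IdLeOne (Alg T)ᵐᵒᵖ Z := by
    intro Z hZ
    obtain ⟨Y, -, hY⟩ := Relation.TransGen.tail'_iff.1 hZ
    exact hR.2.2 Z hY.2.2.1 hY.2.2.2.1 hZ.to_reflTransGen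
  have key : ∃ Y, Relation.TransGen (Step (Alg T)ᵐᵒᵖ) (ModuleCat.of _ (Im (T := T) .snk)) Y ∧
      Indec _ Y ∧ FdMod _ Y ∧ ¬ Ext1Zero (Alg T)ᵐᵒᵖ P Y := by
    clear hproj hP hP'
    induction hXP with
    | refl => exact ⟨C, transGen_reach hII hIC, hC, hC', hext⟩
    | tail _ hst ih =>
      obtain ⟨h1, h2, -, -, f, hf, -⟩ := hst
      obtain ⟨Y, hY, hYi, hYf, hYe⟩ := ih
      exact exists_not_ext1Zero_of_map hid h1 h2 hf hY hYi hYf hYe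
  obtain ⟨Y, -, -, -, hY⟩ := key
  exact hY (ext1Zero_of_projective hproj)

end Cycles

section Simples

variable {k : Type u} [Field k] {T : ToupieAlg k}

lemma e_mul_eq_zero {i : Fin T.t} {c : ℕ} (hc : 0 < c) (hcl : c ≤ T.ℓ i) {x : Alg T}
    (h : ∀ d, c ≤ d → d ≤ T.ℓ i → e T (vt T i c) * x * e T (vt T i d) = 0) :
    e T (vt T i c) * x = 0 := by
  rw [← mul_one (e T (vt T i c) * x), ← sum_e, Finset.mul_sum]
  refine Finset.sum_eq_zero fun v _ => ?_
  by_cases hv : ∃ d, c ≤ d ∧ d ≤ T.ℓ i ∧ v = vt T i d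
  · obtain ⟨d, h1, h2, rfl⟩ := hv
    exact h d h1 h2
  · push Not at hv
    have h1 := e_mul_mem_span T hc hcl x
    refine Submodule.span_induction (p := fun y _ => y * e T v = 0) ?_ (zero_mul _) ?_ ?_ h1
    · rintro y ⟨b, h1, h2, rfl⟩
      exact pp_mul_e_of_ne T h1 (hv b h1 h2)
    · intro y z _ _ hy hz; rw [add_mul, hy, hz, add_zero]
    · intro r y _ hy; rw [smul_mul_assoc, hy, smul_zero]

lemma mul_e_eq_zero {i : Fin T.t} {c : ℕ} (hcl : c < T.ℓ i) {x : Alg T}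
    (h : ∀ a, a ≤ c → e T (vt T i a) * (x * e T (vt T i c)) = 0) :
    x * e T (vt T i c) = 0 := by
  rw [← one_mul (x * e T (vt T i c)), ← sum_e, Finset.sum_mul]
  refine Finset.sum_eq_zero fun v _ => ?_
  by_cases hv : ∃ a, a ≤ c ∧ v = vt T i a
  · obtain ⟨a, h1, rfl⟩ := hv
    exact h a h1
  · push Not at hv
    have h1 := mul_e_mem_span T hcl x
    refine Submodule.span_induction (p := fun y _ => e T v * y = 0) ?_ (mul_zero _) ?_ ?_ h1
    · rintro y ⟨b, h1, rfl⟩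
      exact e_mul_pp_of_ne T (hv b h1)
    · intro y z _ _ hy hz; rw [mul_add, hy, hz, add_zero]
    · intro r y _ hy; rw [mul_smul_comm, hy, smul_zero]

/-- An element of `A e_c` between vertices of a branch is a multiple of a path. -/
lemma e_mul_mul_e_smul {i : Fin T.t} {a c : ℕ} (hac : a ≤ c) (hcl : c < T.ℓ i) (x : Alg T) :
    ∃ r : k, e T (vt T i a) * (x * e T (vt T i c)) = r • pp T i a c := by
  refine Submodule.span_induction (p := fun y _ => ∃ r : k, e T (vt T i a) * y = r • pp T i a c)
    ?_ ⟨0, by rw [mul_zero, zero_smul]⟩ ?_ ?_ (mul_e_mem_span T hcl x)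
  · rintro y ⟨b, h1, rfl⟩
    by_cases hab : a = b
    · subst hab
      exact ⟨1, by rw [e_mul_pp, one_smul]⟩
    · exact ⟨0, by rw [e_mul_pp_of_ne T fun h => hab (vtx_inj (by omega) (by omega) h), zero_smul]⟩
  · rintro y z _ _ ⟨r, hr⟩ ⟨s, hs⟩
    exact ⟨r + s, by rw [mul_add, hr, hs, add_smul]⟩
  · rintro s y _ ⟨r, hr⟩
    exact ⟨s * r, by rw [mul_smul_comm, hr, mul_smul]⟩

lemma e_mul_decomp {i : Fin T.t} {w : ℕ} (hw : 0 < w) (hwl : w ≤ T.ℓ i) (x : Alg T) :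
    ∃ (r : k) (b : Alg T), e T (vt T i w) * x = r • e T (vt T i w) + ar T i w * b := by
  refine Submodule.span_induction
    (p := fun y _ => ∃ (r : k) (b : Alg T), y = r • e T (vt T i w) + ar T i w * b)
    ?_ ⟨0, 0, by simp⟩ ?_ ?_ (e_mul_mem_span T hw hwl x)
  · rintro y ⟨b, h1, -, rfl⟩
    rcases h1.eq_or_lt with rfl | h1
    · exact ⟨1, 0, by rw [pp_of_le T le_rfl]; simp⟩
    · exact ⟨0, _, by rw [pp_cons T h1, zero_smul, zero_add]⟩
  · rintro y z _ _ ⟨r, b, hr⟩ ⟨s, c, hs⟩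
    exact ⟨r + s, b + c, by rw [hr, hs, add_smul, mul_add]; abel⟩
  · rintro s y _ ⟨r, b, hr⟩
    exact ⟨s * r, s • b, by rw [hr, smul_add, mul_smul, mul_smul_comm]⟩

lemma mul_e_decomp {i : Fin T.t} {w : ℕ} (hwl : w + 1 < T.ℓ i) (x : Alg T) :
    ∃ (r : k) (b : Alg T), x * e T (vt T i (w + 1)) = r • e T (vt T i (w + 1)) + b * ar T i w := by
  refine Submodule.span_induction
    (p := fun y _ => ∃ (r : k) (b : Alg T), y = r • e T (vt T i (w + 1)) + b * ar T i w)
    ?_ ⟨0, 0, by simp⟩ ?_ ?_ (mul_e_mem_span T hwl x)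
  · rintro y ⟨b, h1, rfl⟩
    rcases h1.eq_or_lt with rfl | h1
    · exact ⟨1, 0, by rw [pp_of_le T le_rfl]; simp⟩
    · exact ⟨0, _, by rw [pp_succ T (Nat.lt_succ_iff.1 h1), zero_smul, zero_add]⟩
  · rintro y z _ _ ⟨r, b, hr⟩ ⟨s, c, hs⟩
    exact ⟨r + s, b + c, by rw [hr, hs, add_smul, add_mul]; abel⟩
  · rintro s y _ ⟨r, b, hr⟩
    exact ⟨s * r, s • b, by rw [hr, smul_add, mul_smul, smul_mul_assoc]⟩

lemma act_eq_alg {K : Type u} [AddCommGroup K] [Module (Alg T)ᵐᵒᵖ K] {y : K} {v : Vtx T.t T.ℓ}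
    (hv : y <• e T v = y) (har : ∀ i j, y <• ar T i j = 0) (a : Alg T) :
    ∃ r : k, y <• a = y <• algebraMap k (Alg T) r := by
  induction a using alg_induction with
  | he w =>
    by_cases h : v = w
    · subst h; exact ⟨1, by rw [map_one, act_one, hv]⟩
    · exact ⟨0, by rw [map_zero, act_zero, act_e_of_ne hv h]⟩
  | hp i a b hab hb => exact ⟨0, by rw [map_zero, act_zero, pp_cons T hab, ← act_act, har, smul_zero]⟩
  | h0 => exact ⟨0, by rw [map_zero]⟩
  | hadd a b ha hb =>
    obtain ⟨r, hr⟩ := ha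
    obtain ⟨s, hs⟩ := hb
    exact ⟨r + s, by rw [act_add, hr, hs, map_add, act_add]⟩
  | hsmul c a ha =>
    obtain ⟨r, hr⟩ := ha
    exact ⟨r * c, by rw [act_smul, hr, act_act, map_mul]⟩

/-- Induction on a filtration with simple quotients. -/
lemma induction_simple {Φ : ModuleCat.{u} (Alg T)ᵐᵒᵖ → Prop}
    (hsub : ∀ (M : Type u) [AddCommGroup M] [Module (Alg T)ᵐᵒᵖ M] [Subsingleton M],
      Φ (ModuleCat.of _ M))
    (hses : ∀ (M M'' : Type u) [AddCommGroup M] [Module (Alg T)ᵐᵒᵖ M] [AddCommGroup M'']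
      [Module (Alg T)ᵐᵒᵖ M''] (g : M →ₗ[(Alg T)ᵐᵒᵖ] M''), Function.Surjective g →
      Φ (ModuleCat.of _ (LinearMap.ker g)) → Φ (ModuleCat.of _ M'') → Φ (ModuleCat.of _ M))
    {V : Vtx T.t T.ℓ → Prop}
    (hs : ∀ v, V v → ∀ (K : Type u) [AddCommGroup K] [Module (Alg T)ᵐᵒᵖ K] (y : K), y ≠ 0 →
      y <• e T v = y → (∀ i j, y <• ar T i j = 0) → (∀ z, ∃ a : Alg T, y <• a = z) →
      Φ (ModuleCat.of _ K))
    {M : Type u} [AddCommGroup M] [Module (Alg T)ᵐᵒᵖ M] [Module.Finite (Alg T)ᵐᵒᵖ M]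
    (hV : ∀ v, ∀ x : M, x <• e T v ≠ 0 → V v) : Φ (ModuleCat.of _ M) := by
  have key : ∀ N : Submodule (Alg T)ᵐᵒᵖ M, Φ (ModuleCat.of _ (M ⧸ N)) := by
    intro N
    refine IsNoetherian.induction (P := fun N => Φ (ModuleCat.of _ (M ⧸ N))) (fun N ih => ?_) N
    by_cases hN : N = ⊤
    · subst hN
      exact hsub _
    obtain ⟨v, x, -, hxv, hxN, hxa⟩ := exists_homogeneous_max (K := N) (P := ⊤)
      (fun h => hN (top_le_iff.1 h))
    have hle : N ≤ N ⊔ Submodule.span _ {x} := le_sup_left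
    have hx' : x ∈ N ⊔ Submodule.span (Alg T)ᵐᵒᵖ {x} :=
      Submodule.mem_sup_right (Submodule.mem_span_singleton_self x)
    have hlt : N < N ⊔ Submodule.span _ {x} := lt_of_le_of_ne hle fun h => hxN (h ▸ hx')
    refine hses _ _ (Submodule.factor hle) (Submodule.factor_surjective hle) ?_ (ih _ hlt)
    have hker : N.mkQ x ∈ LinearMap.ker (Submodule.factor hle) := by
      rw [LinearMap.mem_ker]
      exact (Submodule.Quotient.mk_eq_zero _).2 hx'
    refine hs v (hV v x (by rw [hxv]; rintro rfl; exact hxN N.zero_mem)) _ ⟨N.mkQ x, hker⟩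
      (fun h => hxN ((Submodule.Quotient.mk_eq_zero N).1 (congrArg Subtype.val h)))
      (Subtype.ext (congrArg N.mkQ hxv))
      (fun i j => Subtype.ext ((Submodule.Quotient.mk_eq_zero N).2 (hxa i j))) ?_
    rintro ⟨z, hz⟩
    obtain ⟨m, rfl⟩ := N.mkQ_surjective z
    have hm : m ∈ N ⊔ Submodule.span (Alg T)ᵐᵒᵖ {x} :=
      (Submodule.Quotient.mk_eq_zero _).1 (LinearMap.mem_ker.1 hz)
    obtain ⟨n, hn, s, hs, rfl⟩ := Submodule.mem_sup.1 hm
    obtain ⟨a, rfl⟩ := Submodule.mem_span_singleton.1 hs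
    refine ⟨a.unop, Subtype.ext ?_⟩
    change N.mkQ (a • x) = N.mkQ (n + a • x)
    rw [map_add, Submodule.mkQ_apply N n, (Submodule.Quotient.mk_eq_zero N).2 hn, zero_add]
  refine hses M (M ⧸ (⊥ : Submodule (Alg T)ᵐᵒᵖ M)) (Submodule.mkQ ⊥) (Submodule.mkQ_surjective ⊥)
    ?_ (key ⊥)
  have : Subsingleton (LinearMap.ker (Submodule.mkQ (⊥ : Submodule (Alg T)ᵐᵒᵖ M))) := by
    rw [Submodule.ker_mkQ]; infer_instance
  exact hsub _

/-- The vertices whose simple modules are known to have projective dimension at most one. -/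
def PdVtx (v : Vtx T.t T.ℓ) : Prop :=
  v = .snk ∨ ∃ i w, 0 < w ∧ w < T.ℓ i ∧ v = vt T i w ∧ pp T i w (T.ℓ i) ≠ 0

/-- The vertices whose simple modules are known to have injective dimension at most one. -/
def IdVtx (v : Vtx T.t T.ℓ) : Prop :=
  v = .src ∨ ∃ i w, 0 < w ∧ w < T.ℓ i ∧ v = vt T i w ∧ pp T i 0 w ≠ 0

lemma pp_ne_zero_of_subpath {i : Fin T.t} {a a' b' b : ℕ} (h : pp T i a b ≠ 0) (h1 : a ≤ a')
    (h2 : a' ≤ b') (h3 : b' ≤ b) : pp T i a' b' ≠ 0 := by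
  intro h0
  rw [← pp_mul_pp T (h1.trans h2) h3, ← pp_mul_pp T h1 h2, h0, mul_zero, zero_mul] at h
  exact h rfl

variable {K : Type u} [AddCommGroup K] [Module (Alg T)ᵐᵒᵖ K]

lemma pdLeOne_simple {v : Vtx T.t T.ℓ} (hv : PdVtx v) {y : K} (hy : y ≠ 0)
    (hyv : y <• e T v = y) (har : ∀ i j, y <• ar T i j = 0) (hgen : ∀ z, ∃ a : Alg T, y <• a = z) :
    PdLeOne (Alg T)ᵐᵒᵖ (ModuleCat.of _ K) := by
  refine ⟨ModuleCat.of _ (Pm (T := T) v), Pm.lift v y, fun z => ?_, Pm.projective v, ?_⟩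
  · obtain ⟨a, rfl⟩ := hgen z
    exact ⟨Pm.gen v <• a, by rw [map_act, Pm.lift_gen hyv]⟩
  rcases hv with rfl | ⟨i, w, hw, hwl, rfl, hp⟩
  · have : Subsingleton (LinearMap.ker (Pm.lift (T := T) .snk y)) := by
      refine subsingleton_of_forall_eq 0 fun z => ?_
      obtain ⟨⟨a, ha⟩, hz⟩ := z
      rw [LinearMap.mem_ker] at hz
      obtain ⟨r, hr⟩ := e_snk_mul T a
      have h1 : y <• a = 0 := hz
      rw [mem_Pm] at ha
      rw [← ha, hr, act_smul, hyv] at h1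
      have hr0 : r = 0 := by
        by_contra hr0
        exact hy (act_alg_cancel hr0 h1)
      refine Subtype.ext (Subtype.ext ?_)
      change a = 0
      rw [← ha, hr, hr0, zero_smul]
    change Module.Projective (Alg T)ᵐᵒᵖ (LinearMap.ker (Pm.lift (T := T) .snk y))
    infer_instance
  · have := Pm.projective (vt T i (w + 1))
    let q : LinearMap.ker (Pm.lift (vt T i w) y) :=
      ⟨⟨ar T i w, e_mul_ar T i w⟩, by rw [LinearMap.mem_ker, Pm.lift_apply]; exact har i w⟩
    refine Module.Projective.of_equiv' (LinearEquiv.ofBijective (Pm.lift (vt T i (w + 1)) q) ⟨?_, ?_⟩)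
    · rw [injective_iff_map_eq_zero]
      rintro ⟨b, hb⟩ h0
      rw [mem_Pm] at hb
      have h1 : ar T i w * b = 0 := congrArg (fun z => z.1.1) h0
      refine Subtype.ext ?_
      change b = 0
      rw [← hb]
      refine e_mul_eq_zero (Nat.succ_pos w) hwl fun d h2 h3 => ?_
      rcases e_mul_e_branch T (Nat.succ_pos w) hwl h3 b with ⟨-, r, hr⟩ | ⟨h4, -⟩
      · have h4 : r • pp T i w d = 0 := by
          rw [pp_cons T (Nat.lt_of_succ_le h2), ← mul_smul_comm, ← hr, hb, ← mul_assoc, h1,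
            zero_mul]
        rw [hr, (smul_eq_zero.1 h4).resolve_right
          (pp_ne_zero_of_subpath hp le_rfl (by omega) h3), zero_smul]
      · omega
    · rintro ⟨⟨a, ha⟩, hz⟩
      rw [LinearMap.mem_ker, Pm.lift_apply] at hz
      change y <• a = 0 at hz
      rw [mem_Pm] at ha
      obtain ⟨r, b, hr⟩ := e_mul_decomp hw hwl.le a
      rw [ha] at hr
      have hr0 : r = 0 := by
        by_contra hr0
        rw [hr, act_add, act_smul, hyv, ← act_act, har, smul_zero, add_zero] at hz
        exact hy (act_alg_cancel hr0 hz)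
      rw [hr0, zero_smul, zero_add] at hr
      refine ⟨⟨e T (vt T i (w + 1)) * b, by rw [mem_Pm, ← mul_assoc, e_mul_self]⟩,
        Subtype.ext (Subtype.ext ?_)⟩
      change ar T i w * (e T (vt T i (w + 1)) * b) = a
      rw [← mul_assoc, ar_mul_e, hr]

lemma pdLeOne_of_support {M : Type u} [AddCommGroup M] [Module (Alg T)ᵐᵒᵖ M]
    [Module.Finite (Alg T)ᵐᵒᵖ M] (hV : ∀ v, ∀ x : M, x <• e T v ≠ 0 → PdVtx v) :
    PdLeOne (Alg T)ᵐᵒᵖ (ModuleCat.of _ M) :=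
  induction_simple (V := PdVtx) (fun _ _ _ _ => pdLeOne_of_projective inferInstance)
    (fun _ _ _ _ _ _ _ hg h' h'' => pdLeOne_of_ses hg h' h'')
    (fun _ hv _ _ _ _ hy hyv har hgen => pdLeOne_simple hv hy hyv har hgen) hV

/-- The map `D(A e_{w+1}) → D(A e_w)` induced by an arrow. -/
def Im.arrow (i : Fin T.t) (w : ℕ) :
    Im (T := T) (vt T i (w + 1)) →ₗ[(Alg T)ᵐᵒᵖ] Im (T := T) (vt T i w) where
  toFun f := ⟨(show Alg T →ₗ[k] k from f.1).comp (LinearMap.mulRight k (ar T i w)), fun a => by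
    change f.1 (a * e T (vt T i w) * ar T i w) = f.1 (a * ar T i w)
    rw [mul_assoc, e_mul_ar]⟩
  map_add' f g := rfl
  map_smul' b f := by
    refine Subtype.ext (DA.ext fun a => ?_)
    change f.1 (b.unop * (a * ar T i w)) = f.1 (b.unop * a * ar T i w)
    rw [mul_assoc]

lemma Im.arrow_apply (i : Fin T.t) (w : ℕ) (f : Im (T := T) (vt T i (w + 1))) (a : Alg T) :
    ((Im.arrow i w f : Im (T := T) (vt T i w)) : DA T) a = (f : DA T) (a * ar T i w) := rfl

lemma Im.arrow_surjective {i : Fin T.t} {w : ℕ} (hw : w < T.ℓ i) (h : pp T i 0 (w + 1) ≠ 0) :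
    Function.Surjective (Im.arrow (T := T) i w) := by
  intro ψ
  let S : Submodule k (Alg T) := LinearMap.range (LinearMap.mulRight k (e T (vt T i w)))
  let R : S →ₗ[k] Alg T := (LinearMap.mulRight k (ar T i w)).comp S.subtype
  have hR : LinearMap.ker R = ⊥ := by
    rw [LinearMap.ker_eq_bot']
    rintro ⟨_, b, rfl⟩ h0
    refine Subtype.ext ?_
    change b * e T (vt T i w) = 0
    change b * e T (vt T i w) * ar T i w = 0 at h0
    refine mul_e_eq_zero hw fun a ha => ?_
    obtain ⟨r, hr⟩ := e_mul_mul_e_smul ha hw b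
    have h1 : r • pp T i a (w + 1) = 0 := by
      rw [pp_succ T ha, ← smul_mul_assoc, ← hr, mul_assoc, h0, mul_zero]
    rw [hr, (smul_eq_zero.1 h1).resolve_right
      (pp_ne_zero_of_subpath h (Nat.zero_le _) (by omega) le_rfl), zero_smul]
  obtain ⟨L, hL⟩ := LinearMap.exists_leftInverse_of_injective R hR
  let φ : DA T := (show Alg T →ₗ[k] k from ψ.1).comp (S.subtype.comp L)
  refine ⟨Im.proj _ φ, Subtype.ext (DA.ext fun a => ?_)⟩
  rw [Im.arrow_apply, Im.proj_apply, mul_assoc, ar_mul_e, ← e_mul_ar, ← mul_assoc]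
  have h1 : L (R ⟨a * e T (vt T i w), a, rfl⟩) = ⟨a * e T (vt T i w), a, rfl⟩ :=
    LinearMap.congr_fun hL _
  change ψ.1 (L (R ⟨a * e T (vt T i w), a, rfl⟩)).1 = _
  rw [h1]
  exact ψ.2 a

lemma idLeOne_simple {v : Vtx T.t T.ℓ} (hv : IdVtx v) {y : K} (hy : y ≠ 0)
    (hyv : y <• e T v = y) (har : ∀ i j, y <• ar T i j = 0) (hgen : ∀ z, ∃ a : Alg T, y <• a = z) :
    IdLeOne (Alg T)ᵐᵒᵖ (ModuleCat.of _ K) := by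
  obtain ⟨f, hf⟩ := Im.exists_hom (show y <• e T v ≠ 0 by rwa [hyv])
  have hfy : f y ≠ 0 := by
    intro h0
    refine hf (LinearMap.ext fun z => ?_)
    obtain ⟨a, rfl⟩ := hgen z
    rw [map_act, h0, smul_zero]; rfl
  have hinj : Function.Injective f := by
    rw [injective_iff_map_eq_zero]
    intro z hz
    obtain ⟨a, rfl⟩ := hgen z
    obtain ⟨r, hr⟩ := act_eq_alg hyv har a
    rw [hr, map_act] at hz
    have hr0 : r = 0 := by
      by_contra hr0
      exact hfy (act_alg_cancel hr0 hz)
    rw [hr, hr0, map_zero, act_zero]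
  refine ⟨ModuleCat.of _ (Im (T := T) v), f, hinj, Im.injective v, ?_⟩
  change Module.Injective (Alg T)ᵐᵒᵖ (Im (T := T) v ⧸ LinearMap.range f)
  set ε : Im (T := T) v := f y with hε
  have hεv : ∀ b, ε.1 b = ε.1 (e T v * b * e T v) := by
    intro b
    rw [ε.2]
    change ε.1 b = (ε <• e T v).1 b
    rw [hε, ← map_act, hyv]
  have hεe : ε.1 (e T v) ≠ 0 := by
    intro h0
    refine hfy (Subtype.ext (DA.ext fun b => ?_))
    obtain ⟨r, hr⟩ := e_mul_e_self T v b
    change ε.1 b = 0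
    rw [hεv, hr, DA.apply_smul, h0, mul_zero]
  have hmem : ∀ φ : Im (T := T) v,
      (∀ b, ∃ r : k, φ.1 b = r * φ.1 (e T v) ∧ ε.1 b = r * ε.1 (e T v)) →
      φ ∈ LinearMap.range f := by
    intro φ h
    refine ⟨y <• algebraMap k (Alg T) (φ.1 (e T v) / ε.1 (e T v)), ?_⟩
    rw [map_act]
    refine Subtype.ext (DA.ext fun b => ?_)
    obtain ⟨r, h1, h2⟩ := h b
    change ε.1 (algebraMap k (Alg T) _ * b) = φ.1 b
    rw [← Algebra.smul_def, DA.apply_smul, h1, h2]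
    field_simp
  rcases hv with rfl | ⟨i, w, hw, hwl, rfl, hp⟩
  · have : LinearMap.range f = ⊤ := by
      rw [eq_top_iff]
      intro φ _
      refine hmem φ fun b => ?_
      obtain ⟨r, hr⟩ := mul_e_src T b
      exact ⟨r, by rw [← φ.2, hr, DA.apply_smul], by rw [← ε.2, hr, DA.apply_smul]⟩
    rw [this]
    exact ⟨fun _ _ _ _ _ _ _ _ _ => ⟨0, fun _ => Subsingleton.elim _ _⟩⟩
  · obtain ⟨w, rfl⟩ : ∃ w', w = w' + 1 := ⟨w - 1, by omega⟩
    have hε0 : ∀ b, ε.1 (b * ar T i w) = 0 := by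
      intro b
      rw [hεv, mul_assoc, mul_assoc, ar_mul_e, ← e_mul_ar, ← mul_assoc, ← mul_assoc]
      rcases e_mul_e_branch T hw hwl.le (show w ≤ T.ℓ i by omega) b with ⟨h1, -⟩ | ⟨-, h1⟩
      · omega
      · rw [h1, zero_mul, DA.apply_zero]
    have : LinearMap.range f = LinearMap.ker (Im.arrow i w) := by
      refine le_antisymm ?_ fun φ hφ => hmem φ fun b => ?_
      · rintro _ ⟨z, rfl⟩
        obtain ⟨a, rfl⟩ := hgen z
        rw [map_act]
        refine Submodule.smul_mem _ _ ?_
        rw [LinearMap.mem_ker]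
        exact Subtype.ext (DA.ext hε0)
      · obtain ⟨r, c, hr⟩ := mul_e_decomp hwl b
        have hφ0 : ∀ c, φ.1 (c * ar T i w) = 0 := fun c =>
          congrArg (fun g : Im (T := T) (vt T i w) => g.1 c) (LinearMap.mem_ker.1 hφ)
        exact ⟨r, by rw [← φ.2, hr, DA.apply_add, DA.apply_smul, hφ0, add_zero],
          by rw [← ε.2, hr, DA.apply_add, DA.apply_smul, hε0, add_zero]⟩
    rw [this]
    exact injective_of_equiv
      (LinearMap.quotKerEquivOfSurjective _ (Im.arrow_surjective (by omega) hp)).symm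
      (Im.injective _)

lemma idLeOne_of_support {M : Type u} [AddCommGroup M] [Module (Alg T)ᵐᵒᵖ M]
    [Module.Finite (Alg T)ᵐᵒᵖ M] (hV : ∀ v, ∀ x : M, x <• e T v ≠ 0 → IdVtx v) :
    IdLeOne (Alg T)ᵐᵒᵖ (ModuleCat.of _ M) :=
  induction_simple (V := IdVtx)
    (fun _ _ _ _ => idLeOne_of_injective
      ⟨fun _ _ _ _ _ _ _ _ _ => ⟨0, fun _ => Subsingleton.elim _ _⟩⟩)
    (fun _ _ _ _ _ _ _ hg h' h'' => idLeOne_of_ses hg h' h'')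
    (fun _ hv _ _ _ _ hy hyv har hgen => idLeOne_simple hv hy hyv har hgen) hV

end Simples

section Splitting

variable {k : Type u} [Field k] {T : ToupieAlg k}
variable {M : Type u} [AddCommGroup M] [Module (Alg T)ᵐᵒᵖ M]

lemma act_sub_alg_mem {K : Submodule (Alg T)ᵐᵒᵖ M} {y : M} {v : Vtx T.t T.ℓ}
    (hv : y <• e T v = y) (har : ∀ i j, y <• ar T i j ∈ K) (a : Alg T) :
    ∃ r : k, y <• a - y <• algebraMap k (Alg T) r ∈ K := by
  obtain ⟨r, hr⟩ := act_eq_alg (y := K.mkQ y) (v := v) (congrArg K.mkQ hv)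
    (fun i j => (Submodule.Quotient.mk_eq_zero K).2 (har i j)) a
  exact ⟨r, (Submodule.Quotient.eq K).1 hr⟩

/-- A homogeneous element acted on by scalars modulo `K` lies in any submodule above `K` meeting
`K ⊔ yA` outside of `K`. -/
lemma mem_of_mem_sup_span {K L : Submodule (Alg T)ᵐᵒᵖ M} (hKL : K ≤ L) {y z : M}
    {v : Vtx T.t T.ℓ} (hv : y <• e T v = y) (har : ∀ i j, y <• ar T i j ∈ K)
    (hz : z ∈ K ⊔ Submodule.span (Alg T)ᵐᵒᵖ {y}) (hzK : z ∉ K) (hzL : z ∈ L) : y ∈ L := by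
  obtain ⟨n, hn, s, hs, rfl⟩ := Submodule.mem_sup.1 hz
  obtain ⟨a, rfl⟩ := Submodule.mem_span_singleton.1 hs
  obtain ⟨r, hr⟩ := act_sub_alg_mem hv har a.unop
  have ha : y <• a.unop = a • y := rfl
  rw [ha] at hr
  have hr0 : r ≠ 0 := by
    rintro rfl
    rw [map_zero, act_zero, sub_zero] at hr
    exact hzK (K.add_mem hn hr)
  have h1 : a • y ∈ L := by simpa using L.sub_mem hzL (hKL hn)
  have h2 : y <• algebraMap k (Alg T) r ∈ L := by simpa using L.sub_mem h1 (hKL hr)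
  have h3 := L.smul_mem (op (algebraMap k (Alg T) r⁻¹)) h2
  rwa [act_act, ← map_mul, mul_inv_cancel₀ hr0, map_one, act_one] at h3

variable [Module.Finite (Alg T)ᵐᵒᵖ M]

/-- A splitting criterion for submodules closed under lifting along arrows. -/
lemma exists_isCompl_of_lift {N : Submodule (Alg T)ᵐᵒᵖ M}
    (h : ∀ v, (∀ x : M, x <• e T v = x → x ∈ N) ∨ v = .snk ∨ ∃ i j, v = vt T i j ∧
      (∀ n ∈ N, ∃ n' ∈ N, n <• e T (vt T i (j + 1)) = n' <• ar T i j) ∧ 0 < j ∧ j < T.ℓ i) :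
    ∃ N', IsCompl N N' := by
  obtain ⟨N', hd, hmax⟩ := set_has_maximal_iff_noetherian.2
    (inferInstanceAs (IsNoetherian (Alg T)ᵐᵒᵖ M)) {N' | Disjoint N N'} ⟨⊥, disjoint_bot_right⟩
  refine ⟨N', hd, codisjoint_iff_le_sup.2 ?_⟩
  by_contra hne
  obtain ⟨v, x, -, hxv, hxK, har⟩ := exists_homogeneous_max hne
  have key : ∀ y : M, y <• e T v = y → y ∉ N ⊔ N' → (∀ i j, y <• ar T i j ∈ N') → False := by
    intro y hyv hyK hyar
    have hyN : y ∉ N' := fun h => hyK (Submodule.mem_sup_right h)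
    refine hmax (N' ⊔ Submodule.span _ {y}) (Submodule.disjoint_def.2 fun z hz hz' => ?_)
      (lt_of_le_of_ne le_sup_left fun heq => hyN ?_)
    · by_contra hz0
      exact hyK (mem_of_mem_sup_span le_sup_right hyv hyar hz'
        (fun h => hz0 (Submodule.disjoint_def.1 hd z hz h)) (Submodule.mem_sup_left hz))
    · rw [heq]
      exact Submodule.mem_sup_right (Submodule.mem_span_singleton_self y)
  rcases h v with h | rfl | ⟨i, j, rfl, hl, hj, hjl⟩
  · exact hxK (Submodule.mem_sup_left (h x hxv))
  · refine key x hxv hxK fun i j => ?_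
    by_cases hj : j < T.ℓ i
    · rw [act_ar_of_ne hxv (vt_ne_snk T hj).symm]; exact N'.zero_mem
    · rw [ar_eq_zero T (not_lt.1 hj), act_zero]; exact N'.zero_mem
  · obtain ⟨n, hn, n', hn', hnn⟩ := Submodule.mem_sup.1 (har i j)
    obtain ⟨m, hm, hmn⟩ := hl n hn
    have hme : m <• e T (vt T i j) ∈ N := N.smul_mem _ hm
    refine key (x - m <• e T (vt T i j)) (by rw [smul_sub, hxv, act_e_e])
      (fun h => hxK (by simpa using Submodule.add_mem _ h (Submodule.mem_sup_left hme)))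
      fun i' j' => ?_
    by_cases hij : vt T i j = vt T i' j' ∧ j' < T.ℓ i'
    · obtain ⟨rfl, rfl⟩ : i = i' ∧ j = j' :=
        (vtx_interior_inj hj hjl hij.1.symm).imp Eq.symm Eq.symm
      have h1 := congrArg (fun z => z <• e T (vt T i (j + 1))) hnn
      rw [smul_add, act_ar_e, hmn] at h1
      rw [smul_sub, act_act, e_mul_ar, ← h1, add_sub_cancel_left]
      exact N'.smul_mem _ hn'
    · have h2 : (x - m <• e T (vt T i j)) <• ar T i' j' = 0 := by
        by_cases hj' : j' < T.ℓ i'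
        · rw [smul_sub, act_ar_of_ne hxv fun h => hij ⟨h, hj'⟩, act_act,
            e_mul_ar_of_ne T fun h => hij ⟨h, hj'⟩, act_zero, sub_zero]
        · rw [ar_eq_zero T (not_lt.1 hj'), act_zero]
      rw [h2]; exact N'.zero_mem

/-- The largest submodule vanishing at the sink. -/
def sinkFree (M : Type u) [AddCommGroup M] [Module (Alg T)ᵐᵒᵖ M] : Submodule (Alg T)ᵐᵒᵖ M where
  carrier := {x | ∀ r : Alg T, x <• r <• e T .snk = 0}
  add_mem' {x y} hx hy r := by rw [smul_add, smul_add, hx, hy, add_zero]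
  zero_mem' r := by simp
  smul_mem' a x hx r := by
    change x <• a.unop <• r <• e T .snk = 0
    rw [act_act x]; exact hx _

lemma exists_isCompl_sinkFree (h0 : ∀ x : M, x <• e T .src = 0) :
    ∃ N', IsCompl N' (sinkFree (T := T) M) := by
  obtain ⟨N, hN, hmin⟩ := IsArtinian.set_has_minimal
    {N : Submodule (Alg T)ᵐᵒᵖ M | N ⊔ sinkFree M = ⊤} ⟨⊤, top_sup_eq _⟩
  refine ⟨N, ?_, codisjoint_iff.2 hN⟩
  rw [disjoint_iff]
  by_contra hne
  obtain ⟨i, j, x, hj, hx, hxU, hx0, hxv, hxα⟩ : ∃ (i : Fin T.t) (j : ℕ) (x : M), j + 1 < T.ℓ i ∧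
      x ∈ N ∧ x ∈ sinkFree (T := T) M ∧ x ≠ 0 ∧ x <• e T (vt T i (j + 1)) = x ∧
      ∀ y ∈ N, y <• ar T i j ≠ x := by
    have hex : ∃ v : Vtx T.t T.ℓ, ∃ x ∈ N, x ∈ sinkFree (T := T) M ∧ x ≠ 0 ∧ x <• e T v = x := by
      by_contra! hc
      refine hne ((Submodule.eq_bot_iff _).2 fun x hx => ?_)
      rw [← sum_act_e (T := T) x]
      refine Finset.sum_eq_zero fun v _ => ?_
      by_contra hxv
      exact hc v _ (N.smul_mem _ hx.1) (Submodule.smul_mem _ _ hx.2) hxv (act_e_e x v)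
    obtain ⟨v, hv, hvmin⟩ := Finset.exists_min_image
      (Finset.univ.filter fun v : Vtx T.t T.ℓ => ∃ x ∈ N, x ∈ sinkFree (T := T) M ∧ x ≠ 0 ∧
        x <• e T v = x) rk (by obtain ⟨v, hv⟩ := hex; exact ⟨v, by simpa using hv⟩)
    obtain ⟨x, hx, hxU, hx0, hxv⟩ := (Finset.mem_filter.1 hv).2
    rcases vt_exhaust T v with rfl | rfl | ⟨i, j, hj, hjl, rfl⟩
    · exact absurd ((h0 x).symm.trans hxv).symm hx0
    · have := hxU 1
      rw [act_one, hxv] at this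
      exact absurd this hx0
    obtain ⟨j, rfl⟩ : ∃ j', j = j' + 1 := ⟨j - 1, by omega⟩
    refine ⟨i, j, x, hjl, hx, hxU, hx0, hxv, fun y hy hyx => ?_⟩
    have hjl' : j < T.ℓ i := by omega
    have hyα : y <• e T (vt T i j) <• ar T i j = x := by rw [act_act, e_mul_ar, hyx]
    have hy0 : y <• e T (vt T i j) ≠ 0 := fun h => hx0 (by rw [← hyα, h, smul_zero])
    have hj0 : 0 < j := by
      rcases Nat.eq_zero_or_pos j with rfl | h
      · rw [vt_zero, h0] at hy0; exact absurd rfl hy0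
      · exact h
    have := hvmin (vt T i j) (Finset.mem_filter.2 ⟨Finset.mem_univ _, _, N.smul_mem _ hy,
      fun r => ?_, hy0, act_e_e y _⟩)
    · exact absurd (rk_vtx_lt (Nat.lt_succ_self j) hjl.le) (not_lt.2 this)
    · rw [act_act, act_act, ← mul_assoc]
      rcases e_mul_e_branch T hj0 hjl'.le (le_refl (T.ℓ i)) r with ⟨-, c, hc⟩ | ⟨h, -⟩
      · have h2 := hxU (pp T i (j + 1) (T.ℓ i))
        rw [vt_len] at hc
        rw [hc, act_smul, pp_cons T hjl', ← act_act, hyx]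
        rw [act_act, ← vt_len T i, pp_mul_e T hjl.le] at h2
        rw [h2, smul_zero]
      · omega
  set v := vt T i (j + 1) with hv
  let L : Submodule (Alg T)ᵐᵒᵖ M := subOf
    { carrier := {n | n ∈ N ∧ ∃ y ∈ N, n <• e T v = y <• ar T i j}
      add_mem' := by
        rintro a b ⟨ha, y, hy, hay⟩ ⟨hb, z, hz, hbz⟩
        exact ⟨N.add_mem ha hb, y + z, N.add_mem hy hz, by rw [smul_add, smul_add, hay, hbz]⟩
      zero_mem' := ⟨N.zero_mem, 0, N.zero_mem, by simp⟩
      neg_mem' := by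
        rintro a ⟨ha, y, hy, hay⟩
        exact ⟨N.neg_mem ha, -y, N.neg_mem hy, by rw [smul_neg, smul_neg, hay]⟩ }
    (by
      rintro c n ⟨hn, y, hy, hny⟩
      exact ⟨N.smul_mem _ hn, _, N.smul_mem (op (algebraMap k (Alg T) c)) hy, by
        rw [← act_comm, hny, act_comm]⟩)
    (by
      rintro w n ⟨hn, y, hy, hny⟩
      refine ⟨N.smul_mem _ hn, ?_⟩
      by_cases hw : w = v
      · exact ⟨y, hy, by rw [hw, act_e_e, hny]⟩
      · exact ⟨0, N.zero_mem, by rw [act_act, e_mul_of_ne T hw, act_zero, smul_zero]⟩)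
    (by
      rintro i' j' n ⟨hn, y, hy, hny⟩
      refine ⟨N.smul_mem _ hn, ?_⟩
      by_cases hw : vt T i' (j' + 1) = v
      · obtain ⟨rfl, h2⟩ := vtx_interior_inj (Nat.succ_pos j) hj hw
        obtain rfl : j' = j := by omega
        exact ⟨n, hn, by rw [hv, act_ar_e]⟩
      · exact ⟨0, N.zero_mem, by rw [act_act, ar_mul_e_of_ne T (Ne.symm hw), act_zero, smul_zero]⟩)
  have hxL : x ∉ L := by
    rintro ⟨-, y, hy, hxy⟩
    exact hxα y hy (hxy.symm.trans hxv)
  have hLN : L ≤ N := fun n hn => hn.1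
  obtain ⟨H, ⟨hLH, hHN, hxH⟩, hmax⟩ := set_has_maximal_iff_noetherian.2
    (inferInstanceAs (IsNoetherian (Alg T)ᵐᵒᵖ M)) {H | L ≤ H ∧ H ≤ N ∧ x ∉ H} ⟨L, le_rfl, hLN, hxL⟩
  have hle : N ≤ H ⊔ Submodule.span _ {x} := by
    by_contra hne
    obtain ⟨w, y, hy, hyw, hyK, -⟩ := exists_homogeneous_max hne
    have hyH : y ∉ H := fun h => hyK (Submodule.mem_sup_left h)
    obtain rfl : w = v := by
      by_contra hwv
      exact hyH (hLH ⟨hy, 0, N.zero_mem, by rw [act_e_of_ne hyw hwv, smul_zero]⟩)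
    have har : ∀ z ∈ N, z <• e T v = z → ∀ i' j', z <• ar T i' j' ∈ H := fun z hz hzv i' j' => by
      refine hLH ⟨N.smul_mem _ hz, 0, N.zero_mem, ?_⟩
      by_cases hw : v = vt T i' j'
      · by_cases hjl : j' < T.ℓ i'
        · obtain ⟨rfl, rfl⟩ := vtx_interior_inj (Nat.succ_pos j) hj hw.symm
          rw [smul_zero, act_act, ar_mul_e_of_ne T, act_zero]
          intro h
          have := (vtx_interior_inj (Nat.succ_pos j) hj h.symm).2
          omega
        · rw [ar_eq_zero T (not_lt.1 hjl), act_zero, smul_zero, smul_zero]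
      · rw [act_ar_of_ne hzv hw, smul_zero, smul_zero]
    have hlt : H < H ⊔ Submodule.span _ {y} := lt_of_le_of_ne le_sup_left fun h => hyH (by
      rw [h]; exact Submodule.mem_sup_right (Submodule.mem_span_singleton_self y))
    have hxy : x ∈ H ⊔ Submodule.span _ {y} := by
      by_contra hxy
      exact hmax _ ⟨hLH.trans le_sup_left, sup_le hHN ((Submodule.span_singleton_le_iff_mem _ _).2 hy),
        hxy⟩ hlt
    exact hyK (mem_of_mem_sup_span le_sup_left hyw (har y hy hyw) hxy hxH
      (Submodule.mem_sup_right (Submodule.mem_span_singleton_self x)))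
  refine hmin H ?_ (lt_of_le_of_ne hHN fun h => hxH (h ▸ hx))
  rw [Set.mem_ofPred_eq, eq_top_iff, ← hN]
  refine sup_le (hle.trans (sup_le le_sup_left ?_)) le_sup_right
  exact (Submodule.span_singleton_le_iff_mem _ _).2 (Submodule.mem_sup_right hxU)

end Splitting

section Supports

variable {k : Type u} [Field k] {T : ToupieAlg k}
variable {M N : Type u} [AddCommGroup M] [Module (Alg T)ᵐᵒᵖ M] [AddCommGroup N]
  [Module (Alg T)ᵐᵒᵖ N]

lemma not_idVtx_snk : ¬ IdVtx (T := T) .snk := by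
  rintro (h | ⟨i, w, -, h, h', -⟩)
  · cases h
  · exact vt_ne_snk T h h'.symm

lemma idVtx_of_src_mul (hm : mDim T = 0) {v : Vtx T.t T.ℓ} {a : Alg T}
    (h : e T .src * a * e T v ≠ 0) : IdVtx v := by
  rcases vt_exhaust T v with rfl | rfl | ⟨i, w, hw, hwl, rfl⟩
  · exact Or.inl rfl
  · exact absurd ((mDim_eq_zero_iff T).1 hm a) h
  · refine Or.inr ⟨i, w, hw, hwl, rfl, fun h0 => h ?_⟩
    obtain ⟨r, hr⟩ := e_mul_mul_e_smul (Nat.zero_le w) hwl a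
    rw [mul_assoc, ← vt_zero T i, hr, h0, smul_zero]

lemma span_src (hm : mDim T = 0) (hM : IsIndec (Alg T)ᵐᵒᵖ M) [Module.Finite (Alg T)ᵐᵒᵖ M]
    {x : M} (hx : x <• e T .src ≠ 0) :
    Submodule.span (Alg T)ᵐᵒᵖ (Set.range fun x : M => x <• e T .src) = ⊤ := by
  rw [mDim_eq_zero_iff] at hm
  set S := Submodule.span (Alg T)ᵐᵒᵖ (Set.range fun x : M => x <• e T .src) with hS
  have hmem : ∀ y : M, y <• e T .src ∈ S := fun y => Submodule.subset_span ⟨y, rfl⟩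
  have hlift : ∀ i j, j < T.ℓ i → ∀ n ∈ S, ∀ a : Alg T, ∃ n' ∈ S,
      n <• a <• e T (vt T i (j + 1)) = n' <• ar T i j := by
    intro i j hjl n hn
    induction hn using Submodule.span_induction with
    | zero => exact fun a => ⟨0, S.zero_mem, by simp⟩
    | add y z _ _ hy hz =>
      intro a
      obtain ⟨y', hy', h1⟩ := hy a
      obtain ⟨z', hz', h2⟩ := hz a
      exact ⟨y' + z', S.add_mem hy' hz', by simp only [smul_add, h1, h2]⟩
    | smul b n hn ih =>
      intro a
      obtain ⟨n', hn', h⟩ := ih (b.unop * a)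
      exact ⟨n', hn', by rw [← h, ← act_act n]; rfl⟩
    | mem n hn =>
      intro a
      obtain ⟨y, rfl⟩ := hn
      obtain ⟨r, hr⟩ : ∃ r : k, e T .src * a * e T (vt T i (j + 1)) = r • pp T i 0 (j + 1) := by
        rcases (Nat.succ_le_of_lt hjl).lt_or_eq with h | h
        · obtain ⟨r, hr⟩ := e_mul_mul_e_smul (Nat.zero_le (j + 1)) h a
          exact ⟨r, by rw [mul_assoc, ← vt_zero T i, hr]⟩
        · exact ⟨0, by rw [← Nat.succ_eq_add_one, h, vt_len, hm, zero_smul]⟩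
      refine ⟨y <• e T .src <• (r • pp T i 0 j), S.smul_mem _ (hmem y), ?_⟩
      rw [act_act, act_act, ← mul_assoc, hr, act_act, act_act, smul_mul_assoc,
        ← pp_succ T (Nat.zero_le j), mul_smul_comm, ← vt_zero T i, e_mul_pp]
  obtain ⟨S', hS'⟩ : ∃ S', IsCompl S S' := by
    refine exists_isCompl_of_lift fun v => ?_
    rcases vt_exhaust T v with rfl | rfl | ⟨i, w, hw, hwl, rfl⟩
    · exact Or.inl fun x hx => hx ▸ hmem x
    · exact Or.inr (Or.inl rfl)
    · refine Or.inr (Or.inr ⟨i, w, rfl, fun n hn => ?_, hw, hwl⟩)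
      simpa using hlift i w hwl n hn 1
  refine (hM.eq_bot_or_top hS').resolve_left fun h => hx ?_
  have := hmem x
  rwa [h, Submodule.mem_bot] at this

lemma idVtx_of_src (hm : mDim T = 0) (hM : IsIndec (Alg T)ᵐᵒᵖ M) [Module.Finite (Alg T)ᵐᵒᵖ M]
    {x : M} (hx : x <• e T .src ≠ 0) {v : Vtx T.t T.ℓ} {y : M} (hy : y <• e T v ≠ 0) :
    IdVtx v := by
  by_contra hv
  have key : ∀ z ∈ Submodule.span (Alg T)ᵐᵒᵖ (Set.range fun x : M => x <• e T .src),
      ∀ a : Alg T, z <• a <• e T v = 0 := by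
    intro z hz
    induction hz using Submodule.span_induction with
    | zero => simp
    | add y z _ _ hy hz => intro a; rw [smul_add, smul_add, hy, hz, add_zero]
    | smul b n _ ih => intro a; exact (congrArg (fun z => z <• e T v) (act_act n _ a)).trans (ih _)
    | mem n hn =>
      obtain ⟨y, rfl⟩ := hn
      intro a
      rw [act_act, act_act, ← mul_assoc]
      by_contra h
      exact hv (idVtx_of_src_mul hm fun h' => h (by rw [h', act_zero]))
  have := key y (by rw [span_src hm hM hx]; trivial) 1
  rw [act_one] at this
  exact hy this

lemma src_of_map (hm : mDim T = 0) (hM : IsIndec (Alg T)ᵐᵒᵖ M) [Module.Finite (Alg T)ᵐᵒᵖ M]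
    {x : M} (hx : x <• e T .src ≠ 0) {f : M →ₗ[(Alg T)ᵐᵒᵖ] N} (hf : f ≠ 0) :
    ∃ y : N, y <• e T .src ≠ 0 := by
  by_contra! h
  refine hf (LinearMap.ext_on (span_src hm hM hx) ?_)
  rintro _ ⟨y, rfl⟩
  rw [map_act, h, LinearMap.zero_apply]

lemma sinkFree_eq_bot (hm : mDim T = 0) (hM : IsIndec (Alg T)ᵐᵒᵖ M) [Module.Finite (Alg T)ᵐᵒᵖ M]
    {x : M} (hx : x <• e T .snk ≠ 0) :
    (∀ y : M, y <• e T .src = 0) ∧ sinkFree (T := T) M = ⊥ := by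
  have h0 : ∀ y : M, y <• e T .src = 0 := by
    intro y
    by_contra hy
    exact not_idVtx_snk (idVtx_of_src hm hM hy hx)
  refine ⟨h0, ?_⟩
  obtain ⟨N, hN⟩ := exists_isCompl_sinkFree h0
  refine (hM.eq_bot_or_top hN.symm).resolve_right fun h => hx ?_
  have : x ∈ sinkFree (T := T) M := by rw [h]; trivial
  simpa using this 1

lemma exists_act_snk (hm : mDim T = 0) (hM : IsIndec (Alg T)ᵐᵒᵖ M) [Module.Finite (Alg T)ᵐᵒᵖ M]
    {x : M} (hx : x <• e T .snk ≠ 0) {y : M} (hy : y ≠ 0) :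
    ∃ a : Alg T, y <• a <• e T .snk ≠ 0 := by
  by_contra! h
  have : y ∈ sinkFree (T := T) M := h
  rw [(sinkFree_eq_bot hm hM hx).2, Submodule.mem_bot] at this
  exact hy this

lemma pdVtx_of_snk (hm : mDim T = 0) (hM : IsIndec (Alg T)ᵐᵒᵖ M) [Module.Finite (Alg T)ᵐᵒᵖ M]
    {x : M} (hx : x <• e T .snk ≠ 0) {v : Vtx T.t T.ℓ} {y : M} (hy : y <• e T v ≠ 0) :
    PdVtx v := by
  obtain ⟨a, ha⟩ := exists_act_snk hm hM hx hy
  rcases vt_exhaust T v with rfl | rfl | ⟨i, w, hw, hwl, rfl⟩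
  · exact absurd ((sinkFree_eq_bot hm hM hx).1 y) hy
  · exact Or.inl rfl
  · refine Or.inr ⟨i, w, hw, hwl, rfl, fun h0 => ha ?_⟩
    rw [act_act, act_act, ← mul_assoc]
    rcases e_mul_e_branch T hw hwl.le (le_refl (T.ℓ i)) a with ⟨-, r, hr⟩ | ⟨h, -⟩
    · rw [vt_len] at hr
      rw [hr, h0, smul_zero, act_zero]
    · omega

lemma snk_of_map (hm : mDim T = 0) (hN : IsIndec (Alg T)ᵐᵒᵖ N) [Module.Finite (Alg T)ᵐᵒᵖ N]
    {x : N} (hx : x <• e T .snk ≠ 0) {f : M →ₗ[(Alg T)ᵐᵒᵖ] N} (hf : f ≠ 0) :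
    ∃ y : M, y <• e T .snk ≠ 0 := by
  obtain ⟨y, hy⟩ : ∃ y, f y ≠ 0 := by
    by_contra! h
    exact hf (LinearMap.ext h)
  obtain ⟨a, ha⟩ := exists_act_snk hm hN hx hy
  refine ⟨y <• a, fun h => ha ?_⟩
  rw [← map_act, ← map_act, h, map_zero]

lemma inRightPart_of_src (hm : mDim T = 0) {M : ModuleCat.{u} (Alg T)ᵐᵒᵖ} (hM : Indec _ M)
    (hM' : FdMod _ M) {x : M} (hx : x <• e T .src ≠ 0) : InRightPart (Alg T)ᵐᵒᵖ M := by
  refine ⟨hM, hM', fun X hX hX' h => ?_⟩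
  obtain ⟨y, hy⟩ : ∃ y : X, y <• e T .src ≠ 0 := by
    clear hX hX'
    induction h with
    | refl => exact ⟨x, hx⟩
    | tail _ h ih =>
      obtain ⟨h1, h2, -, -, f, hf, -⟩ := h
      obtain ⟨y, hy⟩ := ih
      have : Module.Finite (Alg T)ᵐᵒᵖ _ := h2
      exact src_of_map hm h1 hy hf
  have : Module.Finite (Alg T)ᵐᵒᵖ X := hX'
  exact idLeOne_of_support fun v z hz => idVtx_of_src hm hX hy hz

lemma pdLeOne_of_snk (hm : mDim T = 0) {X : ModuleCat.{u} (Alg T)ᵐᵒᵖ} (hX : Indec _ X)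
    (hX' : FdMod _ X) {x : X} (hx : x <• e T .snk ≠ 0) : PdLeOne (Alg T)ᵐᵒᵖ X := by
  have : Module.Finite (Alg T)ᵐᵒᵖ X := hX'
  exact pdLeOne_of_support fun v z hz => pdVtx_of_snk hm hX hx hz

lemma inLeftPart_of_snk (hm : mDim T = 0) {M : ModuleCat.{u} (Alg T)ᵐᵒᵖ} (hM : Indec _ M)
    (hM' : FdMod _ M) {x : M} (hx : x <• e T .snk ≠ 0) : InLeftPart (Alg T)ᵐᵒᵖ M := by
  refine ⟨hM, hM', fun X hX hX' h => ?_⟩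
  obtain ⟨y, hy⟩ : ∃ y : X, y <• e T .snk ≠ 0 := by
    clear hX hX'
    induction h using Relation.ReflTransGen.head_induction_on with
    | refl => exact ⟨x, hx⟩
    | head h _ ih =>
      obtain ⟨-, -, h3, h4, f, hf, -⟩ := h
      obtain ⟨y, hy⟩ := ih
      have : Module.Finite (Alg T)ᵐᵒᵖ _ := h4
      exact snk_of_map hm h3 hy hf
  exact pdLeOne_of_snk hm hX hX' hy

/-- The element `x` generates an interval module supported at the interior vertices `u, …, d` of
branch `i`. -/
structure IsInterval (x : M) (i : Fin T.t) (u d : ℕ) : Prop where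
  pos : 0 < u
  le : u ≤ d
  lt : d < T.ℓ i
  hom : x <• e T (vt T i u) = x
  gen : ∀ y : M, ∃ a : Alg T, x <• a = y
  ne : x <• pp T i u d ≠ 0
  eq : x <• pp T i u (d + 1) = 0

variable {x : M} {i : Fin T.t} {u d : ℕ}

lemma IsInterval.ne_zero_iff (h : IsInterval x i u d) {c : ℕ} (hc : u ≤ c) :
    x <• pp T i u c ≠ 0 ↔ c ≤ d := by
  refine ⟨fun h1 => ?_, fun h1 h2 => h.ne ?_⟩
  · by_contra hcd
    rw [← pp_mul_pp T (h.le.trans (Nat.le_succ d)) (by omega : d + 1 ≤ c), ← act_act, h.eq,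
      smul_zero] at h1
    exact h1 rfl
  · rw [← pp_mul_pp T hc h1, ← act_act, h2, smul_zero]

lemma IsInterval.support (h : IsInterval x i u d) {v : Vtx T.t T.ℓ} {a : Alg T}
    (h0 : x <• a <• e T v ≠ 0) : ∃ (c : ℕ) (r : k), u ≤ c ∧ c ≤ d ∧ v = vt T i c ∧ r ≠ 0 ∧
      e T (vt T i u) * a * e T v = r • pp T i u c := by
  have h1 : x <• a <• e T v = x <• (e T (vt T i u) * a * e T v) := by
    rw [← act_act, ← act_act, h.hom]
  have hpos := h.pos
  have hul : u < T.ℓ i := h.le.trans_lt h.lt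
  obtain ⟨c, hc, rfl⟩ : ∃ c ≤ T.ℓ i, v = vt T i c := by
    rcases vt_exhaust T v with rfl | rfl | ⟨j, w, hw, hwl, rfl⟩
    · exact ⟨0, Nat.zero_le _, (vt_zero T i).symm⟩
    · exact ⟨_, le_rfl, (vt_len T i).symm⟩
    · by_cases hij : i = j
      · subst hij; exact ⟨w, hwl.le, rfl⟩
      · rw [h1, e_mul_e_eq_zero_of_ne T hij hpos hul hw hwl, act_zero] at h0
        exact absurd rfl h0
  rcases e_mul_e_branch T hpos hul.le hc a with ⟨huc, r, hr⟩ | ⟨-, hr⟩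
  · rw [h1, hr, act_smul] at h0
    refine ⟨c, r, huc, (h.ne_zero_iff huc).1 fun h2 => h0 (by rw [h2, smul_zero]), rfl, ?_, hr⟩
    rintro rfl
    rw [map_zero, act_zero] at h0
    exact h0 rfl
  · rw [h1, hr, act_zero] at h0
    exact absurd rfl h0

lemma IsInterval.act_src (h : IsInterval x i u d) (y : M) : y <• e T .src = 0 := by
  obtain ⟨a, rfl⟩ := h.gen y
  by_contra h0
  obtain ⟨c, r, hc, -, hv, -⟩ := h.support h0
  exact vt_ne_src T (h.pos.trans_le hc) hv.symm

lemma IsInterval.act_snk (h : IsInterval x i u d) (y : M) : y <• e T .snk = 0 := by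
  obtain ⟨a, rfl⟩ := h.gen y
  by_contra h0
  obtain ⟨c, r, -, hc, hv, -⟩ := h.support h0
  exact vt_ne_snk T (hc.trans_lt h.lt) hv.symm

lemma IsInterval.ne_zero (h : IsInterval x i u d) : x ≠ 0 := by
  rintro rfl
  exact h.ne (smul_zero _)

lemma exists_isInterval (hM : IsIndec (Alg T)ᵐᵒᵖ M) [Module.Finite (Alg T)ᵐᵒᵖ M]
    (hsrc : ∀ y : M, y <• e T .src = 0) (hsnk : ∀ y : M, y <• e T .snk = 0) :
    ∃ (x : M) (i : Fin T.t) (u d : ℕ), IsInterval x i u d := by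
  obtain ⟨z, hz⟩ := @exists_ne M hM.1 0
  obtain ⟨v, hv⟩ : ∃ v, z <• e T v ≠ 0 := by
    by_contra! h
    exact hz (by rw [← sum_act_e (T := T) z]; exact Finset.sum_eq_zero fun v _ => h v)
  obtain ⟨i, w, hw, hwl, rfl⟩ : ∃ i w, 0 < w ∧ w < T.ℓ i ∧ v = vt T i w := by
    rcases vt_exhaust T v with rfl | rfl | h
    · exact absurd (hsrc z) hv
    · exact absurd (hsnk z) hv
    · exact h
  have hex : ∃ u, ∃ y : M, y <• e T (vt T i u) ≠ 0 := ⟨w, z, hv⟩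
  obtain ⟨u, ⟨y, hy⟩, hmin⟩ : ∃ u, (∃ y : M, y <• e T (vt T i u) ≠ 0) ∧
      ∀ j < u, ∀ y : M, y <• e T (vt T i j) = 0 :=
    ⟨Nat.find hex, Nat.find_spec hex, fun j hj y => by
      by_contra h; exact Nat.find_min hex hj ⟨y, h⟩⟩
  have hul : u < T.ℓ i := by
    by_contra hul
    exact hv (hmin w (by omega) z)
  have hu : 0 < u := by
    rcases Nat.eq_zero_or_pos u with rfl | h
    · rw [vt_zero] at hy; exact absurd (hsrc y) hy
    · exact h
  obtain ⟨x, hx⟩ : ∃ x, x = y <• e T (vt T i u) := ⟨_, rfl⟩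
  have hxv : x <• e T (vt T i u) = x := by rw [hx, act_e_e]
  rw [← hx] at hy
  have hex' : ∃ d, x <• pp T i u (u + (d + 1)) = 0 := ⟨T.ℓ i - u - 1, by
    rw [show u + (T.ℓ i - u - 1 + 1) = T.ℓ i by omega, ← pp_mul_e T hul.le, vt_len, ← act_act, hsnk]⟩
  obtain ⟨S', hS'⟩ : ∃ S', IsCompl (Submodule.span (Alg T)ᵐᵒᵖ {x}) S' := by
    refine exists_isCompl_of_lift fun v => ?_
    rcases vt_exhaust T v with rfl | rfl | ⟨j, c, hc, hcl, rfl⟩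
    · exact Or.inl fun z hz => by rw [← hz, hsrc]; exact Submodule.zero_mem _
    · exact Or.inr (Or.inl rfl)
    by_cases hcu : j = i ∧ c < u
    · obtain ⟨rfl, hcu⟩ := hcu
      exact Or.inl fun z hz => by rw [← hz, hmin c hcu]; exact Submodule.zero_mem _
    refine Or.inr (Or.inr ⟨j, c, rfl, fun n hn => ?_, hc, hcl⟩)
    obtain ⟨a, rfl⟩ := Submodule.mem_span_singleton.1 hn
    change ∃ n' ∈ _, x <• a.unop <• _ = _
    have h1 : x <• a.unop <• e T (vt T j (c + 1)) =
        x <• (e T (vt T i u) * a.unop * e T (vt T j (c + 1))) := by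
      rw [← act_act, ← act_act, hxv]
    rcases (Nat.succ_le_of_lt hcl).lt_or_eq with h | h
    · by_cases hij : i = j
      · subst hij
        rcases e_mul_e_branch T hu hul.le hcl a.unop with ⟨huc, r, hr⟩ | ⟨-, hr⟩
        · refine ⟨x <• (r • pp T i u c), Submodule.smul_mem _ _ (Submodule.mem_span_singleton_self x),
            ?_⟩
          rw [h1, hr, act_act, smul_mul_assoc, ← pp_succ T (by omega)]
        · exact ⟨0, Submodule.zero_mem _, by rw [h1, hr, act_zero, smul_zero]⟩
      · exact ⟨0, Submodule.zero_mem _, by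
          rw [h1, e_mul_e_eq_zero_of_ne T hij hu hul (Nat.succ_pos c) h, act_zero, smul_zero]⟩
    · refine ⟨0, Submodule.zero_mem _, ?_⟩
      rw [← Nat.succ_eq_add_one, h, vt_len, hsnk, smul_zero]
  have htop := (hM.eq_bot_or_top hS').resolve_left fun h =>
    hy ((Submodule.span_singleton_eq_bot).1 h)
  have hne : x <• pp T i u (u + Nat.find hex') ≠ 0 := by
    rcases h : Nat.find hex' with _ | n
    · rwa [add_zero, pp_self, hxv]
    · exact Nat.find_min hex' (m := n) (by omega)
  refine ⟨x, i, u, u + Nat.find hex', hu, Nat.le_add_right _ _, ?_, hxv, fun y => ?_, hne,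
    Nat.find_spec hex'⟩
  · by_contra hlt
    refine hne ?_
    rw [← pp_mul_pp T hul.le (not_lt.1 hlt), ← act_act, ← pp_mul_e T hul.le, vt_len, ← act_act, hsnk,
      smul_zero]
  · obtain ⟨a, ha⟩ := Submodule.mem_span_singleton.1 (show y ∈ Submodule.span _ {x} by
      rw [htop]; trivial)
    exact ⟨a.unop, ha⟩

lemma IsInterval.of_map (h : IsInterval x i u d) {y : N} {j : Fin T.t} {u' d' : ℕ}
    (h' : IsInterval y j u' d') {f : M →ₗ[(Alg T)ᵐᵒᵖ] N} (hf : f ≠ 0) :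
    i = j ∧ u' ≤ u ∧ u ≤ d' ∧ d' ≤ d ∧ (u = u' → d = d' → Function.Bijective f) := by
  have hfx : f x ≠ 0 := fun h0 => hf (LinearMap.ext fun z => by
    obtain ⟨a, rfl⟩ := h.gen z
    rw [map_act, h0, smul_zero, LinearMap.zero_apply])
  obtain ⟨a, ha⟩ := h'.gen (f x)
  have hfe : f x <• e T (vt T i u) = f x := by rw [← map_act, h.hom]
  have h1 : y <• a <• e T (vt T i u) ≠ 0 := by rwa [ha, hfe]
  obtain ⟨c, r, hc, hc', hv, hr, har⟩ := h'.support h1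
  obtain ⟨rfl, rfl⟩ := vtx_interior_inj (h'.pos.trans_le hc) (hc'.trans_lt h'.lt) hv
  have hfx' : f x = y <• pp T i u' u <• algebraMap k (Alg T) r := by
    rw [← act_smul, ← har, ← act_act, ← act_act, h'.hom, ha, hfe]
  have key : ∀ c, u ≤ c → (f x <• pp T i u c ≠ 0 ↔ c ≤ d') := by
    intro c huc
    rw [← h'.ne_zero_iff (hc.trans huc), hfx', ← act_comm, act_act y, pp_mul_pp T hc huc]
    exact not_congr ⟨act_alg_cancel (T := T) hr, fun h => by rw [h, smul_zero]⟩
  refine ⟨rfl, hc, hc', ?_, ?_⟩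
  · by_contra hdd
    refine (key (d + 1) (h.le.trans (Nat.le_succ d))).2 (by omega) ?_
    rw [← map_act, h.eq, map_zero]
  rintro rfl rfl
  constructor
  · rw [injective_iff_map_eq_zero]
    intro z hz
    rw [← sum_act_e (T := T) z]
    refine Finset.sum_eq_zero fun v _ => ?_
    obtain ⟨b, rfl⟩ := h.gen z
    by_contra h0
    obtain ⟨c, s, hc1, hc2, rfl, hs, hsb⟩ := h.support h0
    refine (key c hc1).2 hc2 (act_alg_cancel (T := T) hs ?_)
    rw [← act_smul, ← hsb, ← act_act, ← act_act, hfe, ← map_act, hz, smul_zero]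
  · intro z
    obtain ⟨b, rfl⟩ := h'.gen z
    refine ⟨x <• algebraMap k (Alg T) r⁻¹ <• b, ?_⟩
    rw [map_act, map_act, hfx', pp_self, h'.hom, act_act y, ← map_mul, mul_inv_cancel₀ hr, map_one,
      act_one]

lemma weaklyShod_of_mDim_eq_zero (hm : mDim T = 0) : WeaklyShod (Alg T)ᵐᵒᵖ := by
  intro M hM hM' hL hR hcyc
  have hsrc : ∀ y : M, y <• e T .src = 0 := fun y => by
    by_contra hy; exact hR (inRightPart_of_src hm hM hM' hy)
  have hsnk : ∀ y : M, y <• e T .snk = 0 := fun y => by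
    by_contra hy; exact hL (inLeftPart_of_snk hm hM hM' hy)
  have : Module.Finite (Alg T)ᵐᵒᵖ M := hM'
  obtain ⟨x, i, u, d, hx⟩ := exists_isInterval hM hsrc hsnk
  have key : ∀ X Y, Step (Alg T)ᵐᵒᵖ X Y → ∀ (x : X) (i : Fin T.t) (u d : ℕ), IsInterval x i u d →
      (∃ y : Y, y <• e T .src ≠ 0) ∨ ∃ (y : Y) (j : Fin T.t) (u' d' : ℕ),
        IsInterval y j u' d' ∧ u' + d' < u + d := by
    rintro X Y ⟨-, -, h3, h4, f, hf, hfb⟩ x i u d hx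
    have : Module.Finite (Alg T)ᵐᵒᵖ Y := h4
    by_cases h : ∃ y : Y, y <• e T .src ≠ 0
    · exact Or.inl h
    push Not at h
    have hsnk : ∀ y : Y, y <• e T .snk = 0 := by
      intro y
      by_contra hy
      obtain ⟨z, hz⟩ := snk_of_map hm h3 hy hf
      exact hz (hx.act_snk z)
    obtain ⟨y, j, u', d', hy⟩ := exists_isInterval h3 h hsnk
    refine Or.inr ⟨y, j, u', d', hy, ?_⟩
    obtain ⟨-, h1, -, h2, hb⟩ := hx.of_map hy hf
    by_contra hlt
    exact hfb (hb (by omega) (by omega))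
  have hinv : ∀ Y, Relation.TransGen (Step (Alg T)ᵐᵒᵖ) M Y →
      (∃ y : Y, y <• e T .src ≠ 0) ∨ ∃ (y : Y) (j : Fin T.t) (u' d' : ℕ),
        IsInterval y j u' d' ∧ u' + d' < u + d := by
    intro Y h
    induction h with
    | single h => exact key _ _ h x i u d hx
    | tail _ h ih =>
      rcases ih with ⟨y, hy⟩ | ⟨y, j, u', d', hy, hlt⟩
      · obtain ⟨h1, h2, -, -, f, hf, -⟩ := h
        have : Module.Finite (Alg T)ᵐᵒᵖ _ := h2
        exact Or.inl (src_of_map hm h1 hy hf)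
      · rcases key _ _ h y j u' d' hy with h' | ⟨z, j', u'', d'', hz, hlt'⟩
        · exact Or.inl h'
        · exact Or.inr ⟨z, j', u'', d'', hz, hlt'.trans hlt⟩
  rcases hinv M hcyc with ⟨y, hy⟩ | ⟨y, j, u', d', hy, hlt⟩
  · exact hy (hsrc y)
  · have hid : (LinearMap.id : M →ₗ[(Alg T)ᵐᵒᵖ] M) ≠ 0 := fun h =>
      hx.ne_zero (LinearMap.congr_fun h x)
    obtain ⟨-, h1, -, h2, -⟩ := hx.of_map hy hid
    obtain ⟨-, h3, -, h4, -⟩ := hy.of_map hx hid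
    omega

end Supports

section NotMoreThanOneRel

variable {k : Type u} [Field k] {T : ToupieAlg k}
variable {M N : Type u} [AddCommGroup M] [Module (Alg T)ᵐᵒᵖ M] [AddCommGroup N]
  [Module (Alg T)ᵐᵒᵖ N]

lemma exists_zeroRel {i : Fin T.t} {s d : ℕ} (hsd : s < d) (hd : d ≤ T.ℓ i)
    (h : pp T i s d = 0) : ∃ a b, s ≤ a ∧ b ≤ d ∧ ZeroRel T i a b := by
  induction hn : d - s using Nat.strong_induction_on generalizing s d with
  | _ n ih =>
    by_cases h' : ∃ a b, s ≤ a ∧ b ≤ d ∧ a < b ∧ (a, b) ≠ (s, d) ∧ pp T i a b = 0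
    · obtain ⟨a, b, ha, hb, hab, hne, h0⟩ := h'
      have hne' : ¬ (a = s ∧ b = d) := fun h => hne (by rw [h.1, h.2])
      obtain ⟨a', b', ha', hb', hz⟩ := ih (b - a) (by omega) hab (hb.trans hd) h0 rfl
      exact ⟨a', b', ha.trans ha', hb'.trans hb, hz⟩
    · push Not at h'
      exact ⟨s, d, le_rfl, le_rfl, hsd, hd, (subE_mem_iff T hsd).2 h, fun a b ha hb hab hne hI =>
        h' a b ha hb hab hne ((subE_mem_iff T hab).1 hI)⟩

lemma pp_eq_zero_of_not_moreThanOneRel {i : Fin T.t} (h1 : ¬ MoreThanOneRel T i) {s u d : ℕ}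
    (hsd : s < d) (hd : d ≤ T.ℓ i) (hu : u < T.ℓ i) (h : pp T i s d = 0)
    (h' : pp T i u (T.ℓ i) = 0) : pp T i u d = 0 := by
  obtain ⟨a, b, ha, hb, hz⟩ := exists_zeroRel hsd hd h
  obtain ⟨a', b', ha', hb', hz'⟩ := exists_zeroRel hu le_rfl h'
  have heq : (a, b) = (a', b') := by
    by_contra hne
    exact h1 ⟨_, _, hne, hz, hz'⟩
  obtain ⟨rfl, rfl⟩ := Prod.mk.inj heq
  by_contra hne
  exact pp_ne_zero_of_subpath hne ha' hz.1.le hb ((subE_mem_iff T hz.1).1 hz.2.2.1)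

lemma IsInterval.projective {x : M} {i : Fin T.t} {u d : ℕ} (h : IsInterval x i u d)
    (h0 : pp T i u (d + 1) = 0) : Module.Projective (Alg T)ᵐᵒᵖ M := by
  have := Pm.projective (T := T) (vt T i u)
  refine Module.Projective.of_equiv (M := Pm (T := T) (vt T i u))
    (LinearEquiv.ofBijective (Pm.lift (vt T i u) x) ⟨?_, fun y => ?_⟩)
  · rw [injective_iff_map_eq_zero]
    rintro ⟨a, ha⟩ hxa
    rw [Pm.lift_apply] at hxa
    change x <• a = 0 at hxa
    rw [mem_Pm] at ha
    refine Subtype.ext ?_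
    change a = 0
    rw [← ha]
    refine e_mul_eq_zero h.pos (h.le.trans h.lt.le) fun c huc hcl => ?_
    obtain ⟨-, r, hr⟩ | ⟨hlt, -⟩ := e_mul_e_branch T h.pos (h.le.trans h.lt.le) hcl a
    · rcases le_or_gt c d with hcd | hcd
      · have h1 : x <• pp T i u c <• algebraMap k (Alg T) r = 0 := by
          rw [← act_smul, ← hr, ha, ← act_act, hxa, smul_zero]
        by_cases hr0 : r = 0
        · rw [hr, hr0, zero_smul]
        · exact absurd (act_alg_cancel hr0 h1) ((h.ne_zero_iff huc).2 hcd)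
      · have : pp T i u c = 0 := by
          rw [← pp_mul_pp T (h.le.trans (Nat.le_succ d)) hcd, h0, zero_mul]
        rw [hr, this, smul_zero]
    · omega
  · obtain ⟨a, rfl⟩ := h.gen y
    refine ⟨Pm.gen _ <• a, ?_⟩
    rw [map_act, Pm.lift_gen h.hom]

/-- A class of modules of projective dimension at most one which, when no branch carries more than
one relation, contains the projective at the source and is closed under predecessors. -/
def NearSource (M : Type u) [AddCommGroup M] [Module (Alg T)ᵐᵒᵖ M] : Prop :=
  Nonempty (M ≃ₗ[(Alg T)ᵐᵒᵖ] Pm (T := T) .src) ∨ (∃ x : M, x <• e T .snk ≠ 0) ∨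
    ∃ (x : M) (i : Fin T.t) (u d : ℕ), IsInterval x i u d ∧
      (pp T i u (T.ℓ i) ≠ 0 ∨ pp T i u (d + 1) = 0)

lemma NearSource.pdLeOne (hm : mDim T = 0) {X : ModuleCat.{u} (Alg T)ᵐᵒᵖ} (hX : Indec _ X)
    (hX' : FdMod _ X) (h : NearSource (T := T) X) : PdLeOne (Alg T)ᵐᵒᵖ X := by
  have : Module.Finite (Alg T)ᵐᵒᵖ X := hX'
  rcases h with ⟨⟨f⟩⟩ | ⟨x, hx⟩ | ⟨x, i, u, d, hx, h | h⟩
  · have := Pm.projective (T := T) .src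
    exact pdLeOne_of_projective (Module.Projective.of_equiv f.symm)
  · exact pdLeOne_of_snk hm hX hX' hx
  · refine pdLeOne_of_support (M := X) fun v y hy => ?_
    obtain ⟨a, rfl⟩ := hx.gen y
    obtain ⟨c, r, huc, hcd, rfl, -⟩ := hx.support hy
    exact Or.inr ⟨i, c, hx.pos.trans_le huc, hcd.trans_lt hx.lt, rfl,
      pp_ne_zero_of_subpath h huc (hcd.trans hx.lt.le) le_rfl⟩
  · exact pdLeOne_of_projective (hx.projective h)

lemma nonempty_equiv_of_map_src (hm : mDim T = 0) (hM : IsIndec (Alg T)ᵐᵒᵖ M)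
    [Module.Finite (Alg T)ᵐᵒᵖ M] {x : M} (hx : x <• e T .src ≠ 0)
    {f : M →ₗ[(Alg T)ᵐᵒᵖ] Pm (T := T) .src} (hf : f ≠ 0) :
    Nonempty (M ≃ₗ[(Alg T)ᵐᵒᵖ] Pm (T := T) .src) := by
  obtain ⟨y, hy⟩ : ∃ y : M, f (y <• e T .src) ≠ 0 := by
    by_contra! h
    refine hf (LinearMap.ext_on (span_src hm hM hx) ?_)
    rintro _ ⟨y, rfl⟩
    exact h y
  obtain ⟨r, hr⟩ := mul_e_src (T := T) (f y : Alg T)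
  have hfy : f (y <• e T .src) = Pm.gen (T := T) .src <• algebraMap k (Alg T) r := by
    refine Subtype.ext ?_
    rw [map_act, Pm.act_coe, hr, Pm.gen_act, ← Algebra.commutes, Algebra.smul_def]
  have hr0 : r ≠ 0 := by
    rintro rfl
    exact hy (by rw [hfy, map_zero, op_zero, zero_smul])
  have hsurj : Function.Surjective f := by
    intro z
    obtain ⟨a, rfl⟩ := Pm.exists_act _ z
    refine ⟨y <• e T .src <• algebraMap k (Alg T) r⁻¹ <• a, ?_⟩
    rw [map_act, map_act, hfy, act_act (Pm.gen _), ← map_mul, mul_inv_cancel₀ hr0, map_one, act_one]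
  have := Pm.projective (T := T) .src
  obtain ⟨s, hs⟩ := Module.projective_lifting_property f LinearMap.id hsurj
  exact ⟨(LinearEquiv.ofBijective s (hM.bijective_of_leftInverse (Pm.indec _).1
    (LinearMap.congr_fun hs))).symm⟩

lemma NearSource.of_map (hm : mDim T = 0) (h1 : ∀ i, ¬ MoreThanOneRel T i)
    (hM : IsIndec (Alg T)ᵐᵒᵖ M) [Module.Finite (Alg T)ᵐᵒᵖ M] (hN : IsIndec (Alg T)ᵐᵒᵖ N)
    [Module.Finite (Alg T)ᵐᵒᵖ N] {f : M →ₗ[(Alg T)ᵐᵒᵖ] N} (hf : f ≠ 0)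
    (h : NearSource (T := T) N) : NearSource (T := T) M := by
  by_cases hsnk : ∃ y : M, y <• e T .snk ≠ 0
  · exact Or.inr (Or.inl hsnk)
  have hN' : ¬ ∃ x : N, x <• e T .snk ≠ 0 := by
    rintro ⟨x, hx⟩
    exact hsnk (snk_of_map hm hN hx hf)
  by_cases hsrc : ∃ y : M, y <• e T .src ≠ 0
  · obtain ⟨y, hy⟩ := hsrc
    rcases h with ⟨⟨g⟩⟩ | h | ⟨x, i, u, d, hx, -⟩
    · refine Or.inl (nonempty_equiv_of_map_src hm hM hy (f := g.toLinearMap.comp f) fun h => hf ?_)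
      ext z
      exact g.injective ((LinearMap.congr_fun h z).trans (map_zero g).symm)
    · exact absurd h hN'
    · obtain ⟨z, hz⟩ := src_of_map hm hM hy hf
      exact absurd (hx.act_src z) hz
  push Not at hsrc hsnk
  obtain ⟨y, j, u, d, hy⟩ := exists_isInterval hM hsrc hsnk
  refine Or.inr (Or.inr ⟨y, j, u, d, hy, or_iff_not_imp_left.2 fun hu => ?_⟩)
  rw [not_not] at hu
  have hul := hy.le.trans_lt hy.lt
  rcases h with ⟨⟨g⟩⟩ | h | ⟨x, i, u', d', hx, h⟩
  · have hfy : g (f y) ≠ 0 := fun h0 => hf (LinearMap.ext fun z => by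
      obtain ⟨a, rfl⟩ := hy.gen z
      rw [map_act, (map_eq_zero_iff g g.injective).1 h0, smul_zero, LinearMap.zero_apply])
    have hact : ∀ a, ((g (f (y <• a)) : Pm (T := T) .src) : Alg T) = (g (f y) : Alg T) * a := by
      intro a
      rw [map_act, ← Pm.act_coe]
      exact congrArg _ (map_smul g _ _)
    obtain ⟨r, hr⟩ := e_mul_mul_e_smul (Nat.zero_le u) hul (g (f y) : Alg T)
    rw [← hact, hy.hom, vt_zero, mem_Pm.1 (g (f y)).2] at hr
    have hr0 : r ≠ 0 := by
      rintro rfl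
      exact hfy (Subtype.ext (by rw [hr, zero_smul]; rfl))
    have h0 := hact (pp T j u (d + 1))
    rw [hy.eq, map_zero, map_zero, hr, smul_mul_assoc, pp_mul_pp T (Nat.zero_le u)
      (hy.le.trans (Nat.le_succ d))] at h0
    exact pp_eq_zero_of_not_moreThanOneRel (h1 j) (Nat.succ_pos d) hy.lt hul
      ((smul_eq_zero_iff_right hr0).1 h0.symm) hu
  · exact absurd h hN'
  · obtain ⟨rfl, h2, h3, h4, -⟩ := hy.of_map hx hf
    have h0 : pp T j u' (d' + 1) = 0 := h.resolve_left fun h =>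
      pp_ne_zero_of_subpath h h2 hul.le le_rfl hu
    have h5 := pp_eq_zero_of_not_moreThanOneRel (h1 j) (by omega) hx.lt hul h0 hu
    rw [← pp_mul_pp T (by omega : u ≤ d' + 1) (by omega : d' + 1 ≤ d + 1), h5, zero_mul]

theorem quasitilted_of_not_moreThanOneRel (hm : mDim T = 0) (h1 : ∀ i, ¬ MoreThanOneRel T i) :
    Quasitilted (Alg T)ᵐᵒᵖ := by
  intro P hP hP' hproj
  refine ⟨hP, hP', fun X hX hX' hXP => ?_⟩
  refine NearSource.pdLeOne hm hX hX' ?_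
  have key : ∀ Y, Relation.TransGen (Step (Alg T)ᵐᵒᵖ) Y (ModuleCat.of _ (Pm (T := T) .src)) →
      NearSource (T := T) Y := by
    intro Y hY
    induction hY using Relation.TransGen.head_induction_on with
    | single h =>
      obtain ⟨h2, h3, h4, h5, f, hf, -⟩ := h
      have : Module.Finite (Alg T)ᵐᵒᵖ _ := h3
      exact NearSource.of_map hm h1 h2 h4 hf (Or.inl ⟨LinearEquiv.refl _ _⟩)
    | head h _ ih =>
      obtain ⟨h2, h3, h4, h5, f, hf, -⟩ := h
      have : Module.Finite (Alg T)ᵐᵒᵖ _ := h3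
      have : Module.Finite (Alg T)ᵐᵒᵖ _ := h5
      exact NearSource.of_map hm h1 h2 h4 hf ih
  rcases ((Reach.of_indPath hX hX' hXP).trans (reach_src_of_projective hP hP' hproj)).2.2.2.2 with
    h | h
  · exact Or.inl h
  · exact key X h

end NotMoreThanOneRel

section MoreThanOneRel

variable {k : Type u} [Field k] {T : ToupieAlg k}

lemma exists_zeroRel_lt {i : Fin T.t} (h : MoreThanOneRel T i) :
    ∃ a b a' b', a < a' ∧ b < b' ∧ ZeroRel T i a b ∧ ZeroRel T i a' b' := by
  have key : ∀ a b a' b', ZeroRel T i a b → ZeroRel T i a' b' → (a, b) ≠ (a', b') → a ≤ a' →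
      a < a' ∧ b < b' := by
    intro a b a' b' h h' hne haa
    have hbb : b < b' := by
      by_contra hbb
      exact h.2.2.2 a' b' haa (not_lt.1 hbb) h'.1 hne.symm h'.2.2.1
    refine ⟨lt_of_le_of_ne haa fun heq => ?_, hbb⟩
    exact h'.2.2.2 a b heq.ge hbb.le h.1 hne h.2.2.1
  obtain ⟨⟨a, b⟩, ⟨a', b'⟩, hne, h, h'⟩ := h
  rcases le_total a a' with hle | hle
  · obtain ⟨h1, h2⟩ := key a b a' b' h h' hne hle
    exact ⟨a, b, a', b', h1, h2, h, h'⟩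
  · obtain ⟨h1, h2⟩ := key a' b' a b h' h hne.symm hle
    exact ⟨a', b', a, b, h1, h2, h', h⟩

lemma ZeroRel.pp_eq_zero {i : Fin T.t} {a b : ℕ} (h : ZeroRel T i a b) : pp T i a b = 0 :=
  (subE_mem_iff T h.1).1 h.2.2.1

lemma ZeroRel.pp_ne_zero {i : Fin T.t} {a b : ℕ} (h : ZeroRel T i a b) {a' b' : ℕ} (ha : a ≤ a')
    (hb : b' ≤ b) (hab : a' < b') (hne : (a', b') ≠ (a, b)) : pp T i a' b' ≠ 0 :=
  fun h0 => h.2.2.2 a' b' ha hb hab hne ((subE_mem_iff T hab).2 h0)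

lemma ZeroRel.add_two_le {i : Fin T.t} {a b : ℕ} (h : ZeroRel T i a b) : a + 2 ≤ b := by
  by_contra hab
  have hb : b = a + 1 := by have := h.1; omega
  subst hb
  exact ar_ne_zero T (Nat.lt_of_succ_le h.2.1) (by rw [← pp_self_succ]; exact h.pp_eq_zero)

lemma exists_mul_pp {i : Fin T.t} {s c d : ℕ} (hsc : s < c) (hcd : c < d) (hd : d ≤ T.ℓ i)
    (hne : pp T i (s + 1) d ≠ 0) {y : Alg T} (hy : y * e T (vt T i c) = y)
    (h0 : y * pp T i c d = 0) : ∃ z, z * pp T i s c = y := by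
  have hcl : c < T.ℓ i := hcd.trans_le hd
  have hpath : ∀ j, j ≤ c → ∃ z, z * pp T i s c = e T (vt T i j) * y := by
    intro j hj
    obtain ⟨r, hr⟩ := e_mul_mul_e_smul hj hcl y
    rw [hy] at hr
    rcases le_or_gt j s with hjs | hjs
    · exact ⟨r • pp T i j s, by rw [smul_mul_assoc, pp_mul_pp T hjs hsc.le, hr]⟩
    · refine ⟨0, ?_⟩
      have h1 : r • pp T i j d = 0 := by
        rw [← pp_mul_pp T hj hcd.le, ← smul_mul_assoc, ← hr, mul_assoc, h0, mul_zero]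
      rcases smul_eq_zero.1 h1 with h | h
      · rw [hr, h, zero_smul, zero_mul]
      · exact absurd h (pp_ne_zero_of_subpath hne hjs (hj.trans hcd.le) le_rfl)
  have hall : ∀ v, ∃ z, z * pp T i s c = e T v * y := by
    intro v
    rcases vt_exhaust T v with rfl | rfl | ⟨j, w, hw, hwl, rfl⟩
    · simpa only [vt_zero] using hpath 0 (Nat.zero_le c)
    · obtain ⟨r, hr⟩ := e_snk_mul (T := T) y
      refine ⟨0, ?_⟩
      rw [zero_mul, ← hy, ← mul_assoc, hr, smul_mul_assoc, e_mul_of_ne T (vt_ne_snk T hcl).symm,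
        smul_zero]
    · by_cases hij : j = i
      · subst hij
        rcases le_or_gt w c with hwc | hwc
        · exact hpath w hwc
        · obtain ⟨h, -⟩ | ⟨-, h⟩ := e_mul_e_branch T hw hwl.le hcl.le y
          · omega
          · exact ⟨0, by rw [zero_mul, ← h, mul_assoc, hy]⟩
      · exact ⟨0, by
          rw [zero_mul, ← e_mul_e_eq_zero_of_ne T hij hw hwl (by omega) hcl y, mul_assoc, hy]⟩
  choose z hz using hall
  exact ⟨∑ v, z v, by rw [Finset.sum_mul, Finset.sum_congr rfl fun v _ => hz v, ← Finset.sum_mul,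
    sum_e, one_mul]⟩

lemma exists_act_pp {P : Type u} [AddCommGroup P] [Module (Alg T)ᵐᵒᵖ P]
    (hP : Module.Projective (Alg T)ᵐᵒᵖ P) {i : Fin T.t} {s c d : ℕ} (hsc : s < c) (hcd : c < d)
    (hd : d ≤ T.ℓ i) (hne : pp T i (s + 1) d ≠ 0) {y : P} (hy : y <• e T (vt T i c) = y)
    (h0 : y <• pp T i c d = 0) : ∃ z : P, z <• pp T i s c = y := by
  obtain ⟨σ, hσ⟩ := Module.projective_def'.1 hP
  have hcoord : ∀ m, ∃ z : Alg T, z * pp T i s c = (σ y m).unop := by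
    intro m
    refine exists_mul_pp hsc hcd hd hne ?_ ?_
    · have := congrArg (fun y => (σ y m).unop) hy
      simpa [map_act] using this
    · have := congrArg (fun y => (σ y m).unop) h0
      simpa [map_act] using this
  choose z hz using hcoord
  refine ⟨∑ m ∈ (σ y).support, m <• z m, ?_⟩
  have hsum : ∑ m ∈ (σ y).support, σ y m • m = y := LinearMap.congr_fun hσ y
  rw [Finset.smul_sum]
  refine (Finset.sum_congr rfl fun m _ => ?_).trans hsum
  rw [act_act, hz, op_unop]

lemma IsInterval.not_pdLeOne {X : Type u} [AddCommGroup X] [Module (Alg T)ᵐᵒᵖ X] {x : X}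
    {i : Fin T.t} {s d b : ℕ} (hx : IsInterval x i (s + 1) d) (hdb : d + 1 < b) (hb : b ≤ T.ℓ i)
    (h0 : pp T i (s + 1) b = 0) (h1 : pp T i (d + 1) b ≠ 0) (h2 : pp T i (s + 1) (d + 1) ≠ 0) :
    ¬ PdLeOne (Alg T)ᵐᵒᵖ (ModuleCat.of _ X) := by
  rintro ⟨P, f, hf, hP, hK⟩
  obtain ⟨q, hq⟩ := hf x
  change f q = x at hq
  have hsd := hx.le
  have hqK : q <• pp T i (s + 1) (d + 1) ∈ LinearMap.ker f := by
    rw [LinearMap.mem_ker, map_act, hq]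
    exact hx.eq
  obtain ⟨⟨z, hz⟩, hzq⟩ := exists_act_pp hK (s := d) (y := ⟨_, hqK⟩) (Nat.lt_succ_self d) hdb hb h1
    (Subtype.ext (by
      change q <• _ <• _ = q <• _
      rw [act_act, pp_mul_e T (by omega)]))
    (Subtype.ext (by
      change q <• _ <• _ = 0
      rw [act_act, pp_mul_pp T (by omega) hdb.le, h0, act_zero]))
  replace hzq : z <• pp T i d (d + 1) = q <• pp T i (s + 1) (d + 1) := congrArg Subtype.val hzq
  obtain ⟨w, hw⟩ := exists_act_pp hP (s := s) (y := q <• pp T i (s + 1) d - z <• e T (vt T i d))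
    (by omega) (Nat.lt_succ_self d) (by omega) h2
    (by rw [smul_sub, act_act, act_act, pp_mul_e T hsd, e_mul_self])
    (by rw [smul_sub, act_act, act_act, pp_mul_pp T hsd (Nat.le_succ d), e_mul_pp, hzq, sub_self])
  have hfw := congrArg f hw
  rw [map_sub, map_act, map_act, map_act, hq, LinearMap.mem_ker.1 hz, smul_zero, sub_zero] at hfw
  refine hx.ne (hfw.symm.trans ?_)
  obtain ⟨a, ha⟩ := hx.gen (f w)
  have h3 : f w <• e T (vt T i s) = 0 := by
    rw [← ha]
    by_contra h
    obtain ⟨c, r, hc, hcd, hv, -⟩ := hx.support h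
    have := vtx_inj (by omega) (hcd.trans hx.lt.le) hv
    omega
  rw [← e_mul_pp T, ← act_act, h3, smul_zero]

/-- The interval module supported at the vertices `u, …, d` of branch `i`. -/
abbrev Seg (T : ToupieAlg k) (i : Fin T.t) (u d : ℕ) : Type u :=
  Pm (T := T) (vt T i u) ⧸ Submodule.span (Alg T)ᵐᵒᵖ {Pm.gen (vt T i u) <• pp T i u (d + 1)}

/-- The generator of the interval module. -/
def Seg.gen (T : ToupieAlg k) (i : Fin T.t) (u d : ℕ) : Seg T i u d :=
  Submodule.Quotient.mk (Pm.gen (vt T i u))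

lemma Seg.isInterval {i : Fin T.t} {u d : ℕ} (hu : 0 < u) (hud : u ≤ d) (hd : d < T.ℓ i)
    (h : pp T i u d ≠ 0) : IsInterval (Seg.gen T i u d) i u d where
  pos := hu
  le := hud
  lt := hd
  hom := congrArg Submodule.Quotient.mk (Pm.gen_act_e _)
  gen y := by
    obtain ⟨y, rfl⟩ := Submodule.Quotient.mk_surjective _ y
    obtain ⟨a, rfl⟩ := Pm.exists_act _ y
    exact ⟨a, rfl⟩
  ne h0 := by
    obtain ⟨a, ha⟩ := Submodule.mem_span_singleton.1 ((Submodule.Quotient.mk_eq_zero _).1 h0)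
    have h1 : pp T i u (d + 1) * a.unop = pp T i u d := by
      have := congrArg (Subtype.val) ha
      change e T _ * pp T i u (d + 1) * a.unop = e T _ * pp T i u d at this
      rwa [e_mul_pp, e_mul_pp] at this
    have h2 := congrArg (· * e T (vt T i d)) h1
    simp only [pp_mul_e T hud] at h2
    rw [← pp_mul_e T (hud.trans (Nat.le_succ d)), mul_assoc, mul_assoc, ← mul_assoc (e T _)] at h2
    obtain ⟨h3, -⟩ | ⟨-, h3⟩ := e_mul_e_branch T (Nat.succ_pos d) hd hd.le a.unop
    · omega
    · rw [h3, mul_zero] at h2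
      exact h h2.symm
  eq := (Submodule.Quotient.mk_eq_zero _).2 (Submodule.mem_span_singleton_self _)

lemma Seg.reach {i : Fin T.t} {u d : ℕ} (hu : 0 < u) (hud : u ≤ d) (hd : d < T.ℓ i)
    (h : pp T i u d ≠ 0) {N : ModuleCat.{u} (Alg T)ᵐᵒᵖ} (hN : Indec _ N) (hN' : FdMod _ N) {y : N}
    (hy : y ≠ 0) (hyu : y <• e T (vt T i u) = y) (h0 : y <• pp T i u (d + 1) = 0) :
    Reach (ModuleCat.of (Alg T)ᵐᵒᵖ (Seg T i u d)) N := by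
  have hI := Seg.isInterval hu hud hd h
  refine Reach.of_map (isIndec_of_cyclic hI.ne_zero hI.hom hI.gen)
    (inferInstanceAs (Module.Finite _ (Seg T i u d))) hN hN'
    (f := Submodule.liftQ _ (Pm.lift (vt T i u) y) ?_) fun hf => hy ?_
  · rw [Submodule.span_singleton_le_iff_mem, LinearMap.mem_ker, map_act, Pm.lift_gen hyu, h0]
  · rw [← Pm.lift_gen hyu]
    exact LinearMap.congr_fun hf (Seg.gen T i u d)

lemma Seg.reach_simple {i : Fin T.t} {w : ℕ} (hw : 0 < w) (n : ℕ) (hwn : w + n < T.ℓ i) :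
    Reach (ModuleCat.of (Alg T)ᵐᵒᵖ (Seg T i (w + n) (w + n)))
      (ModuleCat.of (Alg T)ᵐᵒᵖ (Seg T i w w)) := by
  have hself : ∀ j, pp T i j j ≠ 0 := fun j => by rw [pp_self]; exact e_ne_zero T _
  have hint : ∀ j, 0 < j → j < T.ℓ i → IsInterval (Seg.gen T i j j) i j j := fun j hj hjl =>
    Seg.isInterval hj le_rfl hjl (hself j)
  induction n with
  | zero =>
    have h := hint w hw hwn
    exact Reach.refl (isIndec_of_cyclic h.ne_zero h.hom h.gen)
      (inferInstanceAs (Module.Finite _ (Seg T i w w)))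
  | succ n ih =>
    rw [← add_assoc] at hwn ⊢
    have hne : pp T i (w + n) (w + n + 1) ≠ 0 := by
      rw [pp_self_succ]; exact ar_ne_zero T (by omega)
    have hpos : 0 < w + n := by omega
    have hle : w + n ≤ w + n + 1 := by omega
    have h1 := Seg.isInterval hpos hle hwn hne
    have h2 := hint (w + n) hpos (by omega)
    refine (Seg.reach (Nat.succ_pos _) le_rfl hwn (hself _) (N := ModuleCat.of _ (Seg T i (w + n)
      (w + n + 1))) (isIndec_of_cyclic h1.ne_zero h1.hom h1.gen)
      (inferInstanceAs (Module.Finite _ (Seg T i _ _))) h1.ne ?_ ?_).trans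
      ((Seg.reach hpos hle hwn hne (N := ModuleCat.of _ (Seg T i (w + n)
      (w + n))) (isIndec_of_cyclic h2.ne_zero h2.hom h2.gen)
      (inferInstanceAs (Module.Finite _ (Seg T i _ _))) h2.ne_zero h2.hom ?_).trans (ih (by omega)))
    · exact (act_act _ _ _).trans (by rw [pp_mul_e T hle])
    · refine (act_act _ _ _).trans ?_
      rw [pp_mul_pp T hle (Nat.le_succ _)]
      exact h1.eq
    · by_contra h
      have := (h2.ne_zero_iff (by omega)).1 h
      omega

theorem not_quasitilted_of_moreThanOneRel {i : Fin T.t} (h : MoreThanOneRel T i) :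
    ¬ Quasitilted (Alg T)ᵐᵒᵖ := by
  obtain ⟨a, b, a', b', haa, hbb, hz, hz'⟩ := exists_zeroRel_lt h
  obtain ⟨s, rfl⟩ : ∃ s, a' = s + 1 := ⟨a' - 1, by omega⟩
  intro hQ
  have hab := hz.add_two_le
  have hab' := hz'.add_two_le
  have hbl := hz'.2.1
  have hne : ∀ c d, s + 1 ≤ c → c < d → d ≤ b' → (c, d) ≠ (s + 1, b') → pp T i c d ≠ 0 :=
    fun c d h1 h2 h3 h4 => hz'.pp_ne_zero h1 h3 h2 h4
  obtain ⟨d, hd⟩ : ∃ d, d = max (s + 1) (b - 1) := ⟨_, rfl⟩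
  have hsd : s + 1 ≤ d := by omega
  have hdb : d + 1 < b' := by omega
  have h1 : pp T i (d + 1) b' ≠ 0 := hne _ _ (by omega) (by omega) le_rfl
    (by rw [Ne, Prod.mk.injEq]; omega)
  have h2 : pp T i (s + 1) (d + 1) ≠ 0 := hne _ _ (by omega) (by omega) (by omega)
    (by rw [Ne, Prod.mk.injEq]; omega)
  have h3 : pp T i (s + 1) d ≠ 0 :=
    pp_ne_zero_of_subpath h2 le_rfl hsd (Nat.le_succ d)
  have hI := Seg.isInterval (by omega) hsd (by omega) h3
  have hfin : FdMod (Alg T)ᵐᵒᵖ (ModuleCat.of _ (Seg T i (s + 1) d)) :=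
    inferInstanceAs (Module.Finite _ (Seg T i (s + 1) d))
  have hlast : ∀ w, a < w → w < b → Reach (ModuleCat.of (Alg T)ᵐᵒᵖ (Seg T i w (b - 1)))
      (ModuleCat.of _ (Pm (T := T) (vt T i a))) := by
    intro w haw hwb
    have hb1 : b - 1 + 1 = b := by omega
    have hne1 : pp T i w (b - 1) ≠ 0 := by
      rcases (Nat.le_sub_one_of_lt hwb).eq_or_lt with h | h
      · rw [← h, pp_self]; exact e_ne_zero T _
      · exact hz.pp_ne_zero haw.le (by omega) h (by rw [Ne, Prod.mk.injEq]; omega)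
    refine Seg.reach (by omega) (by omega) (by omega) hne1
      (y := (Pm.gen (vt T i a) <• pp T i a w : Pm (T := T) (vt T i a)))
      (Pm.indec _) (Pm.finite _) (fun h0 => ?_) (Subtype.ext ?_) (Subtype.ext ?_)
    · refine hz.pp_ne_zero le_rfl hwb.le haw (by rw [Ne, Prod.mk.injEq]; omega) ?_
      rw [← e_mul_pp T]
      exact congrArg Subtype.val h0
    · change e T _ * pp T i a w * e T _ = e T _ * pp T i a w
      rw [mul_assoc, pp_mul_e T haw.le]
    · change e T _ * pp T i a w * pp T i w _ = 0
      rw [mul_assoc, pp_mul_pp T haw.le (by omega), hb1, hz.pp_eq_zero, mul_zero]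
  have hreach : Reach (ModuleCat.of (Alg T)ᵐᵒᵖ (Seg T i (s + 1) d))
      (ModuleCat.of _ (Pm (T := T) (vt T i a))) := by
    rcases le_or_gt b (s + 1) with hbs | hbs
    · obtain ⟨n, hn⟩ : ∃ n, s + 1 = b - 1 + n := ⟨s + 1 - (b - 1), by omega⟩
      have hdn : d = b - 1 + n := by omega
      rw [hdn, hn]
      exact (Seg.reach_simple (by omega) n (by omega)).trans (hlast _ (by omega) (by omega))
    · have hdb' : d = b - 1 := by omega
      rw [hdb']
      exact hlast _ haa hbs
  refine hI.not_pdLeOne hdb hbl hz'.pp_eq_zero h1 h2 ?_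
  have hproj := Pm.projective (T := T) (vt T i a)
  obtain ⟨-, -, hL⟩ := hQ (ModuleCat.of _ (Pm (T := T) (vt T i a))) (Pm.indec _) (Pm.finite _) hproj
  rcases hreach.2.2.2.2 with ⟨⟨f⟩⟩ | h
  · exact pdLeOne_of_projective (Module.Projective.of_equiv f.symm)
  · exact hL _ hreach.1 hfin h.to_reflTransGen

end MoreThanOneRel

end Toupie

namespace Toupie

/-- A toupie algebra `A = kQ/I` (with `t ≥ 2` branches and
`m = dim_k e₀ A e∞`) is weakly shod and not quasitilted if and only if `m = 0` and at
least one branch carries more than one relation. -/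
theorem weaklyShod_not_quasitilted_iff {k : Type u} [Field k] (T : ToupieAlg k) :
    (WeaklyShod (Alg T)ᵐᵒᵖ ∧ ¬ Quasitilted (Alg T)ᵐᵒᵖ) ↔
      (mDim T = 0 ∧ ∃ i : Fin T.t, MoreThanOneRel T i) := by
  constructor
  · rintro ⟨hW, hQ⟩
    have hm : mDim T = 0 := by
      by_contra hm
      exact hQ (quasitilted_of_weaklyShod hm hW)
    refine ⟨hm, ?_⟩
    by_contra! h
    exact hQ (quasitilted_of_not_moreThanOneRel hm h)
  · rintro ⟨hm, i, hi⟩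
    exact ⟨weaklyShod_of_mDim_eq_zero hm, not_quasitilted_of_moreThanOneRel hi⟩

end Toupie
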